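/- Let f ∈ ℚ[x] be a nonzero polynomial of degree d with leading coefficient c_d. The following are equivalent: (1) f is a sum of four squares in ℚ[x]; (2) c_d > 0 and for every monic irreducible polynomial p ∈ ℚ[x] dividing f with odd multiplicity, −1 is a sum of two squares in the quotient ring ℚ[x]/(p(x)); (3) f(t) ≥ 0 for all t ∈ ℝ, and every monic irreducible factor of odd multiplicity of the image of f in ℚ₂[x] has even degree. -/

import Mathlib

open Polynomial


namespace Pourchet

/-- Sum of four squares. -/
def Sum4 {R : Type*} [CommRing R] (x : R) : Prop :=
  ∃ a b c d : R, x = a ^ 2 + b ^ 2 + c ^ 2 + d ^ 2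

theorem Sum4.mul {R : Type*} [CommRing R] {x y : R} (hx : Sum4 x) (hy : Sum4 y) :
    Sum4 (x * y) := by
  obtain ⟨a, b, c, d, rfl⟩ := hx
  obtain ⟨p, q, r, s, rfl⟩ := hy
  exact ⟨a * p + b * q + c * r + d * s, a * q - b * p + c * s - d * r,
    a * r - c * p + d * q - b * s, a * s - d * p + b * r - c * q, by ring⟩

theorem Sum4.sq {R : Type*} [CommRing R] (x : R) : Sum4 (x ^ 2) := ⟨x, 0, 0, 0, by ring⟩

theorem sum4_rat (c : ℚ) (hc : 0 ≤ c) : Sum4 c := by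
  obtain ⟨a, b, e, d, h⟩ := Nat.sum_four_squares (c.num.toNat * c.den)
  have hd : (c.den : ℚ) ≠ 0 := by exact_mod_cast c.den_ne_zero
  have hn : ((c.num.toNat : ℕ) : ℚ) = c.num := by
    have : ((c.num.toNat : ℕ) : ℤ) = c.num := Int.toNat_of_nonneg (Rat.num_nonneg.mpr hc)
    exact_mod_cast this
  refine ⟨a / c.den, b / c.den, e / c.den, d / c.den, ?_⟩
  have h2 : ((a : ℚ) ^ 2 + b ^ 2 + e ^ 2 + d ^ 2) = c.num * c.den := by
    rw [← hn]; exact_mod_cast h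
  have h3 : c * c.den = c.num := Rat.mul_den_eq_num c
  field_simp
  rw [h2, ← h3]; ring

theorem sum4_zero {p q r s : ℚ[X]} (h : p ^ 2 + q ^ 2 + r ^ 2 + s ^ 2 = 0) :
    p = 0 ∧ q = 0 ∧ r = 0 ∧ s = 0 := by
  have key : ∀ t : ℚ, eval t p = 0 ∧ eval t q = 0 ∧ eval t r = 0 ∧ eval t s = 0 := by
    intro t
    have := congrArg (eval t) h
    simp only [eval_add, eval_pow, eval_zero] at this
    have h1 := sq_nonneg (eval t p)
    have h2 := sq_nonneg (eval t q)
    have h3 := sq_nonneg (eval t r)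
    have h4 := sq_nonneg (eval t s)
    refine ⟨?_, ?_, ?_, ?_⟩ <;> refine pow_eq_zero_iff (two_ne_zero) |>.mp ?_ <;> linarith
  refine ⟨?_, ?_, ?_, ?_⟩ <;> apply Polynomial.funext <;> intro t <;> simp [key t]

theorem leadingCoeff_nonneg_of_eval_nonneg (f : ℝ[X]) (h : ∀ t : ℝ, 0 ≤ eval t f) :
    0 ≤ f.leadingCoeff := by
  by_contra hc
  push Not at hc
  by_cases hd : 0 < f.degree
  · have := f.tendsto_atBot_of_leadingCoeff_nonpos hd hc.le
    obtain ⟨t, ht⟩ := (this.eventually (Filter.eventually_lt_atBot 0)).exists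
    exact absurd (h t) (not_le.mpr ht)
  · rw [eq_C_of_degree_le_zero (not_lt.mp hd)] at hc h
    have := h 0
    simp at this hc
    linarith

theorem leadingCoeff_pos_rat (f : ℚ[X]) (hf : f ≠ 0) (h : ∀ t : ℝ, 0 ≤ aeval t f) :
    0 < f.leadingCoeff := by
  have h1 := leadingCoeff_nonneg_of_eval_nonneg (f.map (algebraMap ℚ ℝ)) (by
    intro t; rw [eval_map_algebraMap]; exact h t)
  rw [leadingCoeff_map] at h1
  have h2 : 0 ≤ f.leadingCoeff := by
    have : (0 : ℝ) ≤ ((f.leadingCoeff : ℚ) : ℝ) := h1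
    exact_mod_cast this
  exact lt_of_le_of_ne h2 (Ne.symm (leadingCoeff_ne_zero.mpr hf))

theorem Sum4.aeval_nonneg {f : ℚ[X]} (h : Sum4 f) (t : ℝ) : 0 ≤ aeval t f := by
  obtain ⟨a, b, c, d, rfl⟩ := h
  simp only [map_add, map_pow]
  positivity

theorem natDegree_sum4_lt {F : Type*} [Field F] {a b c d : F[X]} {n : ℕ}
    (ha : a.natDegree < n) (hb : b.natDegree < n)
    (hc : c.natDegree < n) (hd : d.natDegree < n) :
    (a ^ 2 + b ^ 2 + c ^ 2 + d ^ 2).natDegree < 2 * n := by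
  have key : ∀ x : F[X], x.natDegree < n → (x ^ 2).natDegree ≤ 2 * (n - 1) := by
    intro x hx
    rw [natDegree_pow]; omega
  have : (a ^ 2 + b ^ 2 + c ^ 2 + d ^ 2).natDegree ≤ 2 * (n - 1) :=
    natDegree_add_le_of_degree_le (natDegree_add_le_of_degree_le
      (natDegree_add_le_of_degree_le (key a ha) (key b hb)) (key c hc)) (key d hd)
  omega

theorem descent (p : ℚ[X]) (hp : p.Monic) (hirr : Irreducible p) :
    ∀ n : ℕ, ∀ q : ℚ[X], q ≠ 0 → q.natDegree = n → q.natDegree < p.natDegree → Sum4 (p * q) →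
      Sum4 p := by
  intro n
  induction n using Nat.strong_induction_on with
  | _ n ih =>
  intro q hq hn hlt hs
  have hpq := hs
  obtain ⟨p1, p2, p3, p4, h⟩ := hs
  have d1 := EuclideanDomain.div_add_mod p1 q
  have d2 := EuclideanDomain.div_add_mod p2 q
  have d3 := EuclideanDomain.div_add_mod p3 q
  have d4 := EuclideanDomain.div_add_mod p4 q
  set r1 := p1 % q with hr1
  set r2 := p2 % q with hr2
  set r3 := p3 % q with hr3
  set r4 := p4 % q with hr4
  set k1 := p1 / q
  set k2 := p2 / q
  set k3 := p3 / q
  set k4 := p4 / q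
  obtain ⟨s, hsdef⟩ : ∃ s, s = p - 2 * (r1 * k1 + r2 * k2 + r3 * k3 + r4 * k4)
      - q * (k1 ^ 2 + k2 ^ 2 + k3 ^ 2 + k4 ^ 2) := ⟨_, rfl⟩
  have h2 : r1 ^ 2 + r2 ^ 2 + r3 ^ 2 + r4 ^ 2 = q * s := by
    rw [← d1, ← d2, ← d3, ← d4] at h
    rw [hsdef]
    linear_combination -h
  by_cases hs0 : s = 0
  · rw [hs0, mul_zero] at h2
    obtain ⟨e1, e2, e3, e4⟩ := sum4_zero h2
    have hp' : p = q * (k1 ^ 2 + k2 ^ 2 + k3 ^ 2 + k4 ^ 2) := by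
      rw [e1, e2, e3, e4, hs0] at hsdef
      linear_combination -hsdef
    have hqu : IsUnit q := by
      rcases hirr.isUnit_or_isUnit hp' with h | h
      · exact h
      · exfalso
        rw [hp', natDegree_mul hq h.ne_zero, natDegree_eq_zero_of_isUnit h] at hlt
        omega
    obtain ⟨c, hc, rfl⟩ := Polynomial.isUnit_iff.mp hqu
    have hc0 : 0 ≤ c := by
      have hne : p * C c ≠ 0 := mul_ne_zero hp.ne_zero hq
      have := leadingCoeff_pos_rat _ hne hpq.aeval_nonneg
      simp [hp.leadingCoeff] at this
      exact this.le
    rw [hp']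
    refine Sum4.mul ?_ ⟨_, _, _, _, rfl⟩
    obtain ⟨a, b, d, e, hh⟩ := sum4_rat c hc0
    refine ⟨C a, C b, C d, C e, ?_⟩
    rw [hh]; simp
  · have hqd : 0 < q.natDegree := by
      by_contra hcon
      have hq0 : q.natDegree = 0 := by omega
      have hu : IsUnit q := by
        rw [eq_C_of_natDegree_eq_zero hq0] at hq ⊢
        exact isUnit_C.mpr (isUnit_iff_ne_zero.mpr (by simpa using hq))
      have hz : ∀ x : ℚ[X], x % q = 0 := fun x => EuclideanDomain.mod_eq_zero.mpr hu.dvd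
      rw [hr1, hr2, hr3, hr4, hz, hz, hz, hz] at h2
      simp at h2
      tauto
    have hmod : ∀ x : ℚ[X], (x % q).natDegree < q.natDegree := fun x =>
      natDegree_mod_lt x hqd.ne'
    have hdeg := natDegree_sum4_lt (hmod p1) (hmod p2) (hmod p3) (hmod p4)
    rw [← hr1, ← hr2, ← hr3, ← hr4, h2, natDegree_mul hq hs0] at hdeg
    refine ih s.natDegree (by omega) s hs0 rfl (by omega) ?_
    refine ⟨s + (k1 * r1 + k2 * r2 + k3 * r3 + k4 * r4),
      k1 * r2 - k2 * r1 + k3 * r4 - k4 * r3, k1 * r3 - k3 * r1 + k4 * r2 - k2 * r4,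
      k1 * r4 - k4 * r1 + k2 * r3 - k3 * r2, ?_⟩
    rw [← d1, ← d2, ← d3, ← d4] at h
    have hq2 : q ^ 2 ≠ 0 := pow_ne_zero _ hq
    apply mul_left_cancel₀ hq2
    have hh : q * s * (p * q) = q * s * ((q * k1 + r1) ^ 2 + (q * k2 + r2) ^ 2
      + (q * k3 + r3) ^ 2 + (q * k4 + r4) ^ 2) := by rw [h]
    have e : q * s * ((q * k1 + r1) ^ 2 + (q * k2 + r2) ^ 2
      + (q * k3 + r3) ^ 2 + (q * k4 + r4) ^ 2) = (r1 ^ 2 + r2 ^ 2 + r3 ^ 2 + r4 ^ 2) * ((q * k1 + r1) ^ 2 + (q * k2 + r2) ^ 2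
      + (q * k3 + r3) ^ 2 + (q * k4 + r4) ^ 2) := by rw [h2]
    have e2 : q * (s + (k1 * r1 + k2 * r2 + k3 * r3 + k4 * r4)) =
      r1 ^ 2 + r2 ^ 2 + r3 ^ 2 + r4 ^ 2 + q * (k1 * r1 + k2 * r2 + k3 * r3 + k4 * r4) := by
      rw [h2]; ring
    calc q ^ 2 * (p * s) = q * s * (p * q) := by ring
      _ = _ := hh
      _ = _ := e
      _ = (r1 ^ 2 + r2 ^ 2 + r3 ^ 2 + r4 ^ 2 + q * (k1 * r1 + k2 * r2 + k3 * r3 + k4 * r4)) ^ 2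
          + q ^ 2 * ((k1 * r2 - k2 * r1 + k3 * r4 - k4 * r3) ^ 2 +
            (k1 * r3 - k3 * r1 + k4 * r2 - k2 * r4) ^ 2 +
            (k1 * r4 - k4 * r1 + k2 * r3 - k3 * r2) ^ 2) := by ring
      _ = _ := by rw [← e2]; ring

theorem sum4_of_irreducible (p : ℚ[X]) (hp : p.Monic) (hirr : Irreducible p)
    (h : ∃ u v : ℚ[X] ⧸ Ideal.span {p}, u ^ 2 + v ^ 2 = -1) : Sum4 p := by
  obtain ⟨u, v, huv⟩ := h
  obtain ⟨a, rfl⟩ := Ideal.Quotient.mk_surjective u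
  obtain ⟨b, rfl⟩ := Ideal.Quotient.mk_surjective v
  have h1 : p ∣ 1 ^ 2 + a ^ 2 + b ^ 2 + 0 ^ 2 := by
    rw [← Ideal.mem_span_singleton, ← Ideal.Quotient.eq_zero_iff_mem]
    simp only [map_add, map_pow, map_one, map_zero]
    linear_combination huv
  have hpd : 0 < p.natDegree := hirr.natDegree_pos
  have h2 : p ∣ 1 ^ 2 + (a % p) ^ 2 + (b % p) ^ 2 + 0 ^ 2 := by
    have d1 := EuclideanDomain.div_add_mod a p
    have d2 := EuclideanDomain.div_add_mod b p
    have : 1 ^ 2 + (a % p) ^ 2 + (b % p) ^ 2 + 0 ^ 2 = (1 ^ 2 + a ^ 2 + b ^ 2 + 0 ^ 2)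
      - p * (p * (a / p) ^ 2 + 2 * (a / p) * (a % p) + (p * (b / p) ^ 2 + 2 * (b / p) * (b % p))) := by
      conv_rhs => rw [show (1 ^ 2 + a ^ 2 + b ^ 2 + 0 ^ 2 : ℚ[X]) = 1 ^ 2 + (p * (a / p) + a % p) ^ 2
        + (p * (b / p) + b % p) ^ 2 + 0 ^ 2 by rw [d1, d2]]
      ring
    rw [this]
    exact dvd_sub h1 (dvd_mul_right _ _)
  obtain ⟨q, hq⟩ := h2
  have hq0 : q ≠ 0 := by
    rintro rfl
    rw [mul_zero] at hq
    exact one_ne_zero (sum4_zero hq).1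
  refine descent p hp hirr q.natDegree q hq0 rfl ?_ ⟨_, _, _, _, hq.symm⟩
  have := natDegree_sum4_lt (a := (1 : ℚ[X])) (b := a % p) (c := b % p) (d := 0) (n := p.natDegree)
    (by simpa using hpd) (natDegree_mod_lt _ hpd.ne') (natDegree_mod_lt _ hpd.ne') (by simpa using hpd)
  rw [hq, natDegree_mul hp.ne_zero hq0] at this
  omega

theorem two_imp_one (f : ℚ[X]) (hf : f ≠ 0) (h0 : 0 < f.leadingCoeff)
    (h : ∀ p : ℚ[X], p.Monic → Irreducible p →
            (∃ m : ℕ, Odd m ∧ p ^ m ∣ f ∧ ¬ p ^ (m + 1) ∣ f) →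
            ∃ u v : ℚ[X] ⧸ Ideal.span {p}, u ^ 2 + v ^ 2 = -1) : Sum4 f := by
  -- strong induction on degree
  suffices H : ∀ n : ℕ, ∀ f : ℚ[X], f ≠ 0 → f.natDegree = n → 0 < f.leadingCoeff →
      (∀ p : ℚ[X], p.Monic → Irreducible p →
            (∃ m : ℕ, Odd m ∧ p ^ m ∣ f ∧ ¬ p ^ (m + 1) ∣ f) →
            ∃ u v : ℚ[X] ⧸ Ideal.span {p}, u ^ 2 + v ^ 2 = -1) → Sum4 f from
    H _ f hf rfl h0 h
  intro n
  induction n using Nat.strong_induction_on with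
  | _ n ih =>
  intro f hf hn h0 h
  by_cases hu : f.natDegree = 0
  · rw [eq_C_of_natDegree_eq_zero hu] at h0 ⊢
    rw [leadingCoeff_C] at h0
    obtain ⟨a, b, d, e, hh⟩ := sum4_rat _ h0.le
    refine ⟨C a, C b, C d, C e, ?_⟩
    rw [hh]; simp
  · have hnu : ¬ IsUnit f := fun hh => hu (natDegree_eq_zero_of_isUnit hh)
    obtain ⟨p, hpm, hpi, hpf⟩ := Polynomial.exists_monic_irreducible_factor f hnu
    have hfin : FiniteMultiplicity p f := by
      exact FiniteMultiplicity.of_prime_left hpi.prime hf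
    obtain ⟨g, hg, hpg⟩ := hfin.exists_eq_pow_mul_and_not_dvd
    set m := multiplicity p f
    have hm : 0 < m := by
      by_contra hcon
      have : m = 0 := by omega
      rw [this, pow_zero, one_mul] at hg
      exact hpg (hg ▸ hpf)
    have hg0 : g ≠ 0 := by rintro rfl; simp at hg; exact hf hg
    have hpd := hpi.natDegree_pos
    have hdeg : f.natDegree = m * p.natDegree + g.natDegree := by
      rw [hg, natDegree_mul (pow_ne_zero _ hpm.ne_zero) hg0, natDegree_pow]
    have hlc : f.leadingCoeff = g.leadingCoeff := by
      rw [hg, leadingCoeff_mul, leadingCoeff_pow, hpm.leadingCoeff, one_pow, one_mul]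
    have hgs : Sum4 g := by
      refine ih g.natDegree (by nlinarith) g hg0 rfl (hlc ▸ h0) ?_
      rintro r hrm hri ⟨k, hk, hkd, hkn⟩
      refine h r hrm hri ⟨k, hk, hg ▸ hkd.mul_left _, ?_⟩
      intro hcon
      have hrp : r ≠ p := by
        rintro rfl
        exact hpg ((dvd_pow_self r hk.pos.ne').trans hkd)
      have hcop : IsCoprime (r ^ (k + 1)) (p ^ m) := by
        apply IsCoprime.pow
        refine (hri.coprime_iff_not_dvd.mpr ?_)
        intro hd
        have := (hri.associated_of_dvd hpi hd)
        exact hrp (eq_of_monic_of_associated hrm hpm this)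
      rw [hg] at hcon
      exact hkn (hcop.dvd_of_dvd_mul_left hcon)
    rw [hg]
    refine Sum4.mul ?_ hgs
    rcases Nat.even_or_odd m with ⟨k, hk⟩ | hodd
    · rw [hk, ← two_mul, mul_comm, pow_mul]; exact Sum4.sq _
    · have hp4 : Sum4 p := by
        refine sum4_of_irreducible p hpm hpi (h p hpm hpi ⟨m, hodd, hg ▸ dvd_mul_right _ _, ?_⟩)
        intro hcon
        rw [hg, pow_succ] at hcon
        exact hpg ((mul_dvd_mul_iff_left (pow_ne_zero _ hpm.ne_zero)).mp hcon)
      obtain ⟨k, hk⟩ := hodd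
      rw [hk, pow_succ, mul_comm 2, pow_mul]
      exact (Sum4.sq _).mul hp4

/-! ### (1) implies (3) -/

theorem zmod8 : ∀ a b c d : ZMod 8, a ^ 2 + b ^ 2 + c ^ 2 + d ^ 2 = 0 → 4 * a = 0 := by decide +revert

theorem aniso_int (x y z w : ℤ_[2]) (h : x ^ 2 + y ^ 2 + z ^ 2 + w ^ 2 = 0) : ‖x‖ < 1 := by
  have h1 := congrArg (PadicInt.toZModPow 3) h
  simp only [map_add, map_pow, map_zero] at h1
  have h2 := zmod8 _ _ _ _ h1
  by_contra hc
  have hx : IsUnit x := by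
    rw [PadicInt.isUnit_iff]; exact le_antisymm (PadicInt.norm_le_one x) (not_lt.mp hc)
  have h3 := hx.map (PadicInt.toZModPow 3)
  have h4 : (4 : ZMod (2 ^ 3)) = 0 := by
    have := (h3.mul_left_eq_zero).mp h2
    exact this
  exact absurd h4 (by decide)

theorem aniso_aux (x y z w : ℚ_[2]) (h : x ^ 2 + y ^ 2 + z ^ 2 + w ^ 2 = 0)
    (hy : ‖y‖ ≤ ‖x‖) (hz : ‖z‖ ≤ ‖x‖) (hw : ‖w‖ ≤ ‖x‖) : x = 0 := by
  by_contra hx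
  have hxn : 0 < ‖x‖ := norm_pos_iff.mpr hx
  have hn : ∀ t : ℚ_[2], ‖t‖ ≤ ‖x‖ → ‖t / x‖ ≤ 1 := by
    intro t ht
    rw [norm_div]; exact div_le_one_of_le₀ ht hxn.le
  have := aniso_int ⟨x / x, hn x le_rfl⟩ ⟨y / x, hn y hy⟩ ⟨z / x, hn z hz⟩ ⟨w / x, hn w hw⟩ (by
    apply Subtype.ext
    change (x / x) ^ 2 + (y / x) ^ 2 + (z / x) ^ 2 + (w / x) ^ 2 = 0
    have e : (x / x) ^ 2 + (y / x) ^ 2 + (z / x) ^ 2 + (w / x) ^ 2 =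
      (x ^ 2 + y ^ 2 + z ^ 2 + w ^ 2) / x ^ 2 := by field_simp
    rw [e, h, zero_div])
  have h2 : ‖x / x‖ < 1 := this
  rw [div_self hx] at h2
  simp at h2

theorem aniso (x y z w : ℚ_[2]) (h : x ^ 2 + y ^ 2 + z ^ 2 + w ^ 2 = 0) :
    x = 0 ∧ y = 0 ∧ z = 0 ∧ w = 0 := by
  have key : ∀ m x y z w : ℚ_[2], m = 0 → ‖x‖ ≤ ‖m‖ → ‖y‖ ≤ ‖m‖ → ‖z‖ ≤ ‖m‖ → ‖w‖ ≤ ‖m‖ →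
      x = 0 ∧ y = 0 ∧ z = 0 ∧ w = 0 := by
    rintro m x y z w rfl h1 h2 h3 h4
    simp at h1 h2 h3 h4
    tauto
  rcases le_total ‖x‖ ‖y‖ with h1 | h1 <;> rcases le_total ‖z‖ ‖w‖ with h2 | h2
  · rcases le_total ‖y‖ ‖w‖ with h3 | h3
    · exact key w x y z w (aniso_aux w x y z (by linear_combination h) (h1.trans h3) h3 h2)
        (h1.trans h3) h3 h2 le_rfl
    · exact key y x y z w (aniso_aux y x z w (by linear_combination h) h1 (h2.trans h3) h3)
        h1 le_rfl (h2.trans h3) h3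
  · rcases le_total ‖y‖ ‖z‖ with h3 | h3
    · exact key z x y z w (aniso_aux z x y w (by linear_combination h) (h1.trans h3) h3 h2)
        (h1.trans h3) h3 le_rfl h2
    · exact key y x y z w (aniso_aux y x z w (by linear_combination h) h1 h3 (h2.trans h3))
        h1 le_rfl h3 (h2.trans h3)
  · rcases le_total ‖x‖ ‖w‖ with h3 | h3
    · exact key w x y z w (aniso_aux w x y z (by linear_combination h) h3 (h1.trans h3) h2)
        h3 (h1.trans h3) h2 le_rfl
    · exact key x x y z w (aniso_aux x y z w (by linear_combination h) h1 (h2.trans h3) h3)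
        le_rfl h1 (h2.trans h3) h3
  · rcases le_total ‖x‖ ‖z‖ with h3 | h3
    · exact key z x y z w (aniso_aux z x y w (by linear_combination h) h3 (h1.trans h3) h2)
        h3 (h1.trans h3) le_rfl h2
    · exact key x x y z w (aniso_aux x y z w (by linear_combination h) h1 h3 (h2.trans h3))
        le_rfl h1 h3 (h2.trans h3)

theorem natDegree_sum4_even (a b c d : ℚ_[2][X]) :
    Even (a ^ 2 + b ^ 2 + c ^ 2 + d ^ 2).natDegree := by
  obtain ⟨n, ha, hb, hc, hd, hn⟩ : ∃ n, a.natDegree ≤ n ∧ b.natDegree ≤ n ∧ c.natDegree ≤ n ∧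
      d.natDegree ≤ n ∧ (n = a.natDegree ∨ n = b.natDegree ∨ n = c.natDegree ∨ n = d.natDegree) := by
    refine ⟨max (max a.natDegree b.natDegree) (max c.natDegree d.natDegree), ?_⟩
    omega
  by_cases h0 : a ^ 2 + b ^ 2 + c ^ 2 + d ^ 2 = 0
  · rw [h0]; simp
  have hle : (a ^ 2 + b ^ 2 + c ^ 2 + d ^ 2).natDegree ≤ 2 * n := by
    refine natDegree_add_le_of_degree_le (natDegree_add_le_of_degree_le
      (natDegree_add_le_of_degree_le ?_ ?_) ?_) ?_ <;> rw [natDegree_pow] <;> omega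
  have hco : (a ^ 2 + b ^ 2 + c ^ 2 + d ^ 2).coeff (2 * n) =
      a.coeff n ^ 2 + b.coeff n ^ 2 + c.coeff n ^ 2 + d.coeff n ^ 2 := by
    simp only [coeff_add]
    rw [coeff_pow_of_natDegree_le ha, coeff_pow_of_natDegree_le hb, coeff_pow_of_natDegree_le hc,
      coeff_pow_of_natDegree_le hd]
  have : (a ^ 2 + b ^ 2 + c ^ 2 + d ^ 2).natDegree = 2 * n := by
    apply natDegree_eq_of_le_of_coeff_ne_zero hle
    rw [hco]
    intro hz
    obtain ⟨z1, z2, z3, z4⟩ := aniso _ _ _ _ hz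
    rcases hn with h | h | h | h
    all_goals
      rw [h] at z1 z2 z3 z4
      first
      | have hx := leadingCoeff_eq_zero.mp z1
      | skip
      apply h0
      have e1 : n = 0 := by
        rw [h]
        first
        | rw [leadingCoeff_eq_zero.mp z1]; simp
        | rw [leadingCoeff_eq_zero.mp z2]; simp
        | rw [leadingCoeff_eq_zero.mp z3]; simp
        | rw [leadingCoeff_eq_zero.mp z4]; simp
      rw [← h, e1] at z1 z2 z3 z4
      rw [e1] at ha hb hc hd
      rw [eq_C_of_natDegree_le_zero ha, eq_C_of_natDegree_le_zero hb,
        eq_C_of_natDegree_le_zero hc, eq_C_of_natDegree_le_zero hd, z1, z2, z3, z4]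
      simp
  rw [this]; simp

theorem exists_odd_irreducible_factor {F : Type*} [Field F] :
    ∀ n : ℕ, ∀ h : F[X], h.natDegree = n → Odd n → ∃ g, Irreducible g ∧ Odd g.natDegree ∧ g ∣ h := by
  intro n
  induction n using Nat.strong_induction_on with
  | _ n ih =>
  intro h hn ho
  have h0 : h ≠ 0 := by rintro rfl; simp at hn; subst hn; simp at ho
  have hu : ¬ IsUnit h := fun hh => by
    rw [natDegree_eq_zero_of_isUnit hh] at hn; subst hn; simp at ho
  obtain ⟨g, hgi, hgh⟩ := WfDvdMonoid.exists_irreducible_factor hu h0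
  by_cases hg : Odd g.natDegree
  · exact ⟨g, hgi, hg, hgh⟩
  obtain ⟨k, rfl⟩ := hgh
  have hk0 : k ≠ 0 := right_ne_zero_of_mul h0
  rw [natDegree_mul hgi.ne_zero hk0] at hn
  have hgp := hgi.natDegree_pos
  rw [Nat.not_odd_iff_even] at hg
  obtain ⟨r, hr, hro, hrk⟩ := ih k.natDegree (by omega) k rfl (by
    rw [← hn] at ho
    exact (Nat.odd_add'.mp ho).mpr hg)
  exact ⟨r, hr, hro, hrk.mul_left _⟩

theorem springer : ∀ n : ℕ, ∀ g : ℚ_[2][X], Irreducible g → g.natDegree = n → Odd n →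
    ∀ a b c d : ℚ_[2][X], g ∣ a ^ 2 + b ^ 2 + c ^ 2 + d ^ 2 → g ∣ a ∧ g ∣ b ∧ g ∣ c ∧ g ∣ d := by
  intro n
  induction n using Nat.strong_induction_on with
  | _ n ih =>
  intro g hg hgn ho
  -- inner claim
  have inner : ∀ k : ℕ, ∀ h a b c d : ℚ_[2][X], h.natDegree = k → h ≠ 0 → k < n →
      a ^ 2 + b ^ 2 + c ^ 2 + d ^ 2 = g * h → False := by
    intro k
    induction k using Nat.strong_induction_on with
    | _ k ih2 =>
    intro h a b c d hk h0 hlt heq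
    have hev := natDegree_sum4_even a b c d
    rw [heq, natDegree_mul hg.ne_zero h0, hgn, hk] at hev
    have hko : Odd k := by
      rcases Nat.even_or_odd k with he | ho'
      · exact absurd ((Nat.even_add.mp hev).mpr he) (Nat.not_even_iff_odd.mpr ho)
      · exact ho'
    obtain ⟨r, hri, hro, hrh⟩ := exists_odd_irreducible_factor k h hk hko
    have hrd : r.natDegree ≤ k := hk ▸ natDegree_le_of_dvd hrh h0
    obtain ⟨⟨a', rfl⟩, ⟨b', rfl⟩, ⟨c', rfl⟩, ⟨d', rfl⟩⟩ :=
      ih r.natDegree (by omega) r hri rfl hro a b c d (heq ▸ hrh.mul_left _)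
    have hcop : IsCoprime (r ^ 2) g := by
      apply IsCoprime.pow_left
      refine (hri.coprime_iff_not_dvd.mpr ?_)
      intro hd
      have := (hri.associated_of_dvd hg hd)
      have := natDegree_eq_of_degree_eq (degree_eq_degree_of_associated this)
      omega
    have hd2 : r ^ 2 ∣ h := by
      apply hcop.dvd_of_dvd_mul_left
      rw [← heq]
      exact ⟨a' ^ 2 + b' ^ 2 + c' ^ 2 + d' ^ 2, by ring⟩
    obtain ⟨h', rfl⟩ := hd2
    have hh0 : h' ≠ 0 := right_ne_zero_of_mul h0
    rw [natDegree_mul (pow_ne_zero _ hri.ne_zero) hh0, natDegree_pow] at hk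
    have hrp := hri.natDegree_pos
    refine ih2 h'.natDegree (by omega) h' a' b' c' d' rfl hh0 (by omega) ?_
    apply mul_left_cancel₀ (pow_ne_zero 2 hri.ne_zero)
    linear_combination heq
  intro a b c d hdvd
  have hd2 : g ∣ (a % g) ^ 2 + (b % g) ^ 2 + (c % g) ^ 2 + (d % g) ^ 2 := by
    have key : ∀ x : ℚ_[2][X], g ∣ x ^ 2 - (x % g) ^ 2 := by
      intro x
      have := EuclideanDomain.div_add_mod x g
      refine ⟨(x / g) * (x + x % g), ?_⟩
      have h2 : g * (x / g) = x - x % g := by linear_combination this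
      linear_combination (-(x + x % g)) * h2
    have := dvd_sub hdvd (dvd_add (dvd_add (dvd_add (key a) (key b)) (key c)) (key d))
    convert this using 1
    ring
  obtain ⟨h, hh⟩ := hd2
  have hpos : g.natDegree ≠ 0 := by rintro h; rw [← hgn, h] at ho; simp at ho
  by_cases h0 : h = 0
  · rw [h0, mul_zero] at hh
    -- all mods zero
    have hz : ∀ x y z w : ℚ_[2][X], x ^ 2 + y ^ 2 + z ^ 2 + w ^ 2 = 0 →
        x = 0 ∧ y = 0 ∧ z = 0 ∧ w = 0 := by
      intro x y z w hxyz
      have hinf : ∀ t : ℚ_[2], eval t x = 0 ∧ eval t y = 0 ∧ eval t z = 0 ∧ eval t w = 0 := by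
        intro t
        have := congrArg (eval t) hxyz
        simp only [eval_add, eval_pow, eval_zero] at this
        exact aniso _ _ _ _ this
      refine ⟨?_, ?_, ?_, ?_⟩ <;> apply Polynomial.funext <;> intro t <;> simp [hinf t]
    obtain ⟨e1, e2, e3, e4⟩ := hz _ _ _ _ hh
    exact ⟨EuclideanDomain.mod_eq_zero.mp e1, EuclideanDomain.mod_eq_zero.mp e2,
      EuclideanDomain.mod_eq_zero.mp e3, EuclideanDomain.mod_eq_zero.mp e4⟩
  · exfalso
    have hmod : ∀ x : ℚ_[2][X], (x % g).natDegree < g.natDegree := fun x => natDegree_mod_lt x hpos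
    have hdeg := natDegree_sum4_lt (hmod a) (hmod b) (hmod c) (hmod d)
    rw [hh, natDegree_mul hg.ne_zero h0] at hdeg
    exact inner _ h _ _ _ _ rfl h0 (by omega) hh

theorem even_mult (g : ℚ_[2][X]) (hg : Irreducible g) (ho : Odd g.natDegree) :
    ∀ m : ℕ, ∀ a b c d : ℚ_[2][X], g ^ m ∣ a ^ 2 + b ^ 2 + c ^ 2 + d ^ 2 →
      ¬ g ^ (m + 1) ∣ a ^ 2 + b ^ 2 + c ^ 2 + d ^ 2 → Even m := by
  intro m
  induction m using Nat.strong_induction_on with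
  | _ m ih =>
  intro a b c d h1 h2
  rcases Nat.eq_zero_or_pos m with rfl | hm
  · simp
  obtain ⟨⟨a', rfl⟩, ⟨b', rfl⟩, ⟨c', rfl⟩, ⟨d', rfl⟩⟩ :=
    springer _ g hg rfl ho a b c d ((dvd_pow_self g hm.ne').trans h1)
  have e : (g * a') ^ 2 + (g * b') ^ 2 + (g * c') ^ 2 + (g * d') ^ 2 =
    g ^ 2 * (a' ^ 2 + b' ^ 2 + c' ^ 2 + d' ^ 2) := by ring
  rw [e] at h1 h2
  have hm2 : 2 ≤ m := by
    by_contra hcon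
    have : m = 1 := by omega
    subst this
    exact h2 (dvd_mul_right _ _)
  obtain ⟨k, rfl⟩ := Nat.exists_eq_add_of_le hm2
  rw [pow_add] at h1
  rw [add_assoc, pow_add] at h2
  have hne := pow_ne_zero 2 hg.ne_zero
  have := ih k (by omega) a' b' c' d' ((mul_dvd_mul_iff_left hne).mp h1)
    (fun hc => h2 ((mul_dvd_mul_iff_left hne).mpr hc))
  rw [add_comm]
  exact this.add (by decide)

theorem one_imp_three (f : ℚ[X]) (h : Sum4 f) : ((∀ t : ℝ, 0 ≤ Polynomial.aeval t f) ∧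
          ∀ p : Polynomial ℚ_[2], p.Monic → Irreducible p →
            (∃ m : ℕ, Odd m ∧ p ^ m ∣ f.map (Rat.castHom ℚ_[2]) ∧
              ¬ p ^ (m + 1) ∣ f.map (Rat.castHom ℚ_[2])) →
            Even p.natDegree) := by
  refine ⟨h.aeval_nonneg, ?_⟩
  rintro p - hpi ⟨m, hm, h1, h2⟩
  by_contra hcon
  rw [Nat.not_even_iff_odd] at hcon
  obtain ⟨a, b, c, d, rfl⟩ := h
  simp only [Polynomial.map_add, Polynomial.map_pow] at h1 h2
  exact (Nat.not_even_iff_odd.mpr hm) (even_mult p hpi hcon m _ _ _ _ h1 h2)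

end Pourchet


namespace Pourchet
open Module

section Herb
variable {G : Type*} [CommGroup G]

/-- Herbrand-type identity. -/
theorem herbrand (σ : G →* G) (hσ : ∀ x, σ (σ x) = x) (U : Subgroup G) (hU : ∀ x ∈ U, σ x ∈ U)
    (N D : G →* G) (hN : ∀ x, N x = x * σ x) (hD : ∀ x, D x = x / σ x)
    (P M : Subgroup G) (hP : ∀ x, x ∈ P ↔ x ∈ U ∧ σ x = x) (hM : ∀ x, x ∈ M ↔ x ∈ U ∧ x * σ x = 1) :
    (U.map N).relIndex P * (M.map (powMonoidHom 2)).relIndex M =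
      (P.map (powMonoidHom 2)).relIndex P * (U.map D).relIndex M := by
  have hPN : P.map (powMonoidHom 2) = P.map N := by
    ext y
    simp only [Subgroup.mem_map, powMonoidHom_apply]
    constructor
    · rintro ⟨x, hx, rfl⟩
      exact ⟨x, hx, by rw [hN, ((hP x).mp hx).2, sq]⟩
    · rintro ⟨x, hx, rfl⟩
      exact ⟨x, hx, by rw [hN, ((hP x).mp hx).2, sq]⟩
  have hMD' : ∀ x ∈ M, D x = x ^ 2 := by
    intro x hx
    rw [hD, sq, div_eq_mul_inv, inv_eq_of_mul_eq_one_left ((hM x).mp hx).2]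
  have hMD : M.map (powMonoidHom 2) = M.map D := by
    ext y
    simp only [Subgroup.mem_map, powMonoidHom_apply]
    constructor
    · rintro ⟨x, hx, rfl⟩
      exact ⟨x, hx, hMD' x hx⟩
    · rintro ⟨x, hx, rfl⟩
      exact ⟨x, hx, (hMD' x hx).symm⟩
  have hPU : P ≤ U := fun x hx => ((hP x).mp hx).1
  have hMU : M ≤ U := fun x hx => ((hM x).mp hx).1
  have hNP : U.map N ≤ P := by
    rintro _ ⟨x, hx, rfl⟩
    rw [hP, hN, map_mul, hσ, mul_comm]
    exact ⟨U.mul_mem (hU x hx) hx, rfl⟩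
  have hDM : U.map D ≤ M := by
    rintro _ ⟨x, hx, rfl⟩
    rw [hM, hD, _root_.map_div, hσ]
    exact ⟨U.div_mem hx (hU x hx), by rw [div_mul_div_cancel, div_self']⟩
  rw [hPN, hMD, ← Subgroup.relIndex_mul_relIndex _ _ _ (Subgroup.map_mono hPU) hNP,
    ← Subgroup.relIndex_mul_relIndex _ _ _ (Subgroup.map_mono hMU) hDM]
  have key : (P.map N).relIndex (U.map N) = (M.map D).relIndex (U.map D) := by
    have e1 : (P.map N).relIndex (U.map N) = (P ⊔ M).relIndex U := by
      rw [← Subgroup.relIndex_comap, Subgroup.comap_map_eq, ← Subgroup.inf_relIndex_right,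
        ← Subgroup.inf_relIndex_right (P ⊔ M)]
      congr 1
      ext x
      simp only [Subgroup.mem_inf, Subgroup.mem_sup, MonoidHom.mem_ker]
      constructor
      · rintro ⟨⟨p, hp, m, hm, rfl⟩, hx⟩
        refine ⟨⟨p, hp, m, ?_, rfl⟩, hx⟩
        rw [hM, ← hN]
        exact ⟨by simpa using U.mul_mem (U.inv_mem (hPU hp)) hx, hm⟩
      · rintro ⟨⟨p, hp, m, hm, rfl⟩, hx⟩
        exact ⟨⟨p, hp, m, by rw [hN]; exact ((hM m).mp hm).2, rfl⟩, hx⟩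
    have e2 : (M.map D).relIndex (U.map D) = (P ⊔ M).relIndex U := by
      rw [← Subgroup.relIndex_comap, Subgroup.comap_map_eq, ← Subgroup.inf_relIndex_right,
        ← Subgroup.inf_relIndex_right (P ⊔ M), sup_comm P]
      congr 1
      ext x
      simp only [Subgroup.mem_inf, Subgroup.mem_sup, MonoidHom.mem_ker]
      constructor
      · rintro ⟨⟨p, hp, m, hm, rfl⟩, hx⟩
        refine ⟨⟨p, hp, m, ?_, rfl⟩, hx⟩
        rw [hD, div_eq_one] at hm
        rw [hP]
        exact ⟨by simpa using U.mul_mem (U.inv_mem (hMU hp)) hx, hm.symm⟩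
      · rintro ⟨⟨p, hp, m, hm, rfl⟩, hx⟩
        exact ⟨⟨p, hp, m, by rw [hD, ((hP m).mp hm).2, div_self'], rfl⟩, hx⟩
    rw [e1, e2]
  rw [key]
  ring

end Herb

/-- Rank of a commutative group. -/
noncomputable def rk (A : Type*) [CommGroup A] : ℕ := finrank ℤ (Additive A)

theorem rk_congr {A B : Type*} [CommGroup A] [CommGroup B] (e : A ≃* B) : rk A = rk B :=
  LinearEquiv.finrank_eq (MulEquiv.toAdditive e).toIntLinearEquiv

theorem finite_of_fg (A : Type*) [CommGroup A] [Group.FG A] : Module.Finite ℤ (Additive A) :=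
  Module.Finite.iff_addGroup_fg.mpr inferInstance

theorem fg_of_finite (A : Type*) [CommGroup A] [Module.Finite ℤ (Additive A)] : Group.FG A := by
  have : AddGroup.FG (Additive A) := Module.Finite.iff_addGroup_fg.mp inferInstance
  exact GroupFG.iff_add_fg.mpr this

theorem fg_subgroup {A : Type*} [CommGroup A] [Group.FG A] (H : Subgroup A) : Group.FG H := by
  have := finite_of_fg A
  have h2 : Module.Finite ℤ (AddSubgroup.toIntSubmodule (Subgroup.toAddSubgroup H)) := inferInstance
  have h3 : Module.Finite ℤ (Additive H) := h2
  exact fg_of_finite H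

theorem fg_of_exact {A B : Type*} [CommGroup A] [CommGroup B] [Group.FG B] (f : A →* B)
    [Group.FG f.ker] : Group.FG A := by
  have := finite_of_fg f.ker
  have := finite_of_fg B
  let F : Additive A →ₗ[ℤ] Additive B := (MonoidHom.toAdditive f).toIntLinearMap
  have h1 : Module.Finite ℤ (LinearMap.ker F) := by
    have : Module.Finite ℤ (Additive f.ker) := inferInstance
    exact this
  have h2 : Module.Finite ℤ (Additive A) := by
    constructor
    refine Submodule.fg_of_fg_map_of_fg_inf_ker F ?_ ?_
    · exact IsNoetherian.noetherian _
    · rw [top_inf_eq]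
      exact Module.Finite.iff_fg.mp h1
  exact fg_of_finite A

theorem rk_eq_add {A B : Type*} [CommGroup A] [CommGroup B] [Group.FG A] (f : A →* B) :
    rk A = rk f.ker + rk f.range := by
  have := finite_of_fg A
  let F : Additive A →ₗ[ℤ] Additive B := (MonoidHom.toAdditive f).toIntLinearMap
  have h := Submodule.finrank_quotient_add_finrank (LinearMap.ker F)
  rw [LinearEquiv.finrank_eq (LinearMap.quotKerEquivRange F)] at h
  have h1 : finrank ℤ (LinearMap.ker F) = rk f.ker := rfl
  have h2 : finrank ℤ (LinearMap.range F) = rk f.range := rfl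
  rw [h1, h2] at h
  unfold rk at *
  omega

theorem rk_finite_exponent {A : Type*} [CommGroup A] [Group.FG A] (H : Subgroup A) (n : ℕ)
    (hn : 0 < n) (h : ∀ a : A, a ^ n ∈ H) : rk H = rk A := by
  have := finite_of_fg A
  let N : Submodule ℤ (Additive A) := AddSubgroup.toIntSubmodule (Subgroup.toAddSubgroup H)
  have h1 := Submodule.finrank_quotient_add_finrank N
  have h2 : finrank ℤ (Additive A ⧸ N) = 0 := by
    rw [finrank_eq_zero_iff_isTorsion]
    intro x
    obtain ⟨a, rfl⟩ := Submodule.Quotient.mk_surjective _ x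
    refine ⟨⟨n, ?_⟩, ?_⟩
    · rw [mem_nonZeroDivisors_iff_ne_zero]; exact_mod_cast hn.ne'
    · change (n : ℤ) • (Submodule.Quotient.mk a : Additive A ⧸ N) = 0
      rw [← Submodule.Quotient.mk_smul, Submodule.Quotient.mk_eq_zero]
      change Additive.toMul ((n : ℤ) • a) ∈ H
      rw [toMul_zsmul, zpow_natCast]
      exact h _
  have h3 : finrank ℤ N = rk H := rfl
  unfold rk at *
  omega

theorem rk_pi (ι : Type*) [Fintype ι] : rk (ι → Multiplicative ℤ) = Fintype.card ι := by
  let e : Additive (ι → Multiplicative ℤ) ≃+ (ι → ℤ) :=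
    { toFun := fun x i => Multiplicative.toAdd (Additive.toMul x i)
      invFun := fun x => Additive.ofMul (fun i => Multiplicative.ofAdd (x i))
      left_inv := fun x => rfl
      right_inv := fun x => rfl
      map_add' := fun x y => rfl }
  unfold rk
  rw [LinearEquiv.finrank_eq e.toIntLinearEquiv]
  simp

theorem index_range_congr {A B : Type*} [CommGroup A] [CommGroup B] (e : A ≃* B) :
    (powMonoidHom 2 : A →* A).range.index = (powMonoidHom 2 : B →* B).range.index ∧
    Nat.card (powMonoidHom 2 : A →* A).ker = Nat.card (powMonoidHom 2 : B →* B).ker := by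
  constructor
  · rw [← Subgroup.index_map_equiv _ e]
    congr 1
    ext y
    simp only [Subgroup.mem_map, MonoidHom.mem_range, powMonoidHom_apply]
    constructor
    · rintro ⟨_, ⟨x, rfl⟩, rfl⟩; exact ⟨e x, by simp⟩
    · rintro ⟨x, rfl⟩; exact ⟨_, ⟨e.symm x, rfl⟩, by simp⟩
  · refine Nat.card_congr (Equiv.subtypeEquiv e.toEquiv ?_)
    intro a
    simp only [MonoidHom.mem_ker, powMonoidHom_apply]
    constructor
    · intro h; change (e a) ^ 2 = 1; rw [← map_pow, h, map_one]
    · intro h; apply e.injective; rw [map_pow, map_one]; exact h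

theorem sq_index (A : Type*) [CommGroup A] [Group.FG A] :
    (powMonoidHom 2 : A →* A).range.index = 2 ^ rk A * Nat.card (powMonoidHom 2 : A →* A).ker := by
  obtain ⟨ι, j, _, _, p, hp, e, ⟨E⟩⟩ := CommGroup.equiv_free_prod_prod_multiplicative_zmod A
  have : ∀ i, NeZero (p i ^ e i) := fun i => ⟨pow_ne_zero _ (hp i).ne_zero⟩
  set F := ((i : ι) → Multiplicative (ZMod (p i ^ e i)))
  have hF : Finite F := inferInstance
  have hfg : Group.FG ((j → Multiplicative ℤ) × F) := by
    exact Group.fg_of_surjective (f := E.toMonoidHom) E.surjective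
  rw [(index_range_congr E).1, (index_range_congr E).2, rk_congr E]
  have hrk : rk ((j → Multiplicative ℤ) × F) = Fintype.card j := by
    rw [rk_eq_add (MonoidHom.fst (j → Multiplicative ℤ) F)]
    have h1 : rk (MonoidHom.fst (j → Multiplicative ℤ) F).ker = 0 := by
      have hfin : Finite (MonoidHom.fst (j → Multiplicative ℤ) F).ker := by
        refine Finite.of_injective (β := F) (fun x => x.1.2) ?_
        rintro ⟨⟨a, b⟩, h⟩ ⟨⟨a', b'⟩, h'⟩ hh
        simp only [MonoidHom.mem_ker, MonoidHom.coe_fst] at h h'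
        simp only at hh
        subst h h' hh
        rfl
      unfold rk
      rw [finrank_eq_zero_iff_isTorsion]
      intro x
      have hc : (0 : ℕ) < Nat.card (Additive (MonoidHom.fst (j → Multiplicative ℤ) F).ker) := Nat.card_pos
      refine ⟨⟨Nat.card (Additive (MonoidHom.fst (j → Multiplicative ℤ) F).ker), ?_⟩, ?_⟩
      · rw [mem_nonZeroDivisors_iff_ne_zero]
        exact_mod_cast hc.ne'
      · change ((Nat.card _ : ℕ) : ℤ) • x = 0
        rw [natCast_zsmul]
        exact card_nsmul_eq_zero'
    have h2 : (MonoidHom.fst (j → Multiplicative ℤ) F).range = ⊤ :=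
      MonoidHom.range_eq_top.mpr Prod.fst_surjective
    rw [h1, h2, rk_congr Subgroup.topEquiv, rk_pi, zero_add]
  rw [hrk]
  have hr : (powMonoidHom 2 : (j → Multiplicative ℤ) × F →* _).range =
      (Subgroup.pi Set.univ (fun _ : j => (powMonoidHom 2 : Multiplicative ℤ →* _).range)).prod
        (powMonoidHom 2 : F →* F).range := by
    ext ⟨a, b⟩
    simp only [MonoidHom.mem_range, powMonoidHom_apply, Subgroup.mem_prod, Subgroup.mem_pi]
    constructor
    · rintro ⟨⟨x, y⟩, h⟩
      rw [Prod.ext_iff] at h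
      obtain ⟨h1, h2⟩ := h
      exact ⟨fun i _ => ⟨x i, congrFun h1 i⟩, ⟨y, h2⟩⟩
    · rintro ⟨h1, ⟨y, hy⟩⟩
      choose x hx using fun i => h1 i (Set.mem_univ i)
      exact ⟨⟨x, y⟩, Prod.ext (funext hx) hy⟩
  have hk : Nat.card (powMonoidHom 2 : (j → Multiplicative ℤ) × F →* _).ker =
      Nat.card (powMonoidHom 2 : F →* F).ker := by
    refine Nat.card_congr
      { toFun := fun x => ⟨x.1.2, ?_⟩
        invFun := fun y => ⟨⟨1, y.1⟩, ?_⟩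
        left_inv := ?_
        right_inv := ?_ }
    · have := x.2
      rw [MonoidHom.mem_ker, powMonoidHom_apply, Prod.ext_iff] at this
      exact this.2
    · have := y.2
      rw [MonoidHom.mem_ker, powMonoidHom_apply] at this ⊢
      exact Prod.ext (one_pow 2) this
    · rintro ⟨⟨x, y⟩, h⟩
      apply Subtype.ext
      apply Prod.ext
      · rw [MonoidHom.mem_ker, powMonoidHom_apply, Prod.ext_iff] at h
        have h1 : x ^ 2 = 1 := h.1
        funext i
        have h2 := congrFun h1 i
        have h3 : (2 : ℕ) • Multiplicative.toAdd (x i) = 0 := h2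
        have h4 : Multiplicative.toAdd (x i) = 0 := by simpa using h3
        exact h4.symm
      · rfl
    · rintro ⟨y, h⟩; rfl
  rw [hr, hk, Subgroup.index_prod, Subgroup.index_pi]
  have hz : (powMonoidHom 2 : Multiplicative ℤ →* _).range.index = 2 := by
    have := Int.index_zmultiples 2
    have h2 : (powMonoidHom 2 : Multiplicative ℤ →* _).range =
      AddSubgroup.toSubgroup (AddSubgroup.zmultiples (2 : ℤ)) := by
      ext y
      simp only [MonoidHom.mem_range, powMonoidHom_apply]
      change _ ↔ Multiplicative.toAdd y ∈ AddSubgroup.zmultiples (2 : ℤ)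
      rw [AddSubgroup.mem_zmultiples_iff]
      constructor
      · rintro ⟨x, rfl⟩
        exact ⟨Multiplicative.toAdd x, by simp [mul_comm]⟩
      · rintro ⟨k, hk⟩
        refine ⟨Multiplicative.ofAdd k, ?_⟩
        apply Multiplicative.toAdd.injective
        rw [← hk]; simp [mul_comm]
    rw [h2]
    exact this
  rw [hz, Finset.prod_const, Finset.card_univ]
  congr 1
  exact Subgroup.index_range
end Pourchet


namespace Pourchet
open Module NumberField IsDedekindDomain nonZeroDivisors

/-- Finite primes of a number field. -/
abbrev Pr (K : Type*) [Field K] := HeightOneSpectrum (𝓞 K)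

section Ord
variable {K : Type*} [Field K] [NumberField K]

/-- order of vanishing at a prime (zero at zero). -/
noncomputable def ord (v : Pr K) (x : K) : ℤ := -WithZero.log (v.valuation K x)

theorem val_ne_zero (v : Pr K) {x : K} (hx : x ≠ 0) : v.valuation K x ≠ 0 :=
  (Valuation.ne_zero_iff _).mpr hx

theorem val_eq_exp (v : Pr K) {x : K} (hx : x ≠ 0) :
    v.valuation K x = WithZero.exp (-ord v x) := by
  rw [ord, neg_neg, WithZero.exp_log (val_ne_zero v hx)]

theorem ord_mul (v : Pr K) {x y : K} (hx : x ≠ 0) (hy : y ≠ 0) :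
    ord v (x * y) = ord v x + ord v y := by
  rw [ord, map_mul, WithZero.log_mul (val_ne_zero v hx) (val_ne_zero v hy), ord, ord]; ring

@[simp] theorem ord_one (v : Pr K) : ord v (1 : K) = 0 := by simp [ord]
@[simp] theorem ord_zero (v : Pr K) : ord v (0 : K) = 0 := by simp [ord]

theorem ord_inv (v : Pr K) (x : K) : ord v x⁻¹ = -ord v x := by
  rw [ord, map_inv₀, WithZero.log_inv, ord]

theorem ord_div (v : Pr K) {x y : K} (hx : x ≠ 0) (hy : y ≠ 0) :
    ord v (x / y) = ord v x - ord v y := by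
  rw [div_eq_mul_inv, ord_mul v hx (inv_ne_zero hy), ord_inv]; ring

theorem ord_pow (v : Pr K) (x : K) (n : ℕ) : ord v (x ^ n) = n * ord v x := by
  rw [ord, map_pow, WithZero.log_pow, ord]; simp

theorem ord_zpow (v : Pr K) (x : K) (n : ℤ) : ord v (x ^ n) = n * ord v x := by
  rw [ord, map_zpow₀, WithZero.log_zpow, ord]; simp

@[simp] theorem ord_neg (v : Pr K) (x : K) : ord v (-x) = ord v x := by
  rw [ord, Valuation.map_neg, ord]

theorem val_le_iff (v : Pr K) {x y : K} (hx : x ≠ 0) (hy : y ≠ 0) :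
    v.valuation K x ≤ v.valuation K y ↔ ord v y ≤ ord v x := by
  rw [val_eq_exp v hx, val_eq_exp v hy, WithZero.exp_le_exp]; omega

theorem val_lt_iff (v : Pr K) {x y : K} (hx : x ≠ 0) (hy : y ≠ 0) :
    v.valuation K x < v.valuation K y ↔ ord v y < ord v x := by
  rw [← not_le, val_le_iff v hy hx, not_le]

theorem val_eq_iff (v : Pr K) {x y : K} (hx : x ≠ 0) (hy : y ≠ 0) :
    v.valuation K x = v.valuation K y ↔ ord v x = ord v y := by
  rw [val_eq_exp v hx, val_eq_exp v hy, WithZero.exp_inj]; omega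

theorem val_le_one_iff (v : Pr K) {x : K} (hx : x ≠ 0) : v.valuation K x ≤ 1 ↔ 0 ≤ ord v x := by
  have := val_le_iff v hx one_ne_zero
  rwa [map_one, ord_one] at this

theorem val_lt_one_iff (v : Pr K) {x : K} (hx : x ≠ 0) : v.valuation K x < 1 ↔ 0 < ord v x := by
  have := val_lt_iff v hx one_ne_zero
  rwa [map_one, ord_one] at this

theorem val_eq_one_iff (v : Pr K) {x : K} (hx : x ≠ 0) : v.valuation K x = 1 ↔ ord v x = 0 := by
  have := val_eq_iff v hx one_ne_zero
  rwa [map_one, ord_one] at this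

theorem ord_nonneg (v : Pr K) (r : 𝓞 K) : 0 ≤ ord v (r : K) := by
  by_cases h : (r : K) = 0
  · rw [h]; simp
  · exact (val_le_one_iff v h).mp (v.valuation_le_one r)

theorem ord_pos_iff (v : Pr K) (r : 𝓞 K) (hr : (r : K) ≠ 0) : 0 < ord v (r : K) ↔ r ∈ v.asIdeal := by
  rw [← val_lt_one_iff v hr]; exact v.valuation_lt_one_iff_mem r

theorem ord_eq_zero_iff (v : Pr K) (r : 𝓞 K) (hr : (r : K) ≠ 0) :
    ord v (r : K) = 0 ↔ r ∉ v.asIdeal := by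
  rw [← ord_pos_iff v r hr]; have := ord_nonneg v r; omega

theorem exists_uniformizer (v : Pr K) : ∃ π : 𝓞 K, (π : K) ≠ 0 ∧ ord v (π : K) = 1 := by
  obtain ⟨π, h⟩ := v.valuation_exists_uniformizer' K
  refine ⟨π, ?_, ?_⟩
  · intro h0
    have h' : v.valuation K (π : K) = WithZero.exp (-1) := h
    rw [h0, map_zero] at h'
    exact WithZero.exp_ne_zero h'.symm
  · have h' : v.valuation K (π : K) = WithZero.exp (-1) := h
    rw [ord, h', WithZero.log_exp]; norm_num

theorem ord_finite (x : K) (hx : x ≠ 0) : {v : Pr K | ord v x ≠ 0}.Finite := by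
  have h1 := HeightOneSpectrum.Support.finite (𝓞 K) x
  have h2 := HeightOneSpectrum.Support.finite (𝓞 K) x⁻¹
  refine (h1.union h2).subset ?_
  intro v hv
  by_contra hcon
  simp only [Set.mem_union, HeightOneSpectrum.Support, Set.mem_ofPred_eq, not_or, not_lt] at hcon
  apply hv
  have a := (val_le_one_iff v hx).mp hcon.1
  have b := (val_le_one_iff v (inv_ne_zero hx)).mp hcon.2
  rw [ord_inv] at b
  omega

theorem ord_add_ge (v : Pr K) {x y : K} {n : ℤ} (hx : x ≠ 0) (hy : y ≠ 0) (hxy : x + y ≠ 0)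
    (h1 : n ≤ ord v x) (h2 : n ≤ ord v y) : n ≤ ord v (x + y) := by
  have := Valuation.map_add (v.valuation K) x y
  rw [val_eq_exp v hx, val_eq_exp v hy, val_eq_exp v hxy, le_max_iff, WithZero.exp_le_exp,
    WithZero.exp_le_exp] at this
  omega

theorem exists_int_of_ord_nonneg (x : K) (hx : x ≠ 0) (h : ∀ v : Pr K, 0 ≤ ord v x) :
    ∃ r : 𝓞 K, (r : K) = x := by
  obtain ⟨r, hr⟩ := HeightOneSpectrum.mem_integers_of_valuation_le_one (R := 𝓞 K) K x (fun v =>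
    (val_le_one_iff v hx).mpr (h v))
  exact ⟨r, hr⟩

/-- The value of an integer is at most `exp (-n)` iff it is in the n-th power. -/
theorem val_le_exp_iff (v : Pr K) (r : 𝓞 K) (n : ℕ) :
    v.valuation K (r : K) ≤ WithZero.exp (-(n : ℤ)) ↔ r ∈ v.asIdeal ^ n := by
  rw [← v.intValuation_le_pow_iff_mem, ← v.valuation_of_algebraMap (K := K)]

theorem ord_ge_iff (v : Pr K) (r : 𝓞 K) (hr : (r : K) ≠ 0) (n : ℕ) :
    (n : ℤ) ≤ ord v (r : K) ↔ r ∈ v.asIdeal ^ n := by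
  rw [← val_le_exp_iff, val_eq_exp v hr, WithZero.exp_le_exp]; omega

/-- Chinese remainder theorem. -/
theorem crt (S : Finset (Pr K)) (t : Pr K → 𝓞 K) (n : Pr K → ℕ) :
    ∃ x : 𝓞 K, ∀ v ∈ S, x - t v ∈ v.asIdeal ^ n v := by
  obtain ⟨y, hy⟩ := IsDedekindDomain.exists_forall_sub_mem_ideal (s := S)
    (fun v : Pr K => v.asIdeal) n (fun v _ => v.prime)
    (fun v _ w _ hvw h => hvw (HeightOneSpectrum.ext h)) (fun v => t v.1)
  exact ⟨y, fun v hv => hy v hv⟩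

open FractionalIdeal in
theorem count_spanSingleton (v : Pr K) (x : K) (hx : x ≠ 0) :
    count K v (spanSingleton (𝓞 K)⁰ x) = ord v x := by
  classical
  have key : ∀ r : 𝓞 K, r ≠ 0 → count K v (spanSingleton (𝓞 K)⁰ (r : K)) = ord v (r : K) := by
    intro r hr
    have h1 : spanSingleton (𝓞 K)⁰ (r : K) = ((Ideal.span {r} : Ideal (𝓞 K)) : FractionalIdeal (𝓞 K)⁰ K) := by
      rw [coeIdeal_span_singleton]
    rw [h1, count_coe K v (by simpa using hr)]
    have h2 : v.valuation K (r : K) = v.intValuation r := v.valuation_of_algebraMap r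
    rw [ord, h2, v.intValuation_if_neg hr, WithZero.log_exp, neg_neg]
  obtain ⟨a, b, hb, rfl⟩ := IsFractionRing.div_surjective (A := 𝓞 K) x
  have hb0 : b ≠ 0 := nonZeroDivisors.ne_zero hb
  have hbK : (b : K) ≠ 0 := by simpa using hb0
  have ha0 : a ≠ 0 := by rintro rfl; simp at hx
  have haK : (a : K) ≠ 0 := by simpa using ha0
  have h3 := ord_mul v hx hbK
  have e : algebraMap (𝓞 K) K a / algebraMap (𝓞 K) K b * (b : K) = (a : K) := by
    change (a : K) / (b : K) * (b : K) = a
    field_simp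
  rw [e] at h3
  have h4 := count_mul K v (I := spanSingleton (𝓞 K)⁰ (algebraMap (𝓞 K) K a / algebraMap (𝓞 K) K b))
    (I' := spanSingleton (𝓞 K)⁰ (b : K)) (spanSingleton_ne_zero_iff.mpr hx)
    (spanSingleton_ne_zero_iff.mpr hbK)
  rw [spanSingleton_mul_spanSingleton, e, key a ha0, key b hb0] at h4
  linarith

open FractionalIdeal in
/-- The fractional ideal with given exponents. -/
noncomputable def fid (e : Pr K →₀ ℤ) : (FractionalIdeal (𝓞 K)⁰ K)ˣ :=
  Units.mk0 (e.prod (fun v n => (v.asIdeal : FractionalIdeal (𝓞 K)⁰ K) ^ n)) (by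
    rw [Finsupp.prod]
    exact Finset.prod_ne_zero_iff.mpr fun v hv => zpow_ne_zero _ (coeIdeal_ne_zero.mpr v.ne_bot))

open FractionalIdeal in
theorem count_fid (e : Pr K →₀ ℤ) (v : Pr K) :
    count K v (fid e : FractionalIdeal (𝓞 K)⁰ K) = e v := count_finsuppProd K v e

open FractionalIdeal in
theorem exists_ord_of_mk_eq_one (I : (FractionalIdeal (𝓞 K)⁰ K)ˣ) (h : ClassGroup.mk K I = 1) :
    ∃ c : Kˣ, ∀ v : Pr K, ord v (c : K) = count K v (I : FractionalIdeal (𝓞 K)⁰ K) := by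
  rw [ClassGroup.mk_eq_one_iff] at h
  obtain ⟨x, hx⟩ := h
  have e : (I : FractionalIdeal (𝓞 K)⁰ K) = spanSingleton (𝓞 K)⁰ x := by
    apply coeToSubmodule_injective
    beta_reduce
    rw [hx, coe_spanSingleton]
  have hx0 : x ≠ 0 := by
    rintro rfl
    rw [spanSingleton_zero] at e
    exact I.ne_zero e
  refine ⟨Units.mk0 x hx0, fun v => ?_⟩
  rw [e, count_spanSingleton v x hx0]; rfl

open FractionalIdeal in
theorem exists_ord_classNumber : ∃ h : ℕ, 0 < h ∧ ∀ e : Pr K →₀ ℤ, ∃ c : Kˣ,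
    ∀ v : Pr K, ord v (c : K) = h * e v := by
  refine ⟨Nat.card (ClassGroup (𝓞 K)), Nat.card_pos, fun e => ?_⟩
  obtain ⟨c, hc⟩ := exists_ord_of_mk_eq_one ((fid e) ^ (Nat.card (ClassGroup (𝓞 K)))) (by
    rw [map_pow]; exact pow_card_eq_one')
  refine ⟨c, fun v => ?_⟩
  rw [hc v, Units.val_pow_eq_pow_val, count_pow, count_fid]

/-- `S` generates the class group. -/
def Cl (S : Finset (Pr K)) : Prop :=
  ∀ e : Pr K →₀ ℤ, ∃ c : Kˣ, ∀ v ∉ S, ord v (c : K) = e v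

theorem exists_reps : ∃ R : Finset (Pr K →₀ ℤ), ∀ e : Pr K →₀ ℤ, ∃ r ∈ R, ∃ c : Kˣ,
    ∀ v : Pr K, ord v (c : K) = e v - r v := by
  classical
  have : Fintype (ClassGroup (𝓞 K)) := inferInstance
  let φ : (Pr K →₀ ℤ) → ClassGroup (𝓞 K) := fun e => ClassGroup.mk K (fid e)
  let g : ClassGroup (𝓞 K) → (Pr K →₀ ℤ) := Function.invFun φ
  refine ⟨Finset.univ.image g, fun e => ⟨g (φ e), Finset.mem_image_of_mem _ (Finset.mem_univ _), ?_⟩⟩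
  have h : φ (g (φ e)) = φ e := Function.invFun_eq ⟨e, rfl⟩
  obtain ⟨c, hc⟩ := exists_ord_of_mk_eq_one (fid e * (fid (g (φ e)))⁻¹) (by
    rw [map_mul, map_inv]
    change φ e * (φ (g (φ e)))⁻¹ = 1
    rw [h, mul_inv_cancel])
  refine ⟨c, fun v => ?_⟩
  rw [hc, Units.val_mul, Units.val_inv_eq_inv_val, FractionalIdeal.count_mul K v (Units.ne_zero _)
    (inv_ne_zero (Units.ne_zero _)), FractionalIdeal.count_inv, count_fid, count_fid]
  ring

theorem val_pos_four (v : Pr K) : v.valuation K 4 ≤ 1 := by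
  have := v.valuation_le_one (K := K) 4
  have e : ((4 : 𝓞 K) : K) = 4 := map_ofNat (algebraMap (𝓞 K) K) 4
  exact (congrArg (v.valuation K) e).ge.trans this

/-- Elements with prescribed order at finitely many primes. -/
theorem exists_ord_prescribed (T : Finset (Pr K)) (e : Pr K → ℤ) :
    ∃ c : Kˣ, ∀ t ∈ T, ord t (c : K) = e t := by
  have pos : ∀ f : Pr K → ℕ, ∃ c : Kˣ, ∀ t ∈ T, ord t (c : K) = f t := by
    intro f
    by_cases hT : T.Nonempty
    · choose π hπ0 hπ using fun v : Pr K => exists_uniformizer v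
      obtain ⟨x, hx⟩ := crt T (fun t => π t ^ f t) (fun t => f t + 1)
      have key : ∀ t ∈ T, t.valuation K (x : K) = WithZero.exp (-(f t : ℤ)) := by
        intro t ht
        have h1 := (val_le_exp_iff t _ _).mpr (hx t ht)
        have h2 : t.valuation K ((π t ^ f t : 𝓞 K) : K) = WithZero.exp (-(f t : ℤ)) := by
          have e1 : ((π t ^ f t : 𝓞 K) : K) = (π t : K) ^ f t := map_pow (algebraMap (𝓞 K) K) _ _
          rw [e1, val_eq_exp t (pow_ne_zero _ (hπ0 t)), ord_pow, hπ]; simp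
        rw [← h2]
        apply Valuation.map_eq_of_sub_lt
        have e2 : ((x - π t ^ f t : 𝓞 K) : K) = (x : K) - ((π t ^ f t : 𝓞 K) : K) :=
          map_sub (algebraMap (𝓞 K) K) _ _
        rw [e2] at h1
        refine lt_of_le_of_lt h1 ?_
        rw [h2, WithZero.exp_lt_exp]; push_cast; omega
      obtain ⟨t0, ht0⟩ := hT
      have hx0 : (x : K) ≠ 0 := by
        intro h
        have := key t0 ht0
        rw [h, map_zero] at this
        exact WithZero.exp_ne_zero this.symm
      refine ⟨Units.mk0 (x : K) hx0, fun t ht => ?_⟩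
      rw [Units.val_mk0, ord, key t ht, WithZero.log_exp, neg_neg]
    · exact ⟨1, fun t ht => absurd ⟨t, ht⟩ hT⟩
  obtain ⟨a, ha⟩ := pos (fun v => (e v).toNat)
  obtain ⟨b, hb⟩ := pos (fun v => (-e v).toNat)
  refine ⟨a / b, fun t ht => ?_⟩
  rw [Units.val_div_eq_div_val, ord_div t a.ne_zero b.ne_zero, ha t ht, hb t ht]
  omega

theorem Cl.mono {S S' : Finset (Pr K)} (h : Cl S) (hS : S ⊆ S') : Cl S' := fun e => by
  obtain ⟨c, hc⟩ := h e
  exact ⟨c, fun v hv => hc v (fun h' => hv (hS h'))⟩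

theorem exists_Cl [DecidableEq (Pr K)] (A T : Finset (Pr K)) (hd : Disjoint A T) :
    ∃ S : Finset (Pr K), A ⊆ S ∧ Disjoint S T ∧ Cl S := by
  classical
  obtain ⟨R, hR⟩ := exists_reps (K := K)
  choose c hc using fun r : Pr K →₀ ℤ => exists_ord_prescribed T (fun v => r v)
  have hfin : ∀ r : Pr K →₀ ℤ, {v : Pr K | r v ≠ ord v (c r : K)}.Finite := by
    intro r
    refine (r.hasFiniteSupport.union (ord_finite (c r : K) (c r).ne_zero)).subset ?_
    intro v hv
    by_contra hcon
    simp only [Set.mem_union, Function.mem_support, Set.mem_ofPred_eq, not_or, not_not] at hcon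
    exact hv (by rw [hcon.1, hcon.2])
  refine ⟨A ∪ R.biUnion (fun r => (hfin r).toFinset), Finset.subset_union_left, ?_, ?_⟩
  · rw [Finset.disjoint_union_left]
    refine ⟨hd, ?_⟩
    rw [Finset.disjoint_left]
    intro v hv hT
    simp only [Finset.mem_biUnion, Set.Finite.mem_toFinset, Set.mem_ofPred_eq] at hv
    obtain ⟨r, hr, hne⟩ := hv
    exact hne (hc r v hT).symm
  · intro e
    obtain ⟨r, hr, d, hd⟩ := hR e
    refine ⟨d * c r, fun v hv => ?_⟩
    rw [Units.val_mul, ord_mul v d.ne_zero (c r).ne_zero, hd]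
    have : r v = ord v (c r : K) := by
      by_contra hne
      apply hv
      rw [Finset.mem_union, Finset.mem_biUnion]
      exact Or.inr ⟨r, hr, by simpa using hne⟩
    rw [← this]; ring

/-- S-units. -/
def SU (S : Finset (Pr K)) : Subgroup Kˣ where
  carrier := {x | ∀ v ∉ S, ord v (x : K) = 0}
  one_mem' := fun v _ => by simp
  mul_mem' := fun {a b} ha hb v hv => by
    rw [Units.val_mul, ord_mul v a.ne_zero b.ne_zero, ha v hv, hb v hv, add_zero]
  inv_mem' := fun {a} ha v hv => by
    rw [Units.val_inv_eq_inv_val, ord_inv, ha v hv, neg_zero]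

theorem mem_SU {S : Finset (Pr K)} {x : Kˣ} : x ∈ SU S ↔ ∀ v ∉ S, ord v (x : K) = 0 := Iff.rfl

theorem SU_mono {S S' : Finset (Pr K)} (h : S ⊆ S') : SU S ≤ SU S' :=
  fun _ hx v hv => hx v (fun h' => hv (h h'))

theorem neg_one_mem_SU (S : Finset (Pr K)) : -1 ∈ SU S := fun v _ => by
  rw [Units.val_neg, ord_neg]; simp

/-- the order map on S-units -/
noncomputable def ordHom (S : Finset (Pr K)) : SU S →* (S → Multiplicative ℤ) where
  toFun x := fun v => Multiplicative.ofAdd (ord v.1 ((x : Kˣ) : K))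
  map_one' := by funext v; simp
  map_mul' x y := by
    funext v
    simp only [Pi.mul_apply, ← ofAdd_add]
    rw [← ord_mul v.1 (x : Kˣ).ne_zero (y : Kˣ).ne_zero]; rfl

theorem ordHom_mem_ker (S : Finset (Pr K)) (x : SU S) :
    x ∈ (ordHom S).ker ↔ ∀ v : Pr K, ord v ((x : Kˣ) : K) = 0 := by
  rw [MonoidHom.mem_ker]
  constructor
  · intro h v
    by_cases hv : v ∈ S
    · exact congrFun h ⟨v, hv⟩
    · exact x.2 v hv
  · intro h
    funext v
    exact h v.1

theorem unit_ord (u : (𝓞 K)ˣ) (v : Pr K) : ord v ((u : 𝓞 K) : K) = 0 := by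
  have h1 := ord_nonneg v (u : 𝓞 K)
  have h2 := ord_nonneg v ((u⁻¹ : (𝓞 K)ˣ) : 𝓞 K)
  have h3 : (((u⁻¹ : (𝓞 K)ˣ) : 𝓞 K) : K) = (((u : (𝓞 K)ˣ) : 𝓞 K) : K)⁻¹ := by
    apply eq_inv_of_mul_eq_one_left
    have := map_mul (algebraMap (𝓞 K) K) ((u⁻¹ : (𝓞 K)ˣ) : 𝓞 K) (u : 𝓞 K)
    rw [Units.inv_mul, map_one] at this
    exact this.symm
  rw [h3, ord_inv] at h2
  omega

noncomputable def unitsToKer (S : Finset (Pr K)) : (𝓞 K)ˣ →* (ordHom S).ker where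
  toFun u := ⟨⟨Units.map (algebraMap (𝓞 K) K).toMonoidHom u, fun v _ => unit_ord u v⟩,
    (ordHom_mem_ker S _).mpr (fun v => unit_ord u v)⟩
  map_one' := by apply Subtype.ext; apply Subtype.ext; simp
  map_mul' x y := by apply Subtype.ext; apply Subtype.ext; simp

theorem unitsToKer_bij (S : Finset (Pr K)) : Function.Bijective (unitsToKer S) := by
  constructor
  · intro x y h
    have h1 : Units.map (algebraMap (𝓞 K) K).toMonoidHom x =
      Units.map (algebraMap (𝓞 K) K).toMonoidHom y := congrArg (fun z : (ordHom S).ker => ((z : SU S) : Kˣ)) h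
    have h2 := congrArg (fun z : Kˣ => (z : K)) h1
    apply Units.ext
    exact RingOfIntegers.ext h2
  · rintro ⟨x, hx⟩
    rw [ordHom_mem_ker] at hx
    obtain ⟨r, hr⟩ := exists_int_of_ord_nonneg ((x : Kˣ) : K) (x : Kˣ).ne_zero (fun v => (hx v).ge)
    obtain ⟨s, hs⟩ := exists_int_of_ord_nonneg (((x : Kˣ)⁻¹ : Kˣ) : K) ((x : Kˣ)⁻¹ : Kˣ).ne_zero (fun v => by
      rw [Units.val_inv_eq_inv_val, ord_inv, hx v, neg_zero])
    have hrs : r * s = 1 := by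
      apply RingOfIntegers.ext
      have := map_mul (algebraMap (𝓞 K) K) r s
      change ((r * s : 𝓞 K) : K) = (r : K) * (s : K) at this
      rw [this, hr, hs]; simp
    refine ⟨Units.mk r s hrs (by rw [mul_comm, hrs]), ?_⟩
    apply Subtype.ext; apply Subtype.ext; apply Units.ext
    exact hr

theorem ordHom_ker_fg (S : Finset (Pr K)) : Group.FG (ordHom S).ker := by
  have : Module.Finite ℤ (Additive (𝓞 K)ˣ) := inferInstance
  have := fg_of_finite (𝓞 K)ˣ
  exact Group.fg_of_surjective (unitsToKer_bij S).2

theorem ordHom_ker_rk (S : Finset (Pr K)) : rk (ordHom S).ker = Units.rank K := by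
  rw [← rk_congr (MulEquiv.ofBijective _ (unitsToKer_bij S))]
  exact Units.finrank_eq K

theorem fg_pi (ι : Type*) [Finite ι] : Group.FG (ι → Multiplicative ℤ) := by
  have e : Additive (ι → Multiplicative ℤ) ≃+ (ι → ℤ) :=
    { toFun := fun x i => Multiplicative.toAdd (Additive.toMul x i)
      invFun := fun x => Additive.ofMul (fun i => Multiplicative.ofAdd (x i))
      left_inv := fun x => rfl
      right_inv := fun x => rfl
      map_add' := fun x y => rfl }
  have : Module.Finite ℤ (Additive (ι → Multiplicative ℤ)) :=
    Module.Finite.equiv e.toIntLinearEquiv.symm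
  exact fg_of_finite _

instance SU_fg (S : Finset (Pr K)) : Group.FG (SU S) := by
  have := ordHom_ker_fg S
  have := fg_pi S
  exact fg_of_exact (ordHom S)

theorem SU_rk (S : Finset (Pr K)) : rk (SU S) = S.card + Units.rank K := by
  classical
  rw [rk_eq_add (ordHom S), ordHom_ker_rk]
  have := fg_pi S
  obtain ⟨h, hh, hc⟩ := exists_ord_classNumber (K := K)
  rw [rk_finite_exponent (ordHom S).range h hh, rk_pi, Fintype.card_coe, add_comm]
  intro a
  let e : Pr K →₀ ℤ := Finsupp.onFinset S (fun v => if hv : v ∈ S then Multiplicative.toAdd (a ⟨v, hv⟩) else 0)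
    (by intro v hv; by_contra hcon; simp [hcon] at hv)
  obtain ⟨c, hcc⟩ := hc e
  have hcS : c ∈ SU S := by
    intro v hv
    rw [hcc v]
    simp [e, hv]
  refine ⟨⟨c, hcS⟩, ?_⟩
  funext v
  change Multiplicative.ofAdd (ord v.1 (c : K)) = _
  rw [hcc]
  apply Multiplicative.toAdd.injective
  simp [e, mul_comm]

/-- index of squares for a f.g. group of units of a field containing -1 -/
theorem sq_relIndex {F : Type*} [Field F] [CharZero F] (A : Subgroup Fˣ) (hA : -1 ∈ A)
    [Group.FG A] : (A.map (powMonoidHom 2)).relIndex A = 2 ^ (rk A + 1) := by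
  have h := sq_index A
  have h1 : A.map (powMonoidHom 2) = ((powMonoidHom 2 : A →* A).range).map A.subtype := by
    ext y
    simp only [Subgroup.mem_map, MonoidHom.mem_range, powMonoidHom_apply]
    constructor
    · rintro ⟨x, hx, rfl⟩
      exact ⟨_, ⟨⟨x, hx⟩, rfl⟩, rfl⟩
    · rintro ⟨_, ⟨⟨x, hx⟩, rfl⟩, rfl⟩
      exact ⟨x, hx, rfl⟩
  have h2 : (A.map (powMonoidHom 2)).relIndex A = (powMonoidHom 2 : A →* A).range.index := by
    rw [h1, Subgroup.relIndex, Subgroup.subgroupOf, Subgroup.comap_map_eq_self_of_injective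
      A.subtype_injective]
  rw [h2, h, pow_succ]
  congr 1
  have h3 : ∀ x : Fˣ, x ^ 2 = 1 ↔ x = 1 ∨ x = -1 := by
    intro x
    rw [← Units.val_inj, ← Units.val_inj, ← Units.val_inj]
    push_cast
    exact sq_eq_one_iff
  have h4 : (1 : Fˣ) ≠ -1 := by
    intro h
    have := congrArg (fun z : Fˣ => (z : F)) h
    simp only [Units.val_one, Units.val_neg] at this
    have h5 : (2 : F) = 0 := by linear_combination this
    exact two_ne_zero h5
  rw [Nat.card_eq_two_iff]
  refine ⟨⟨1, by simp⟩, ⟨⟨-1, hA⟩, ?_⟩, ?_, ?_⟩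
  · rw [MonoidHom.mem_ker]; apply Subtype.ext; simp
  · intro h
    exact h4 (congrArg (fun z : (powMonoidHom 2 : A →* A).ker => ((z : A) : Fˣ)) h)
  · ext ⟨⟨x, hx⟩, hx2⟩
    simp only [Set.mem_univ, iff_true, Set.mem_insert_iff, Set.mem_singleton_iff, Subtype.ext_iff]
    rw [MonoidHom.mem_ker] at hx2
    exact (h3 x).mp (congrArg Subtype.val hx2)

end Ord
end Pourchet


set_option linter.unusedSectionVars false
set_option linter.unusedVariables false

namespace Pourchet
open Module NumberField IsDedekindDomain nonZeroDivisors

section LSsec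
variable {K : Type*} [Field K] [NumberField K]

theorem val_four_pos (v : Pr K) : 0 < v.valuation K 4 :=
  (Valuation.pos_iff _).mpr (by norm_num : (4 : K) ≠ 0)

theorem coe_ne_zero' {r : 𝓞 K} (h : r ≠ 0) : (r : K) ≠ 0 := fun h' => h (RingOfIntegers.ext h')

/-- Local squares (to sufficient precision). -/
def LS (v : Pr K) : Subgroup Kˣ where
  carrier := {b | ∃ z : Kˣ, v.valuation K ((b : K) * (z : K) ^ 2 - 1) < v.valuation K 4}
  one_mem' := ⟨1, by
    simp only [Units.val_one, one_pow, mul_one, sub_self, map_zero]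
    exact val_four_pos v⟩
  mul_mem' := by
    rintro a b ⟨z, hz⟩ ⟨w, hw⟩
    refine ⟨z * w, ?_⟩
    have h1 : v.valuation K ((b : K) * (w : K) ^ 2) = 1 := by
      rw [← map_one (v.valuation K)]
      apply Valuation.map_eq_of_sub_lt
      rw [map_one]; exact hw.trans_le (val_pos_four v)
    have e : ((a * b : Kˣ) : K) * ((z * w : Kˣ) : K) ^ 2 - 1 =
      ((a : K) * (z : K) ^ 2 - 1) * ((b : K) * (w : K) ^ 2) + ((b : K) * (w : K) ^ 2 - 1) := by
      push_cast; ring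
    rw [e]
    refine Valuation.map_add_lt _ ?_ hw
    rw [map_mul, h1, mul_one]; exact hz
  inv_mem' := by
    rintro a ⟨z, hz⟩
    refine ⟨z⁻¹, ?_⟩
    have h1 : v.valuation K ((a : K) * (z : K) ^ 2) = 1 := by
      rw [← map_one (v.valuation K)]
      apply Valuation.map_eq_of_sub_lt
      rw [map_one]; exact hz.trans_le (val_pos_four v)
    have e : ((a⁻¹ : Kˣ) : K) * ((z⁻¹ : Kˣ) : K) ^ 2 - 1 =
      -((a : K) * (z : K) ^ 2 - 1) * ((a : K) * (z : K) ^ 2)⁻¹ := by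
      have := a.ne_zero
      have := z.ne_zero
      push_cast; field_simp; ring
    rw [e, map_mul, Valuation.map_neg, map_inv₀, h1, inv_one, mul_one]; exact hz

theorem mem_LS {v : Pr K} {b : Kˣ} : b ∈ LS v ↔
  ∃ z : Kˣ, v.valuation K ((b : K) * (z : K) ^ 2 - 1) < v.valuation K 4 := Iff.rfl

theorem sq_mem_LS (v : Pr K) (x : Kˣ) : x ^ 2 ∈ LS v := ⟨x⁻¹, by
  have := x.ne_zero
  have e : ((x ^ 2 : Kˣ) : K) * ((x⁻¹ : Kˣ) : K) ^ 2 - 1 = 0 := by push_cast; field_simp; ring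
  rw [e, map_zero]
  exact val_four_pos v⟩

theorem close_mem_LS {v : Pr K} {b : Kˣ} (h : v.valuation K ((b : K) - 1) < v.valuation K 4) :
    b ∈ LS v := ⟨1, by simpa using h⟩

theorem ord_even_of_LS {v : Pr K} {b : Kˣ} (h : b ∈ LS v) : Even (ord v (b : K)) := by
  obtain ⟨z, hz⟩ := h
  have h1 : v.valuation K ((b : K) * (z : K) ^ 2) = 1 := by
    rw [← map_one (v.valuation K)]
    apply Valuation.map_eq_of_sub_lt
    rw [map_one]; exact hz.trans_le (val_pos_four v)
  rw [val_eq_one_iff v (mul_ne_zero b.ne_zero (pow_ne_zero _ z.ne_zero)), ord_mul v b.ne_zero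
    (pow_ne_zero _ z.ne_zero), ord_pow] at h1
  refine ⟨-ord v (z : K), ?_⟩
  push_cast at h1
  linarith

/-- v-units -/
def Uv (v : Pr K) : Subgroup Kˣ where
  carrier := {x | ord v (x : K) = 0}
  one_mem' := by simp
  mul_mem' := fun {a b} ha hb => by
    change ord v ((a * b : Kˣ) : K) = 0
    rw [Units.val_mul, ord_mul v a.ne_zero b.ne_zero, ha, hb, add_zero]
  inv_mem' := fun {a} ha => by
    change ord v ((a⁻¹ : Kˣ) : K) = 0
    rw [Units.val_inv_eq_inv_val, ord_inv, ha, neg_zero]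

theorem mem_Uv {v : Pr K} {x : Kˣ} : x ∈ Uv v ↔ ord v (x : K) = 0 := Iff.rfl

theorem ord_two_nonneg (v : Pr K) : 0 ≤ ord v (2 : K) := by
  have e : ((2 : 𝓞 K) : K) = 2 := map_ofNat (algebraMap (𝓞 K) K) 2
  exact (ord_nonneg v 2).trans (congrArg (ord v) e).le

/-- order of 2 -/
noncomputable def e2 (v : Pr K) : ℕ := (ord v (2 : K)).toNat

theorem e2_cast (v : Pr K) : (e2 v : ℤ) = ord v (2 : K) := Int.toNat_of_nonneg (ord_two_nonneg v)

theorem val_four (v : Pr K) : v.valuation K 4 = WithZero.exp (-(2 * e2 v : ℕ) : ℤ) := by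
  have h : (4 : K) = 2 ^ 2 := by norm_num
  rw [h, val_eq_exp v (pow_ne_zero _ two_ne_zero), ord_pow, ← e2_cast]; push_cast; rfl

theorem val_lt_four_iff (v : Pr K) (r : 𝓞 K) :
    v.valuation K (r : K) < v.valuation K 4 ↔ r ∈ v.asIdeal ^ (2 * e2 v + 1) := by
  by_cases hr : (r : K) = 0
  · have : r = 0 := by exact_mod_cast hr
    subst this
    simp only [Ideal.zero_mem, iff_true]
    rw [hr, map_zero]
    exact val_four_pos v
  · rw [← ord_ge_iff v r hr, val_four, val_eq_exp v hr, WithZero.exp_lt_exp]; push_cast; omega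

/-- approximating v-integers -/
theorem approx (v : Pr K) {x : K} (hx : v.valuation K x ≤ 1) :
    ∃ r : 𝓞 K, v.valuation K ((r : K) - x) < v.valuation K 4 := by
  obtain ⟨a, ha⟩ := v.exists_valuation_sub_lt_of_integer hx
    (Units.mk0 (v.valuation K 4) (val_ne_zero v (by norm_num : (4 : K) ≠ 0)))
  exact ⟨a, ha⟩

theorem card_quot_pow (v : Pr K) (n : ℕ) :
    Nat.card (𝓞 K ⧸ v.asIdeal ^ n) = (Ideal.absNorm v.asIdeal) ^ n := by
  rw [← map_pow, Ideal.absNorm_apply, Submodule.cardQuot_apply]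

theorem finite_quot_pow (v : Pr K) (n : ℕ) : Finite (𝓞 K ⧸ v.asIdeal ^ n) :=
  Ideal.finiteQuotientOfFreeOfNeBot _ (pow_ne_zero _ v.ne_bot)

theorem card_sq_eq_one (v : Pr K) :
    Nat.card {x : 𝓞 K ⧸ v.asIdeal ^ (2 * e2 v + 1) // x ^ 2 = 1} ≤
      2 * (Ideal.absNorm v.asIdeal) ^ e2 v := by
  classical
  set e := e2 v
  set I := v.asIdeal ^ (2 * e + 1)
  set J := v.asIdeal ^ (e + 1)
  have hIJ : I ≤ J := Ideal.pow_le_pow_right (by omega)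
  have := finite_quot_pow v (2 * e + 1)
  have := finite_quot_pow v (e + 1)
  let π : (𝓞 K ⧸ I) →+ (𝓞 K ⧸ J) := (Ideal.Quotient.factor hIJ : (𝓞 K ⧸ I) →+* _).toAddMonoidHom
  have hπ : Function.Surjective π := Ideal.Quotient.factor_surjective hIJ
  have hq : 0 < Ideal.absNorm v.asIdeal := Nat.pos_of_ne_zero (by
    rw [Ne, Ideal.absNorm_eq_zero_iff]; exact v.ne_bot)
  have hker : Nat.card π.ker = (Ideal.absNorm v.asIdeal) ^ e := by
    have h1 := AddSubgroup.card_eq_card_quotient_mul_card_addSubgroup π.ker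
    rw [Nat.card_congr (QuotientAddGroup.quotientKerEquivOfSurjective π hπ).toEquiv,
      card_quot_pow, card_quot_pow, show 2 * e + 1 = (e + 1) + e by ring, pow_add] at h1
    exact (Nat.eq_of_mul_eq_mul_left (pow_pos hq _) h1).symm
  have hsub : ∀ x : 𝓞 K ⧸ I, x ^ 2 = 1 → (x - 1 ∈ π.ker ∨ x + 1 ∈ π.ker) := by
    intro x hx
    obtain ⟨r, rfl⟩ := Ideal.Quotient.mk_surjective x
    have hr : (r - 1) * (r + 1) ∈ I := by
      rw [← Ideal.Quotient.eq_zero_iff_mem, map_mul, map_sub, map_add, map_one]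
      linear_combination hx
    have aux : ∀ s : 𝓞 K, s ∈ J → Ideal.Quotient.mk I s ∈ π.ker := by
      intro s hs
      rw [AddMonoidHom.mem_ker]
      change Ideal.Quotient.factor hIJ (Ideal.Quotient.mk I s) = 0
      rw [Ideal.Quotient.factor_mk, Ideal.Quotient.eq_zero_iff_mem]; exact hs
    have : r - 1 ∈ J ∨ r + 1 ∈ J := by
      by_cases h1 : r - 1 = 0
      · left; rw [h1]; exact J.zero_mem
      by_cases h2 : r + 1 = 0
      · right; rw [h2]; exact J.zero_mem
      have h1' : ((r - 1 : 𝓞 K) : K) ≠ 0 := coe_ne_zero' h1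
      have h2' : ((r + 1 : 𝓞 K) : K) ≠ 0 := coe_ne_zero' h2
      have e3 : (((r - 1) * (r + 1) : 𝓞 K) : K) = ((r - 1 : 𝓞 K) : K) * ((r + 1 : 𝓞 K) : K) :=
        map_mul (algebraMap (𝓞 K) K) _ _
      rw [← ord_ge_iff v _ h1', ← ord_ge_iff v _ h2']
      rw [← ord_ge_iff v _ (by rw [e3]; exact mul_ne_zero h1' h2'), e3, ord_mul v h1' h2'] at hr
      push_cast at hr ⊢
      omega
    rcases this with h | h
    · left; simpa using aux _ h
    · right; simpa using aux _ h
  calc Nat.card {x : 𝓞 K ⧸ I // x ^ 2 = 1} ≤ Nat.card (Bool × π.ker) := by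
        let g : Bool × π.ker → 𝓞 K ⧸ I := fun p => if p.1 then p.2.1 + 1 else p.2.1 - 1
        have hg : {x : 𝓞 K ⧸ I | x ^ 2 = 1} ⊆ Set.range g := by
          intro x hx
          rcases hsub x hx with h | h
          · exact ⟨(true, ⟨_, h⟩), by simp [g]⟩
          · exact ⟨(false, ⟨_, h⟩), by simp [g]⟩
        calc _ = Nat.card ({x : 𝓞 K ⧸ I | x ^ 2 = 1} : Set _) := rfl
          _ ≤ Nat.card (Set.range g) := Nat.card_mono (Set.toFinite _) hg
          _ ≤ _ := Finite.card_range_le g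
    _ = _ := by rw [Nat.card_prod, hker]; simp

theorem LS_units (v : Pr K) : (LS v).relIndex (Uv v) ≤ 2 * (Ideal.absNorm v.asIdeal) ^ e2 v ∧
    (LS v).relIndex (Uv v) ≠ 0 := by
  classical
  set e := e2 v with he
  set I := v.asIdeal ^ (2 * e + 1) with hI
  have := finite_quot_pow v (2 * e + 1)
  have hfinU : Finite (𝓞 K ⧸ I)ˣ := inferInstance
  -- residues
  have h0 : ∀ x : Uv v, ∃ u : (𝓞 K ⧸ I)ˣ, ∃ r : 𝓞 K, (u : 𝓞 K ⧸ I) = Ideal.Quotient.mk I r ∧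
      v.valuation K ((r : K) - ((x : Kˣ) : K)) < v.valuation K 4 := by
    rintro ⟨x, hx⟩
    have hx1 : v.valuation K (x : K) = 1 := (val_eq_one_iff v x.ne_zero).mpr hx
    have hy1 : v.valuation K (x : K)⁻¹ = 1 := by rw [map_inv₀, hx1, inv_one]
    obtain ⟨r, hr⟩ := approx v hx1.le
    obtain ⟨s, hs⟩ := approx v hy1.le
    have hs1 : v.valuation K (s : K) = 1 := by
      rw [← hy1]
      apply Valuation.map_eq_of_sub_lt
      rw [hy1]; exact hs.trans_le (val_pos_four v)
    have hrs : r * s - 1 ∈ I := by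
      rw [← val_lt_four_iff]
      have e1 : ((r * s - 1 : 𝓞 K) : K) = ((r : K) - x) * s + x * ((s : K) - (x : K)⁻¹) := by
        have := x.ne_zero
        have e2 : ((r * s - 1 : 𝓞 K) : K) = (r : K) * s - 1 := by simp
        rw [e2]; field_simp; ring
      rw [e1]
      apply Valuation.map_add_lt
      · rw [map_mul, hs1, mul_one]; exact hr
      · rw [map_mul, hx1, one_mul]; exact hs
    have hrs' : Ideal.Quotient.mk I r * Ideal.Quotient.mk I s = 1 := by
      rw [← map_mul, ← map_one (Ideal.Quotient.mk I), Ideal.Quotient.eq]; exact hrs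
    exact ⟨Units.mk _ _ hrs' (by rw [mul_comm, hrs']), r, rfl, hr⟩
  choose F R hFR hR using h0
  have key : ∀ x y : Uv v, (∃ u : (𝓞 K ⧸ I)ˣ, F x = F y * u ^ 2) → x⁻¹ * y ∈ (LS v).subgroupOf (Uv v) := by
    rintro x y ⟨u, hu⟩
    rw [Subgroup.mem_subgroupOf]
    obtain ⟨s, hs⟩ := Ideal.Quotient.mk_surjective (u : 𝓞 K ⧸ I)
    have h1 : R x - R y * s ^ 2 ∈ I := by
      rw [← Ideal.Quotient.eq, map_mul, map_pow, ← hFR, ← hFR, hs, hu]; push_cast; rfl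
    have hx1 : v.valuation K ((x : Kˣ) : K) = 1 := (val_eq_one_iff v (x : Kˣ).ne_zero).mpr x.2
    have hlt : v.valuation K ((y : Kˣ) * (s : K) ^ 2 - (x : Kˣ)) < v.valuation K 4 := by
      have e1 : ((y : Kˣ) * (s : K) ^ 2 - (x : Kˣ) : K) =
        (-((R x - R y * s ^ 2 : 𝓞 K) : K) + ((R x : K) - (x : Kˣ))) + -(((R y : K) - (y : Kˣ)) * (s : K) ^ 2) := by
        have e2 : ((R x - R y * s ^ 2 : 𝓞 K) : K) = (R x : K) - R y * (s : K) ^ 2 := by simp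
        rw [e2]; ring
      rw [e1]
      apply Valuation.map_add_lt
      · apply Valuation.map_add_lt
        · rw [Valuation.map_neg]; exact (val_lt_four_iff v _).mpr h1
        · exact hR x
      · rw [Valuation.map_neg, map_mul, map_pow]
        calc _ ≤ v.valuation K ((R y : K) - (y : Kˣ)) * 1 := by
              gcongr; exact pow_le_one' (v.valuation_le_one s) 2
          _ < _ := by rw [mul_one]; exact hR y
    have hs0 : (s : K) ≠ 0 := by
      intro h
      have h5 : s = 0 := by exact_mod_cast h
      rw [h, zero_pow two_ne_zero, mul_zero, zero_sub, Valuation.map_neg, hx1] at hlt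
      exact absurd (hlt.trans_le (val_pos_four v)) (lt_irrefl _)
    refine ⟨Units.mk0 (s : K) hs0, ?_⟩
    have e1 : (((x⁻¹ * y : Uv v) : Kˣ) : K) * ((Units.mk0 (s : K) hs0 : Kˣ) : K) ^ 2 - 1 =
      ((x : Kˣ) : K)⁻¹ * ((y : Kˣ) * (s : K) ^ 2 - (x : Kˣ)) := by
      have := (x : Kˣ).ne_zero
      push_cast; field_simp; rfl
    rw [e1, map_mul, map_inv₀, hx1, inv_one, one_mul]; exact hlt
  let sq : (𝓞 K ⧸ I)ˣ →* (𝓞 K ⧸ I)ˣ := powMonoidHom 2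
  let Φ : Uv v ⧸ (LS v).subgroupOf (Uv v) → (𝓞 K ⧸ I)ˣ ⧸ sq.range := fun q => QuotientGroup.mk (F q.out)
  have hΦ : Function.Injective Φ := by
    intro a b hab
    have h1 := QuotientGroup.eq.mp hab
    obtain ⟨u, hu⟩ := h1
    have h2 := key a.out b.out ⟨u⁻¹, by
      have : u ^ 2 = (F a.out)⁻¹ * F b.out := hu
      rw [inv_pow, this]; group⟩
    have h3 := QuotientGroup.eq.mpr h2
    rwa [QuotientGroup.out_eq', QuotientGroup.out_eq'] at h3
  have hle : Nat.card (Uv v ⧸ (LS v).subgroupOf (Uv v)) ≤ Nat.card ((𝓞 K ⧸ I)ˣ ⧸ sq.range) :=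
    Nat.card_le_card_of_injective Φ hΦ
  have hfin : Finite (Uv v ⧸ (LS v).subgroupOf (Uv v)) := Finite.of_injective Φ hΦ
  constructor
  · refine hle.trans ?_
    change sq.range.index ≤ _
    rw [Subgroup.index_range]
    refine le_trans ?_ (card_sq_eq_one v)
    have : Finite {x : 𝓞 K ⧸ v.asIdeal ^ (2 * e2 v + 1) // x ^ 2 = 1} := Subtype.finite
    refine Nat.card_le_card_of_injective (fun x => ⟨((x : (𝓞 K ⧸ I)ˣ) : 𝓞 K ⧸ I), ?_⟩) ?_
    · have := x.2
      rw [MonoidHom.mem_ker] at this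
      have h2 := congrArg (fun z : (𝓞 K ⧸ I)ˣ => (z : 𝓞 K ⧸ I)) this
      simpa [sq] using h2
    · intro x y hxy
      apply Subtype.ext; apply Units.ext
      exact congrArg Subtype.val hxy
  · change Nat.card (Uv v ⧸ (LS v).subgroupOf (Uv v)) ≠ 0
    exact Nat.card_ne_zero.mpr ⟨inferInstance, hfin⟩

/-- even order -/
def Ev (v : Pr K) : Subgroup Kˣ where
  carrier := {x | Even (ord v (x : K))}
  one_mem' := by simp
  mul_mem' := fun {a b} ha hb => by
    change Even (ord v ((a * b : Kˣ) : K))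
    rw [Units.val_mul, ord_mul v a.ne_zero b.ne_zero]; exact Even.add ha hb
  inv_mem' := fun {a} ha => by
    change Even (ord v ((a⁻¹ : Kˣ) : K))
    rw [Units.val_inv_eq_inv_val, ord_inv]; exact Even.neg ha

theorem mem_Ev {v : Pr K} {x : Kˣ} : x ∈ Ev v ↔ Even (ord v (x : K)) := Iff.rfl

theorem LS_le_Ev (v : Pr K) : LS v ≤ Ev v := fun _ h => ord_even_of_LS h

theorem Ev_index (v : Pr K) : (Ev v).index = 2 := by
  obtain ⟨π, hπ0, hπ⟩ := exists_uniformizer v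
  rw [Subgroup.index_eq_two_iff]
  refine ⟨Units.mk0 (π : K) hπ0, fun b => ?_⟩
  rw [mem_Ev, mem_Ev, Units.val_mul, ord_mul v b.ne_zero (Units.ne_zero _), Units.val_mk0, hπ]
  by_cases h : Even (ord v (b : K))
  · right; exact ⟨h, by rw [Int.even_add_one]; simpa using h⟩
  · left; exact ⟨by rw [Int.even_add_one]; exact h, h⟩

theorem LS_index (v : Pr K) : (LS v).index ≤ 4 * (Ideal.absNorm v.asIdeal) ^ e2 v ∧
    (LS v).index ≠ 0 := by
  obtain ⟨h1, h2⟩ := LS_units v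
  have hE : Ev v = Uv v ⊔ LS v := by
    apply le_antisymm
    · intro x hx
      obtain ⟨k, hk⟩ := hx
      obtain ⟨π, hπ0, hπ⟩ := exists_uniformizer v
      let p := Units.mk0 (π : K) hπ0
      have : x = (x * (p ^ (-k)) ^ 2) * (p ^ k) ^ 2 := by
        rw [mul_assoc, ← mul_pow, ← zpow_add]; simp
      rw [this]
      refine Subgroup.mul_mem_sup ?_ (sq_mem_LS v _)
      rw [mem_Uv]
      have e1 : ((x * (p ^ (-k)) ^ 2 : Kˣ) : K) = (x : K) * ((π : K) ^ (-k)) ^ 2 := by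
        rw [Units.val_mul, Units.val_pow_eq_pow_val, Units.val_zpow_eq_zpow_val]; rfl
      rw [e1, ord_mul v x.ne_zero (pow_ne_zero _ (zpow_ne_zero _ hπ0)), ord_pow, ord_zpow, hπ, hk]
      push_cast; ring
    · refine sup_le ?_ (LS_le_Ev v)
      intro x hx
      rw [mem_Ev, mem_Uv.mp hx]; exact Even.zero
  have h3 : (LS v).relIndex (Ev v) = (LS v).relIndex (Uv v) := by
    rw [hE]; exact Subgroup.relIndex_sup_right _ _
  have h4 := Subgroup.relIndex_mul_index (LS_le_Ev v)
  rw [h3, Ev_index] at h4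
  rw [← h4]
  constructor
  · omega
  · omega

end LSsec
end Pourchet


set_option linter.unusedSectionVars false
set_option linter.unusedVariables false

namespace Pourchet
open Module NumberField IsDedekindDomain nonZeroDivisors

section Ext
variable {K L : Type*} [Field K] [NumberField K] [Field L] [NumberField L] [Algebra K L]

theorem coe_alg (r : 𝓞 K) : ((algebraMap (𝓞 K) (𝓞 L) r : 𝓞 L) : L) = algebraMap K L (r : K) := rfl

/-- The prime below. -/
noncomputable def dn (w : Pr L) : Pr K where
  asIdeal := w.asIdeal.comap (algebraMap (𝓞 K) (𝓞 L))
  isPrime := inferInstance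
  ne_bot := by
    intro h
    exact w.ne_bot (Ideal.eq_bot_of_comap_eq_bot h)

theorem mem_dn (w : Pr L) (r : 𝓞 K) :
    r ∈ (dn w : Pr K).asIdeal ↔ algebraMap (𝓞 K) (𝓞 L) r ∈ w.asIdeal := Iff.rfl

instance dn_liesOver (w : Pr L) : w.asIdeal.LiesOver (dn w : Pr K).asIdeal := ⟨rfl⟩

/-- ramification index -/
noncomputable def ee (K : Type*) {L : Type*} [Field K] [NumberField K] [Field L] [NumberField L]
  [Algebra K L] (w : Pr L) : ℕ := (dn w : Pr K).asIdeal.ramificationIdx' w.asIdeal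

theorem ord_alg (w : Pr L) (x : K) :
    ord w (algebraMap K L x) = ee K w * ord (dn w : Pr K) x := by
  rw [ord, ← HeightOneSpectrum.valuation_liesOver L (dn w : Pr K) w, WithZero.log_pow, ord, ee]
  simp

theorem ee_pos (w : Pr L) : 0 < ee K w := by
  obtain ⟨π, hπ0, hπ⟩ := exists_uniformizer (dn w : Pr K)
  have h1 : π ∈ (dn w : Pr K).asIdeal := by rw [← ord_pos_iff _ _ hπ0, hπ]; norm_num
  have h2 : ((algebraMap (𝓞 K) (𝓞 L) π : 𝓞 L) : L) ≠ 0 := by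
    rw [coe_alg]; simpa using hπ0
  have h3 := (ord_pos_iff w _ h2).mpr ((mem_dn w π).mp h1)
  rw [coe_alg, ord_alg, hπ] at h3
  omega

theorem dn_surj (v : Pr K) : ∃ w : Pr L, dn w = v := by
  have : Algebra.IsIntegral (𝓞 K) (𝓞 L) := inferInstance
  have hm : v.asIdeal.IsMaximal := v.isMaximal
  obtain ⟨Q, hQ, hl⟩ := Ideal.exists_maximal_ideal_liesOver_of_isIntegral (S := 𝓞 L) v.asIdeal
  have hb : Q ≠ ⊥ := by
    rintro rfl
    apply v.ne_bot
    have := hl.over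
    rw [this]
    exact Ideal.under_bot _ _
  refine ⟨⟨Q, hQ.isPrime, hb⟩, ?_⟩
  apply HeightOneSpectrum.ext
  exact hl.over.symm

theorem pr_ext {v w : Pr L} (h : ∀ x : L, ord v x = ord w x) : v = w := by
  apply HeightOneSpectrum.ext
  ext r
  by_cases hr : (r : L) = 0
  · have : r = 0 := RingOfIntegers.ext hr
    subst this; simp
  · rw [← ord_pos_iff v r hr, ← ord_pos_iff w r hr, h]

theorem ord_val_eq {v w : Pr L} {x y : L} (hx : x ≠ 0) (hy : y ≠ 0)
    (h : ∀ n : ℕ, (n : ℤ) ≤ ord v x ↔ (n : ℤ) ≤ ord w y) (h1 : 0 ≤ ord v x) (h2 : 0 ≤ ord w y) :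
    ord v x = ord w y := by
  apply le_antisymm
  · have := (h (ord v x).toNat).mp (by omega)
    omega
  · have := (h (ord w y).toNat).mpr (by omega)
    omega

/-- the conjugate prime -/
noncomputable def conj (σ : L ≃ₐ[K] L) (w : Pr L) : Pr L where
  asIdeal := w.asIdeal.comap (RingOfIntegers.mapRingEquiv σ.toRingEquiv)
  isPrime := inferInstance
  ne_bot := by
    intro h
    apply w.ne_bot
    have h1 : w.asIdeal.comap (RingOfIntegers.mapRingEquiv σ.toRingEquiv) = Ideal.comap (RingOfIntegers.mapRingEquiv σ.toRingEquiv) ⊥ := by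
      rw [h]
      exact (Ideal.comap_bot_of_injective _ (RingOfIntegers.mapRingEquiv σ.toRingEquiv).injective).symm
    exact Ideal.comap_injective_of_surjective _ (RingOfIntegers.mapRingEquiv σ.toRingEquiv).surjective h1

theorem ord_conj (σ : L ≃ₐ[K] L) (w : Pr L) (x : L) : ord (conj σ w) x = ord w (σ x) := by
  have key : ∀ r : 𝓞 L, r ≠ 0 → ord (conj σ w) (r : L) = ord w (σ (r : L)) := by
    intro r hr
    set τ := RingOfIntegers.mapRingEquiv σ.toRingEquiv with hτ
    have hc : ((τ r : 𝓞 L) : L) = σ (r : L) := rfl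
    have hr0 : (r : L) ≠ 0 := coe_ne_zero' hr
    have hr1 : ((τ r : 𝓞 L) : L) ≠ 0 := by rw [hc]; simpa using hr0
    rw [← hc]
    refine ord_val_eq hr0 hr1 (fun n => ?_) (ord_nonneg _ _) (ord_nonneg _ _)
    rw [ord_ge_iff _ _ hr0, ord_ge_iff _ _ hr1]
    have h1 : (conj σ w).asIdeal ^ n = (w.asIdeal ^ n).comap τ := by
      change (w.asIdeal.comap τ) ^ n = _
      rw [← Ideal.map_symm τ, ← Ideal.map_symm τ, Ideal.map_pow]
    rw [h1]; exact Ideal.mem_comap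
  by_cases hx : x = 0
  · subst hx; simp
  obtain ⟨a, b, hb, rfl⟩ := IsFractionRing.div_surjective (A := 𝓞 L) x
  have hb0 : b ≠ 0 := nonZeroDivisors.ne_zero hb
  have ha0 : a ≠ 0 := by rintro rfl; simp at hx
  have hbL := coe_ne_zero' hb0
  have haL := coe_ne_zero' ha0
  change ord _ ((a : L) / (b : L)) = ord _ (σ ((a : L) / (b : L)))
  rw [map_div₀, ord_div _ haL hbL, ord_div _ (by simpa using haL) (by simpa using hbL), key a ha0, key b hb0]

theorem dn_conj (σ : L ≃ₐ[K] L) (w : Pr L) : (dn (conj σ w) : Pr K) = dn w := by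
  apply HeightOneSpectrum.ext
  ext r
  rw [mem_dn, mem_dn]
  by_cases hr : r = 0
  · subst hr; simp
  have h2 : ((algebraMap (𝓞 K) (𝓞 L) r : 𝓞 L) : L) ≠ 0 := by
    rw [coe_alg]; simpa using hr
  rw [← ord_pos_iff _ _ h2, ← ord_pos_iff _ _ h2, ord_conj, coe_alg, AlgEquiv.commutes]

/-- Quadratic extensions with explicit generator. -/
structure Quad (K L : Type*) [Field K] [Field L] [Algebra K L] where
  a : K
  δ : L
  σ : L ≃ₐ[K] L
  hδ : δ ^ 2 = algebraMap K L a
  hσ : σ δ = -δ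
  ha : a ≠ 0
  span : ∀ y : L, ∃ c d : K, y = algebraMap K L c + algebraMap K L d * δ

namespace Quad
variable (q : Quad K L)
include q

theorem δ_ne : q.δ ≠ 0 := by
  intro h
  have := q.hδ
  rw [h, zero_pow two_ne_zero] at this
  exact q.ha ((map_eq_zero (algebraMap K L)).mp this.symm)

theorem σσ (y : L) : q.σ (q.σ y) = y := by
  obtain ⟨c, d, rfl⟩ := q.span y
  simp [q.hσ]

theorem fixed {y : L} (h : q.σ y = y) : ∃ c : K, algebraMap K L c = y := by
  obtain ⟨c, d, rfl⟩ := q.span y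
  simp only [map_add, map_mul, AlgEquiv.commutes, q.hσ] at h
  have h2 : algebraMap K L d * q.δ = 0 := by
    have : (2 : L) * (algebraMap K L d * q.δ) = 0 := by linear_combination -h
    exact (mul_eq_zero.mp this).resolve_left two_ne_zero
  exact ⟨c, by rw [h2, add_zero]⟩

/-- norm -/
noncomputable def nm (y : L) : K := (q.fixed (y := y * q.σ y) (by rw [map_mul, q.σσ, mul_comm])).choose

theorem nm_spec (y : L) : algebraMap K L (q.nm y) = y * q.σ y :=
  (q.fixed (y := y * q.σ y) (by rw [map_mul, q.σσ, mul_comm])).choose_spec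

theorem nm_eq (c d : K) : q.nm (algebraMap K L c + algebraMap K L d * q.δ) = c ^ 2 - q.a * d ^ 2 := by
  apply (algebraMap K L).injective
  rw [q.nm_spec]
  simp only [map_add, map_mul, AlgEquiv.commutes, q.hσ, map_sub, map_pow, ← q.hδ]
  ring

theorem nm_ne {y : L} (hy : y ≠ 0) : q.nm y ≠ 0 := by
  intro h
  have := q.nm_spec y
  rw [h, map_zero] at this
  rcases mul_eq_zero.mp this.symm with h | h
  · exact hy h
  · exact hy (by simpa using h)

/-- conjugate prime -/
noncomputable abbrev cj (w : Pr L) : Pr L := conj q.σ w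

theorem ord_cj (w : Pr L) (x : L) : ord (q.cj w) x = ord w (q.σ x) := ord_conj _ _ _

theorem cj_cj (w : Pr L) : q.cj (q.cj w) = w := pr_ext fun x => by
  rw [q.ord_cj, q.ord_cj, q.σσ]

theorem dn_cj (w : Pr L) : (dn (q.cj w) : Pr K) = dn w := dn_conj _ _

theorem ord_nm (w : Pr L) {y : L} (hy : y ≠ 0) :
    ee K w * ord (dn w : Pr K) (q.nm y) = ord w y + ord (q.cj w) y := by
  rw [← ord_alg, q.nm_spec, ord_mul w hy (by simpa using hy), q.ord_cj]

theorem dn_eq {w w' : Pr L} (h : (dn w' : Pr K) = dn w) : w' = w ∨ w' = q.cj w := by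
  classical
  by_contra hcon
  push Not at hcon
  obtain ⟨h1, h2⟩ := hcon
  obtain ⟨x, hx⟩ := crt ({w', w, q.cj w} : Finset (Pr L)) (fun u => if u = w' then 0 else 1) (fun _ => 1)
  have hx1 : x ∈ w'.asIdeal := by simpa using hx w' (by simp)
  have hx2 : x - 1 ∈ w.asIdeal := by simpa [h1.symm] using hx w (by simp)
  have hx3 : x - 1 ∈ (q.cj w).asIdeal := by simpa [h2.symm] using hx (q.cj w) (by simp)
  have n2 : x ∉ w.asIdeal := fun hh => w.isPrime.ne_top ((Ideal.eq_top_iff_one _).mpr (by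
    simpa using Ideal.sub_mem _ hh hx2))
  have n3 : x ∉ (q.cj w).asIdeal := fun hh => (q.cj w).isPrime.ne_top ((Ideal.eq_top_iff_one _).mpr (by
    simpa using Ideal.sub_mem _ hh hx3))
  have hx0 : (x : L) ≠ 0 := by
    intro h0
    have : x = 0 := RingOfIntegers.ext h0
    rw [this] at n2
    exact n2 (Ideal.zero_mem _)
  have a1 := (ord_pos_iff w' x hx0).mpr hx1
  have a2 := (ord_eq_zero_iff w x hx0).mpr n2
  have a3 := (ord_eq_zero_iff _ x hx0).mpr n3
  have b1 := q.ord_nm w hx0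
  have b2 := q.ord_nm w' hx0
  have a4 := ord_nonneg (q.cj w') x
  rw [a2, a3, add_zero] at b1
  have p := ee_pos (K := K) w
  have : ord (dn w : Pr K) (q.nm (x : L)) = 0 := by
    rcases mul_eq_zero.mp b1 with h | h
    · omega
    · exact h
  rw [h, this] at b2
  omega

theorem ee_one_of_split {w : Pr L} (h : q.cj w ≠ w) : ee K w = 1 := by
  classical
  obtain ⟨c, hc⟩ := exists_ord_prescribed {w, q.cj w} (fun u => if u = w then 1 else 0)
  have h1 := hc w (by simp)
  have h2 := hc (q.cj w) (by simp)
  simp only [h, if_true, if_false] at h1 h2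
  have h3 := q.ord_nm w c.ne_zero
  rw [h1, h2] at h3
  have := Int.eq_one_or_neg_one_of_mul_eq_one (by linarith : (ee K w : ℤ) * _ = 1)
  omega

theorem ee_le_two (w : Pr L) : ee K w = 1 ∨ ee K w = 2 := by
  by_cases h : q.cj w = w
  · obtain ⟨π, h0, h1⟩ := exists_uniformizer w
    have h3 := q.ord_nm w h0
    rw [h, h1] at h3
    have : (ee K w : ℤ) ∣ 2 := ⟨_, by linarith⟩
    have h4 : ee K w ∣ 2 := by exact_mod_cast this
    exact (Nat.dvd_prime Nat.prime_two).mp h4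
  · left; exact q.ee_one_of_split h

/-- unramified criterion -/
theorem ee_one_of {w : Pr L} (α : L) (h1 : w.valuation L α ≤ 1)
    (h2 : w.valuation L (α - q.σ α) = 1) : ee K w = 1 := by
  by_cases h : q.cj w = w
  swap
  · exact q.ee_one_of_split h
  have hσv : ∀ x, ord w (q.σ x) = ord w x := fun x => by rw [← q.ord_cj, h]
  obtain ⟨a, b, hab⟩ := q.span α
  have hb : b ≠ 0 := by
    rintro rfl
    rw [hab] at h2
    simp at h2
  obtain ⟨π, h0, hπ⟩ := exists_uniformizer w
  obtain ⟨c, d, hcd⟩ := q.span (π : L)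
  -- π = c' + d' α
  obtain ⟨c', d', hπ'⟩ : ∃ c' d' : K, (π : L) = algebraMap K L c' + algebraMap K L d' * α :=
    ⟨c - d / b * a, d / b, by
      have hbL : algebraMap K L b ≠ 0 := by simpa using hb
      rw [hab, hcd]; simp only [map_sub, map_mul, map_div₀]; field_simp; ring⟩
  have hvσ : w.valuation L (q.σ (π : L)) = w.valuation L (π : L) :=
    (val_eq_iff w (by simpa using h0) h0).mpr (hσv _)
  have e1 : (π : L) - q.σ (π : L) = algebraMap K L d' * (α - q.σ α) := by
    rw [hπ']; simp only [map_add, map_mul, AlgEquiv.commutes]; ring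
  have hd : w.valuation L (algebraMap K L d') ≤ w.valuation L (π : L) := by
    have : w.valuation L (algebraMap K L d') = w.valuation L ((π : L) - q.σ (π : L)) := by
      rw [e1, map_mul, h2, mul_one]
    rw [this]
    refine (Valuation.map_sub _ _ _).trans ?_
    rw [hvσ, max_self]
  have hdα : w.valuation L (algebraMap K L d' * α) ≤ w.valuation L (algebraMap K L d') := by
    rw [map_mul]; exact mul_le_of_le_one_right' h1
  have hc : w.valuation L (algebraMap K L c') ≤ w.valuation L (π : L) := by
    have : algebraMap K L c' = (π : L) - algebraMap K L d' * α := by rw [hπ']; ring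
    rw [this]
    refine (Valuation.map_sub _ _ _).trans (max_le le_rfl (hdα.trans hd))
  have hmax : w.valuation L (π : L) ≤ max (w.valuation L (algebraMap K L c')) (w.valuation L (algebraMap K L d')) := by
    conv_lhs => rw [hπ']
    refine (Valuation.map_add _ _ _).trans (max_le_max le_rfl hdα)
  have fin : ∀ x : K, w.valuation L (algebraMap K L x) = w.valuation L (π : L) → ee K w = 1 := by
    intro x hx
    have hx0 : algebraMap K L x ≠ 0 := by
      intro h; rw [h, map_zero] at hx; exact val_ne_zero w h0 hx.symm
    rw [val_eq_iff w hx0 h0, ord_alg, hπ] at hx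
    have := Int.eq_one_or_neg_one_of_mul_eq_one hx
    omega
  rcases le_max_iff.mp hmax with h | h
  · exact fin _ (le_antisymm hc h)
  · exact fin _ (le_antisymm hd h)

theorem ee_one_of_even {w : Pr L} (h2 : ord w (2 : L) = 0) (h : Even (ord (dn w : Pr K) q.a)) :
    ee K w = 1 := by
  obtain ⟨k, hk⟩ := h
  obtain ⟨π, h0, hπ⟩ := exists_uniformizer (dn w : Pr K)
  have hδ : 2 * ord w q.δ = ee K w * (k + k) := by
    have := ord_pow w q.δ 2
    rw [q.hδ, ord_alg, hk] at this
    push_cast at this; linarith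
  have hπL : algebraMap K L (π : K) ≠ 0 := by simpa using h0
  have hα0 : q.δ * algebraMap K L (π : K) ^ (-k) ≠ 0 := mul_ne_zero q.δ_ne (zpow_ne_zero _ hπL)
  have hα : ord w (q.δ * algebraMap K L (π : K) ^ (-k)) = 0 := by
    rw [ord_mul w q.δ_ne (zpow_ne_zero _ hπL), ord_zpow, ord_alg, hπ]; linarith
  refine q.ee_one_of _ ((val_eq_one_iff w hα0).mpr hα).le ?_
  have e : q.δ * algebraMap K L (π : K) ^ (-k) - q.σ (q.δ * algebraMap K L (π : K) ^ (-k)) =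
    2 * (q.δ * algebraMap K L (π : K) ^ (-k)) := by
    rw [map_mul, q.hσ, map_zpow₀, AlgEquiv.commutes]; ring
  rw [e, val_eq_one_iff w (mul_ne_zero two_ne_zero hα0), ord_mul w two_ne_zero hα0, h2, hα, add_zero]

theorem ee_two_of_odd {w : Pr L} (h : Odd (ord (dn w : Pr K) q.a)) : ee K w = 2 := by
  rcases q.ee_le_two w with h1 | h1
  · have := ord_pow w q.δ 2
    rw [q.hδ, ord_alg, h1] at this
    obtain ⟨k, hk⟩ := h
    push_cast at this
    omega
  · exact h1

theorem cj_of_ee_two {w : Pr L} (h : ee K w = 2) : q.cj w = w := by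
  by_contra hc
  have := q.ee_one_of_split hc
  omega

/-- v splits -/
def Split (v : Pr K) : Prop := ∀ w : Pr L, (dn w : Pr K) = v → q.cj w ≠ w

theorem split_of {w : Pr L} (h : q.cj w ≠ w) : q.Split (dn w) := by
  intro w' hw'
  rcases q.dn_eq hw' with rfl | rfl
  · exact h
  · rw [q.cj_cj]; exact h.symm

theorem split_of_LS {v : Pr K} {b : Kˣ} (hb : b ∈ LS v) (ha : q.a = b) : q.Split v := by
  obtain ⟨z, hz⟩ := hb
  intro w hw
  subst hw
  set t : K := ((b : K) * (z : K) ^ 2 - 1) / 4 with ht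
  have ht1 : (dn w : Pr K).valuation K t < 1 := by
    have h4 := val_four_pos (dn w : Pr K)
    rw [ht, map_div₀, div_lt_one₀ h4]; exact hz
  set θ : L := (q.δ * algebraMap K L z - 1) / 2 with hθ
  have hs : q.σ θ = -1 - θ := by
    rw [hθ]; simp only [map_div₀, map_sub, map_mul, q.hσ, AlgEquiv.commutes, map_one, map_ofNat]
    ring
  have hmul : θ * q.σ θ = - algebraMap K L t := by
    rw [hs, hθ, ht]
    have hd : q.δ ^ 2 = algebraMap K L b := by rw [q.hδ, ha]
    simp only [map_div₀, map_sub, map_mul, map_pow, map_one, map_ofNat]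
    rw [← hd]; ring
  have hθ0 : θ ≠ 0 := by
    intro h; rw [h, map_zero] at hs; norm_num at hs
  have hσθ0 : q.σ θ ≠ 0 := by simpa using hθ0
  have ht0 : t ≠ 0 := by
    intro h; rw [h, map_zero, neg_zero] at hmul
    exact mul_ne_zero hθ0 hσθ0 hmul
  have hpos : 0 < ord w θ + ord w (q.σ θ) := by
    rw [← ord_mul w hθ0 hσθ0, hmul, ord_neg, ord_alg]
    have := (val_lt_one_iff _ ht0).mp ht1
    have := ee_pos (K := K) w
    positivity
  have aux : ∀ x y : L, x ≠ 0 → y = -1 - x → y ≠ 0 → 0 < ord w x → ord w y = 0 := by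
    intro x y hx hxy hy hpos
    rw [← val_eq_one_iff w hy]
    have : w.valuation L (-1 : L) = 1 := by rw [Valuation.map_neg, map_one]
    rw [← this]
    apply Valuation.map_eq_of_sub_lt
    have e : y - -1 = -x := by rw [hxy]; ring
    rw [this, e, Valuation.map_neg, val_lt_one_iff w hx]; exact hpos
  intro hcj
  have h5 : ord w (q.σ θ) = ord w θ := by rw [← q.ord_cj, hcj]
  have h6 := aux θ (q.σ θ) hθ0 hs hσθ0 (by omega)
  omega

/-- norms of units at ramified odd primes are local squares -/
theorem nm_LS {w : Pr L} (h2 : ord (dn w : Pr K) (2 : K) = 0) (h : Odd (ord (dn w : Pr K) q.a))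
    {y : L} (hy : y ≠ 0) (hy0 : ord w y = 0) : Units.mk0 _ (q.nm_ne hy) ∈ LS (dn w : Pr K) := by
  have he := q.ee_two_of_odd h
  have hδ : ord w q.δ = ord (dn w : Pr K) q.a := by
    have := ord_pow w q.δ 2
    rw [q.hδ, ord_alg, he] at this
    push_cast at this; linarith
  obtain ⟨c, d, rfl⟩ := q.span y
  have h4 : (dn w : Pr K).valuation K 4 = 1 := by
    rw [show (4 : K) = 2 ^ 2 by norm_num, val_eq_one_iff _ (by norm_num), ord_pow, h2, mul_zero]
  have hdo : ∀ d : K, Odd (ord w (algebraMap K L d * q.δ)) ∨ d = 0 := by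
    intro d
    by_cases hd : d = 0
    · exact Or.inr hd
    · left
      rw [ord_mul w (by simpa using hd) q.δ_ne, ord_alg, he, hδ]
      exact Even.add_odd (by simp) h
  have hc0 : c ≠ 0 := by
    rintro rfl
    rw [map_zero, zero_add] at hy0 hy
    rcases hdo d with h | rfl
    · rw [hy0] at h; simp at h
    · simp at hy
  have hcL : algebraMap K L c ≠ 0 := by simpa using hc0
  have key : ord (dn w : Pr K) c = 0 ∧ (dn w : Pr K).valuation K (q.a * d ^ 2) < 1 := by
    by_cases hd : d = 0
    · subst hd
      rw [map_zero, zero_mul, add_zero, ord_alg, he] at hy0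
      refine ⟨by push_cast at hy0; omega, by simp⟩
    have hdL : algebraMap K L d * q.δ ≠ 0 := mul_ne_zero (by simpa using hd) q.δ_ne
    have hodd := (hdo d).resolve_right hd
    have hev : ord w (algebraMap K L c) = 2 * ord (dn w : Pr K) c := by rw [ord_alg, he]; rfl
    have hv0 := (val_eq_one_iff w hy).mpr hy0
    have hne : ord w (algebraMap K L c) ≠ ord w (algebraMap K L d * q.δ) := by
      intro h; rw [← h, hev] at hodd
      exact (Int.not_odd_iff_even.mpr (even_two_mul _)) hodd
    have hc : ord w (algebraMap K L c) = 0 ∧ 0 < ord w (algebraMap K L d * q.δ) := by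
      rcases lt_or_gt_of_ne hne with h | h
      · have := Valuation.map_add_eq_of_lt_right (w.valuation L) ((val_lt_iff w hdL hcL).mpr h)
        rw [add_comm, hv0, eq_comm, val_eq_one_iff w hcL] at this
        omega
      · have := Valuation.map_add_eq_of_lt_right (w.valuation L) ((val_lt_iff w hcL hdL).mpr h)
        rw [hv0, eq_comm, val_eq_one_iff w hdL] at this
        rw [this] at hodd; simp at hodd
    refine ⟨by omega, ?_⟩
    have hne0 : q.a * d ^ 2 ≠ 0 := mul_ne_zero q.ha (pow_ne_zero _ hd)
    rw [val_lt_one_iff _ hne0]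
    have e := ord_pow w (algebraMap K L d * q.δ) 2
    have e' : (algebraMap K L d * q.δ) ^ 2 = algebraMap K L (q.a * d ^ 2) := by
      rw [mul_pow, q.hδ]; simp [mul_comm]
    rw [e', ord_alg, he] at e
    push_cast at e; omega
  obtain ⟨k1, k2⟩ := key
  refine ⟨(Units.mk0 c hc0)⁻¹, ?_⟩
  rw [h4]
  have e : ((Units.mk0 _ (q.nm_ne hy) : Kˣ) : K) * (((Units.mk0 c hc0)⁻¹ : Kˣ) : K) ^ 2 - 1 =
    - (q.a * d ^ 2) * (c⁻¹) ^ 2 := by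
    rw [Units.val_mk0, q.nm_eq, Units.val_inv_eq_inv_val, Units.val_mk0]; field_simp; ring
  rw [e, map_mul, Valuation.map_neg, map_pow, map_inv₀, (val_eq_one_iff _ hc0).mpr k1]
  simpa using k2

theorem exists_w_split (v : Pr K) (h : ¬ q.Split v) : ∃ w : Pr L, (dn w : Pr K) = v ∧ q.cj w = w := by
  unfold Split at h
  push Not at h
  exact h

theorem even_ord_nm {v : Pr K} (h : ¬ q.Split v) (hur : ∀ w : Pr L, (dn w : Pr K) = v → ee K w = 1)
    {y : L} (hy : y ≠ 0) : Even (ord v (q.nm y)) := by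
  obtain ⟨w, rfl, hw⟩ := q.exists_w_split v h
  have := q.ord_nm w hy
  rw [hur w rfl, hw] at this
  exact ⟨ord w y, by push_cast at this; linarith⟩

end Quad
end Ext
end Pourchet


set_option linter.unusedSectionVars false
set_option linter.unusedVariables false

namespace Pourchet
open Module NumberField IsDedekindDomain nonZeroDivisors

section LemA
variable {K L : Type*} [Field K] [NumberField K] [Field L] [NumberField L] [Algebra K L]

theorem rank_succ (K : Type*) [Field K] [NumberField K] [IsTotallyComplex K] :
    Units.rank K + 1 = InfinitePlace.nrComplexPlaces K := by
  have h1 := InfinitePlace.card_eq_nrRealPlaces_add_nrComplexPlaces K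
  have h2 : InfinitePlace.nrRealPlaces K = 0 := IsTotallyComplex.nrRealPlaces_eq_zero K
  have h3 : 0 < Fintype.card (InfinitePlace K) := Fintype.card_pos
  rw [Units.rank]
  omega

theorem finrank_c (K : Type*) [Field K] [NumberField K] [IsTotallyComplex K] :
    finrank ℚ K = 2 * InfinitePlace.nrComplexPlaces K   := IsTotallyComplex.finrank K

namespace Quad
variable (q : Quad K L)
include q

theorem indep {c d : K} (h : algebraMap K L c + algebraMap K L d * q.δ = 0) : c = 0 ∧ d = 0 := by
  have h2 := congrArg q.σ h
  simp only [map_add, map_mul, AlgEquiv.commutes, q.hσ, map_zero] at h2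
  have h3 : algebraMap K L c = 0 := by linear_combination (h + h2) / 2
  rw [h3, zero_add] at h
  refine ⟨by simpa using h3, ?_⟩
  have := (mul_eq_zero.mp h).resolve_right q.δ_ne
  simpa using this

theorem finrank_eq : finrank K L = 2 := by
  let F : (K × K) →ₗ[K] L :=
    { toFun := fun p => algebraMap K L p.1 + algebraMap K L p.2 * q.δ
      map_add' := fun x y => by simp only [Prod.fst_add, Prod.snd_add, map_add]; ring
      map_smul' := fun r x => by
        simp only [Prod.smul_fst, Prod.smul_snd, smul_eq_mul, map_mul, RingHom.id_apply]
        rw [Algebra.smul_def]; ring }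
  have hF : Function.Bijective F := by
    constructor
    · rw [injective_iff_map_eq_zero]
      rintro ⟨c, d⟩ h
      obtain ⟨rfl, rfl⟩ := q.indep h
      rfl
    · intro y
      obtain ⟨c, d, rfl⟩ := q.span y
      exact ⟨(c, d), rfl⟩
  rw [← (LinearEquiv.ofBijective F hF).finrank_eq, Module.finrank_prod, Module.finrank_self]

theorem nr_eq [IsTotallyComplex K] [IsTotallyComplex L] :
    InfinitePlace.nrComplexPlaces L = 2 * InfinitePlace.nrComplexPlaces K := by
  have h1 := finrank_c K
  have h2 := finrank_c L
  have h3 := Module.finrank_mul_finrank ℚ K L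
  rw [q.finrank_eq] at h3
  omega

open Classical in
/-- primes above a finite set -/
noncomputable def up (S : Finset (Pr K)) : Finset (Pr L) :=
  S.biUnion (fun v => {(dn_surj (L := L) v).choose, q.cj (dn_surj (L := L) v).choose})

theorem mem_up {S : Finset (Pr K)} {w : Pr L} : w ∈ q.up S ↔ dn w ∈ S := by
  classical
  simp only [up, Finset.mem_biUnion, Finset.mem_insert, Finset.mem_singleton]
  constructor
  · rintro ⟨v, hv, h | h⟩
    · rw [h, (dn_surj (L := L) v).choose_spec]; exact hv
    · rw [h, q.dn_cj, (dn_surj (L := L) v).choose_spec]; exact hv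
  · intro h
    exact ⟨dn w, h, q.dn_eq ((dn_surj (L := L) (dn w : Pr K)).choose_spec.symm)⟩

open Classical in
theorem card_up (S : Finset (Pr K)) : (q.up S).card + (S.filter (fun v => ¬ q.Split v)).card = 2 * S.card := by
  rw [up, Finset.card_biUnion, Finset.card_filter, ← Finset.sum_add_distrib]
  · rw [mul_comm, ← smul_eq_mul, ← Finset.sum_const]
    apply Finset.sum_congr rfl
    intro v hv
    set w := (dn_surj (L := L) v).choose with hw
    have hdw : dn w = v := (dn_surj (L := L) v).choose_spec
    by_cases h : q.cj w = w
    · have : ¬ q.Split v := fun hs => hs w hdw h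
      simp [h, this]
    · have : q.Split v := hdw ▸ q.split_of h
      have h' : w ≠ q.cj w := fun e => h e.symm
      rw [Finset.card_pair h']; simp [this]
  · intro v hv v' hv' hne
    rw [Function.onFun, Finset.disjoint_left]
    intro w hw hw'
    apply hne
    have aux : ∀ v : Pr K, w ∈ ({(dn_surj (L := L) v).choose, q.cj (dn_surj (L := L) v).choose} : Finset (Pr L)) → dn w = v := by
      intro v hv
      rw [Finset.mem_insert, Finset.mem_singleton] at hv
      rcases hv with h | h
      · rw [h, (dn_surj (L := L) v).choose_spec]
      · rw [h, q.dn_cj, (dn_surj (L := L) v).choose_spec]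
    rw [← aux v hw, ← aux v' hw']

/-- norm on units -/
noncomputable def nmU : Lˣ →* Kˣ where
  toFun y := Units.mk0 (q.nm y) (q.nm_ne y.ne_zero)
  map_one' := by
    apply Units.ext; apply (algebraMap K L).injective
    simp [q.nm_spec]
  map_mul' x y := by
    apply Units.ext; apply (algebraMap K L).injective
    simp only [Units.val_mul, Units.val_mk0, map_mul, q.nm_spec]; ring

theorem nmU_val (y : Lˣ) : ((q.nmU y : Kˣ) : K) = q.nm (y : L) := rfl

/-- inclusion on units -/
def io (K L : Type*) [Field K] [Field L] [Algebra K L] : Kˣ →* Lˣ := Units.map (algebraMap K L).toMonoidHom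

omit q in
theorem io_val (x : Kˣ) : ((io K L x : Lˣ) : L) = algebraMap K L (x : K) := rfl

omit q in
theorem io_inj : Function.Injective (io K L) := Units.map_injective (algebraMap K L).injective

noncomputable def sU : Lˣ →* Lˣ := Units.map q.σ.toAlgHom.toRingHom.toMonoidHom

theorem sU_val (x : Lˣ) : ((q.sU x : Lˣ) : L) = q.σ (x : L) := rfl

theorem io_mem_SU {S : Finset (Pr K)} {x : Kˣ} : io K L x ∈ SU (q.up S) ↔ x ∈ SU S := by
  constructor
  · intro h v hv
    obtain ⟨w, rfl⟩ := dn_surj (L := L) v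
    have := h w (fun h' => hv (q.mem_up.mp h'))
    rw [io_val, ord_alg] at this
    have p := ee_pos (K := K) w
    rcases mul_eq_zero.mp this with h | h
    · omega
    · exact h
  · intro h w hw
    rw [io_val, ord_alg, h _ (fun h' => hw (q.mem_up.mpr h')), mul_zero]

theorem sU_mem {S : Finset (Pr K)} {x : Lˣ} (h : x ∈ SU (q.up S)) : q.sU x ∈ SU (q.up S) := by
  intro w hw
  rw [sU_val, ← q.ord_cj]
  apply h
  rw [q.mem_up, q.dn_cj, ← q.mem_up]; exact hw

theorem nmU_mem {S : Finset (Pr K)} {x : Lˣ} (h : x ∈ SU (q.up S)) : q.nmU x ∈ SU S := by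
  rw [← q.io_mem_SU]
  have : io K L (q.nmU x) = x * q.sU x := by
    apply Units.ext; rw [io_val, nmU_val, q.nm_spec]; rfl
  rw [this]
  exact mul_mem h (q.sU_mem h)

theorem hilbert90 {u : Lˣ} (h : u * q.sU u = 1) : ∃ x : Lˣ, u = x / q.sU x := by
  have h' : (u : L) * q.σ (u : L) = 1 := congrArg (fun z : Lˣ => (z : L)) h
  by_cases h1 : (u : L) + 1 = 0
  · refine ⟨Units.mk0 q.δ q.δ_ne, ?_⟩
    apply Units.ext
    rw [Units.val_div_eq_div_val, sU_val, Units.val_mk0, q.hσ, div_neg, div_self q.δ_ne]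
    linear_combination h1
  · refine ⟨Units.mk0 _ h1, ?_⟩
    have h2 : q.σ ((u : L) + 1) ≠ 0 := by rw [Ne, map_eq_zero_iff _ q.σ.injective]; exact h1
    apply Units.ext
    rw [Units.val_div_eq_div_val, sU_val, Units.val_mk0, eq_div_iff h2]
    rw [map_add, map_one]
    linear_combination h'

theorem MD_index {S T : Finset (Pr K)} (hS : Cl S) (hST : Disjoint S T)
    (hur : ∀ w : Pr L, dn w ∉ S → dn w ∉ T → ee K w = 1)
    (hram : ∀ w : Pr L, dn w ∈ T → ee K w = 2)
    (D : Lˣ →* Lˣ) (hD : ∀ x, D x = x / q.sU x)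
    (M : Subgroup Lˣ) (hM : ∀ x, x ∈ M ↔ x ∈ SU (q.up S) ∧ x * q.sU x = 1) :
    ((SU (q.up S)).map D).relIndex M ≤ 2 ^ T.card ∧ ((SU (q.up S)).map D).relIndex M ≠ 0 := by
  classical
  choose X hX using fun m : M => q.hilbert90 ((hM m).mp m.2).2
  choose W hW using fun v : Pr K => dn_surj (L := L) v
  have inv : ∀ m : M, ∀ w : Pr L, dn w ∉ S → ord (q.cj w) (X m : L) = ord w (X m : L) := by
    intro m w hw
    have h1 := ((hM m).mp m.2).1 w (fun h => hw (q.mem_up.mp h))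
    rw [hX m, Units.val_div_eq_div_val, ord_div _ (Units.ne_zero _) (Units.ne_zero _), sU_val, ← q.ord_cj] at h1
    linarith
  let Φ : M ⧸ ((SU (q.up S)).map D).subgroupOf M → (T → Bool) := fun m t =>
    decide (Even (ord (W t) (X m.out : L)))
  have key : ∀ m m' : M, (∀ t ∈ T, (Even (ord (W t) (X m : L)) ↔ Even (ord (W t) (X m' : L)))) →
      m⁻¹ * m' ∈ ((SU (q.up S)).map D).subgroupOf M := by
    intro m m' hmm
    rw [Subgroup.mem_subgroupOf]
    set y := (X m)⁻¹ * X m' with hy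
    have hordy : ∀ w : Pr L, ord w (y : L) = ord w (X m' : L) - ord w (X m : L) := by
      intro w
      rw [hy, Units.val_mul, Units.val_inv_eq_inv_val, ord_mul w (inv_ne_zero (Units.ne_zero _)) (Units.ne_zero _), ord_inv]; ring
    have hyD : ((m⁻¹ * m' : M) : Lˣ) = y / q.sU y := by
      rw [hy, map_mul, map_inv]
      have h1 := hX m
      have h2 := hX m'
      push_cast
      rw [h1, h2, mul_div_mul_comm, inv_div_inv, inv_div]
    -- choose c
    have hfin : {v : Pr K | ord (W v) (y : L) ≠ 0}.Finite := by
      refine ((ord_finite (y : L) y.ne_zero).image (fun w => dn w)).subset ?_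
      intro v hv
      exact ⟨W v, hv, hW v⟩
    let e : Pr K →₀ ℤ := Finsupp.onFinset hfin.toFinset (fun v => if v ∈ T then - (ord (W v) (y : L)) / 2 else - ord (W v) (y : L))
      (by intro v hv; rw [Set.Finite.mem_toFinset]; intro h; simp [h] at hv)
    obtain ⟨c, hc⟩ := hS e
    refine ⟨y * io K L c, ?_, ?_⟩
    · intro w hw
      rw [q.mem_up] at hw
      have hww : ord w (y : L) = ord (W (dn w)) (y : L) := by
        rcases q.dn_eq (hW (dn w)) with h | h
        · rw [h]
        · rw [h, hordy, hordy, inv m _ hw, inv m' _ hw]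
      rw [Units.val_mul, ord_mul w y.ne_zero (Units.ne_zero _), io_val, ord_alg, hc _ hw, hww]
      by_cases hT : dn w ∈ T
      · have hev : Even (ord (W (dn w)) (y : L)) := by
          rw [hordy, Int.even_sub]
          exact (hmm _ hT).symm
        obtain ⟨k, hk⟩ := hev
        simp only [e, Finsupp.onFinset_apply, hT, if_true, hram w hT, hk]
        push_cast; omega
      · simp only [e, Finsupp.onFinset_apply, hT, if_false, hur w hw hT]
        push_cast; ring
    · rw [hD, hyD, map_mul]
      have : q.sU (io K L c) = io K L c := by
        apply Units.ext; rw [sU_val, io_val, AlgEquiv.commutes]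
      rw [this, mul_div_mul_right_eq_div]
  have hΦ : Function.Injective Φ := by
    intro a b hab
    have h2 := key a.out b.out (fun t ht => by
      have := congrFun hab ⟨t, ht⟩
      simpa [Φ] using this)
    have h3 := QuotientGroup.eq.mpr h2
    rwa [QuotientGroup.out_eq', QuotientGroup.out_eq'] at h3
  have hfin : Finite (M ⧸ ((SU (q.up S)).map D).subgroupOf M) := Finite.of_injective Φ hΦ
  constructor
  · have := Nat.card_le_card_of_injective Φ hΦ
    refine this.trans ?_
    simp
  · change Nat.card (M ⧸ ((SU (q.up S)).map D).subgroupOf M) ≠ 0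
    exact Nat.card_ne_zero.mpr ⟨inferInstance, hfin⟩

open Classical in
theorem lemmaA [IsTotallyComplex K] {S T : Finset (Pr K)} (hS : Cl S) (hST : Disjoint S T)
    (hur : ∀ w : Pr L, dn w ∉ S → dn w ∉ T → ee K w = 1)
    (hram : ∀ w : Pr L, dn w ∈ T → ee K w = 2) :
    ((SU (q.up S)).map q.nmU).relIndex (SU S) ≠ 0 ∧
    2 * ((SU (q.up S)).map q.nmU).relIndex (SU S) ≤ 2 ^ ((S.filter (fun v => ¬ q.Split v)).card + T.card) := by
  have : IsTotallyComplex L := isTotallyComplex_of_algebra K L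
  let N : Lˣ →* Lˣ := (MonoidHom.id Lˣ) * q.sU
  let D : Lˣ →* Lˣ := (MonoidHom.id Lˣ) / q.sU
  let U := SU (q.up S)
  let P := (SU S).map (io K L)
  let M := U ⊓ N.ker
  have hNio : N = (io K L).comp q.nmU := by
    ext y
    change (y : L) * q.σ y = algebraMap K L (q.nm y)
    rw [q.nm_spec]
  have hP : ∀ x, x ∈ P ↔ x ∈ U ∧ q.sU x = x := by
    intro x
    constructor
    · rintro ⟨y, hy, rfl⟩
      refine ⟨q.io_mem_SU.mpr hy, ?_⟩
      apply Units.ext; rw [sU_val, io_val, AlgEquiv.commutes]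
    · rintro ⟨h1, h2⟩
      obtain ⟨c, hc⟩ := q.fixed (y := (x : L)) (congrArg (fun z : Lˣ => (z : L)) h2)
      have hc0 : c ≠ 0 := by rintro rfl; rw [map_zero] at hc; exact x.ne_zero hc.symm
      have hx : io K L (Units.mk0 c hc0) = x := Units.ext hc
      exact ⟨Units.mk0 c hc0, by rw [← hx] at h1; exact q.io_mem_SU.mp h1, hx⟩
  have hM : ∀ x, x ∈ M ↔ x ∈ U ∧ x * q.sU x = 1 := fun x => Iff.rfl
  have hh := herbrand q.sU (fun x => Units.ext (q.σσ x)) U (fun x hx => q.sU_mem hx) N D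
    (fun x => rfl) (fun x => rfl) P M hP hM
  obtain ⟨hMD, hMD0⟩ := q.MD_index hS hST hur hram D (fun x => rfl) M hM
  -- relIndex transfers
  have e1 : (U.map N).relIndex P = (U.map q.nmU).relIndex (SU S) := by
    rw [hNio, ← Subgroup.map_map]
    exact Subgroup.relIndex_map_map_of_injective _ _ (io_inj (K := K) (L := L))
  -- rank of P
  let eP : SU S ≃* P := (SU S).equivMapOfInjective _ (io_inj (K := K) (L := L))
  have hPfg : Group.FG P := Group.fg_of_surjective (f := eP.toMonoidHom) eP.surjective
  have hPrk : rk P = S.card + Units.rank K := by rw [← rk_congr eP, SU_rk]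
  have hPneg : -1 ∈ P := ⟨-1, neg_one_mem_SU S, by apply Units.ext; rw [io_val]; simp⟩
  have hP2 := sq_relIndex P hPneg
  -- rank of M
  let f : U →* P := { toFun := fun x => ⟨N x, by
                        rw [hNio]; exact ⟨q.nmU x, q.nmU_mem x.2, rfl⟩⟩
                      map_one' := by apply Subtype.ext; simp
                      map_mul' := fun x y => by apply Subtype.ext; simp }
  have hrkU := rk_eq_add f
  have hrange : rk f.range = rk P := by
    apply rk_finite_exponent _ 2 two_pos
    rintro ⟨x, hx⟩
    obtain ⟨h1, h2⟩ := (hP x).mp hx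
    refine ⟨⟨x, h1⟩, ?_⟩
    apply Subtype.ext
    change x * q.sU x = x ^ 2
    rw [h2, sq]
  let eM : f.ker ≃* M :=
    { toFun := fun x => ⟨((x : U) : Lˣ), (x : U).2, by
        exact MonoidHom.mem_ker.mpr (congrArg Subtype.val (MonoidHom.mem_ker.mp x.2))⟩
      invFun := fun x => ⟨⟨(x : Lˣ), x.2.1⟩, by
        exact MonoidHom.mem_ker.mpr (Subtype.ext (MonoidHom.mem_ker.mp x.2.2))⟩
      left_inv := fun x => rfl
      right_inv := fun x => rfl
      map_mul' := fun x y => rfl }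
  have hkfg : Group.FG f.ker := fg_subgroup _
  have hMfg : Group.FG M := Group.fg_of_surjective (f := eM.toMonoidHom) eM.surjective
  have hMrk : rk M + (S.card + Units.rank K) = (q.up S).card + Units.rank L := by
    have hUrk : rk U = (q.up S).card + Units.rank L := SU_rk _
    rw [← rk_congr eM, ← hPrk, ← hUrk, hrkU, hrange]
  have hMneg : -1 ∈ M := (hM _).mpr ⟨neg_one_mem_SU _, by apply Units.ext; simp [sU_val]⟩
  have hM2 := sq_relIndex M hMneg
  rw [e1, hM2, hP2] at hh
  have hnr := q.nr_eq
  have r1 := rank_succ K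
  have r2 := rank_succ L
  have hcard := q.card_up S
  set i := (U.map q.nmU).relIndex (SU S) with hi
  change i ≠ 0 ∧ 2 * i ≤ _
  set ns := (S.filter (fun v => ¬ q.Split v)).card
  constructor
  · intro h0
    rw [h0, zero_mul] at hh
    exact (mul_ne_zero (pow_ne_zero _ two_ne_zero) hMD0) hh.symm
  · have hle : i * 2 ^ (rk M + 1) ≤ 2 ^ (rk P + 1) * 2 ^ T.card := by
      rw [hh]; gcongr
    have h5 : rk P + 1 + T.card + 1 = rk M + 1 + (ns + T.card) := by omega
    have h6 : (2 * i) * 2 ^ (rk M + 1) ≤ 2 ^ (ns + T.card) * 2 ^ (rk M + 1) := by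
      calc (2 * i) * 2 ^ (rk M + 1) = 2 * (i * 2 ^ (rk M + 1)) := by ring
        _ ≤ 2 * (2 ^ (rk P + 1) * 2 ^ T.card) := Nat.mul_le_mul_left 2 hle
        _ = 2 ^ (rk P + 1 + T.card + 1) := by ring
        _ = 2 ^ (rk M + 1 + (ns + T.card)) := by rw [h5]
        _ = 2 ^ (ns + T.card) * 2 ^ (rk M + 1) := by rw [add_comm, pow_add]
    exact Nat.le_of_mul_le_mul_right h6 (by positivity)

end Quad
end LemA
end Pourchet


set_option linter.unusedSectionVars false
set_option linter.unusedVariables false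

namespace Pourchet
open Module NumberField IsDedekindDomain nonZeroDivisors

section Bound
variable {K : Type*} [Field K] [NumberField K]

theorem pow_e2_dvd (v : Pr K) : v.asIdeal ^ e2 v ∣ Ideal.span {(2 : 𝓞 K)} := by
  rw [Ideal.dvd_span_singleton]
  have h0 : ((2 : 𝓞 K) : K) = 2 := map_ofNat (algebraMap (𝓞 K) K) 2
  have h1 := v.valuation_of_algebraMap (K := K) (2 : 𝓞 K)
  have h2 : v.valuation K (2 : K) = WithZero.exp (-(e2 v : ℤ)) := by
    rw [val_eq_exp v two_ne_zero, e2_cast]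
  rw [← v.intValuation_le_pow_iff_mem, ← h1]
  exact (congrArg (v.valuation K) h0).le.trans h2.le

theorem prod_e2_le (S : Finset (Pr K)) :
    ∏ v ∈ S, (Ideal.absNorm v.asIdeal) ^ e2 v ≤ 2 ^ finrank ℚ K := by
  have h1 : (∏ v ∈ S, v.asIdeal ^ e2 v) ∣ Ideal.span {(2 : 𝓞 K)} := by
    apply Finset.prod_dvd_of_isRelPrime
    · intro v _ w _ hvw
      apply IsCoprime.isRelPrime
      apply IsCoprime.pow
      rw [Ideal.isCoprime_iff_sup_eq]
      exact Ideal.IsMaximal.coprime_of_ne v.isMaximal w.isMaximal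
        (fun h => hvw (HeightOneSpectrum.ext h))
    · intro v _; exact pow_e2_dvd v
  have h2 := Ideal.absNorm_dvd_absNorm_of_le (Ideal.dvd_iff_le.mp h1)
  have h3 : Ideal.absNorm (Ideal.span {(2 : 𝓞 K)}) = 2 ^ finrank ℚ K := by
    rw [Ideal.absNorm_span_singleton]
    have : (2 : 𝓞 K) = algebraMap ℤ (𝓞 K) 2 := by simp
    rw [this, Algebra.norm_algebraMap, RingOfIntegers.rank]
    simp [Int.natAbs_pow]
  rw [h3, map_prod] at h2
  simp only [map_pow] at h2
  exact Nat.le_of_dvd (by positivity) h2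

end Bound

section Ex
universe u
open Polynomial

theorem exists_quad {K : Type u} [Field K] [NumberField K] (a : K) (ha : ¬ IsSquare a) :
    ∃ (L : Type u) (_ : Field L) (_ : NumberField L) (_ : Algebra K L) (q : Quad K L), q.a = a := by
  have hirr : Irreducible (X ^ 2 - C a : K[X]) := by
    apply X_pow_sub_C_irreducible_of_prime Nat.prime_two
    intro b hb
    exact ha ⟨b, by rw [← hb, sq]⟩
  haveI : Fact (Irreducible (X ^ 2 - C a : K[X])) := ⟨hirr⟩
  have hmon : (X ^ 2 - C a : K[X]).Monic := monic_X_pow_sub_C a two_ne_zero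
  let L := AdjoinRoot (X ^ 2 - C a : K[X])
  haveI : FiniteDimensional K L := hmon.finite_adjoinRoot
  haveI : CharZero L := charZero_of_injective_algebraMap (algebraMap K L).injective
  haveI : FiniteDimensional ℚ L := FiniteDimensional.trans ℚ K L
  haveI : NumberField L := ⟨⟩
  let δ : L := AdjoinRoot.root _
  have hδ : δ ^ 2 = algebraMap K L a := by
    have := AdjoinRoot.eval₂_root (X ^ 2 - C a : K[X])
    simp only [eval₂_sub, eval₂_pow, eval₂_X, eval₂_C] at this
    exact sub_eq_zero.mp this
  let s : L →ₐ[K] L := AdjoinRoot.liftAlgHom _ (Algebra.ofId K L) (-δ) (by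
    simp only [eval₂_sub, eval₂_pow, eval₂_X, eval₂_C]
    rw [neg_sq, hδ]; exact sub_self _)
  have hs : s δ = -δ := AdjoinRoot.liftAlgHom_root ..
  have hss : s.comp s = AlgHom.id K L := by
    apply AdjoinRoot.algHom_ext
    change s (s δ) = δ
    rw [hs, map_neg, hs, neg_neg]
  let σ : L ≃ₐ[K] L := AlgEquiv.ofAlgHom s s hss hss
  refine ⟨L, inferInstance, inferInstance, inferInstance,
    ⟨a, δ, σ, hδ, hs, by rintro rfl; exact ha (IsSquare.zero), ?_⟩, rfl⟩
  intro y
  obtain ⟨p, rfl⟩ := AdjoinRoot.mk_surjective y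
  have hd : (p %ₘ (X ^ 2 - C a)).degree ≤ 1 := by
    have h1 := degree_modByMonic_lt p hmon
    rw [degree_X_pow_sub_C two_pos] at h1
    exact Order.le_of_lt_succ h1
  have h2 := eq_X_add_C_of_degree_le_one hd
  have h3 : AdjoinRoot.mk (X ^ 2 - C a) p = AdjoinRoot.mk (X ^ 2 - C a) (p %ₘ (X ^ 2 - C a)) := by
    rw [AdjoinRoot.mk_eq_mk]
    exact ⟨p /ₘ (X ^ 2 - C a), by linear_combination -(modByMonic_add_div p (X ^ 2 - C a))⟩
  refine ⟨(p %ₘ (X ^ 2 - C a)).coeff 0, (p %ₘ (X ^ 2 - C a)).coeff 1, ?_⟩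
  rw [h3]
  conv_lhs => rw [h2]
  rw [map_add, map_mul, AdjoinRoot.mk_C, AdjoinRoot.mk_C, AdjoinRoot.mk_X, add_comm]
  rfl

end Ex
end Pourchet


set_option linter.unusedSectionVars false
set_option linter.unusedVariables false
set_option linter.style.haveILetI false

namespace Pourchet
open Module NumberField IsDedekindDomain nonZeroDivisors
open scoped ENNReal

section Zeta
variable (K : Type*) [Field K] [NumberField K]

/-- weight of a prime -/
noncomputable def wt (s : ℝ) {K : Type*} [Field K] [NumberField K] (v : Pr K) : ℝ≥0∞ :=
  ENNReal.ofReal ((Ideal.absNorm v.asIdeal : ℝ) ^ (-s))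

/-- zeta function as a sum over multisets of primes -/
noncomputable def ZZ (s : ℝ) : ℝ≥0∞ := ∑' m : Multiset (Pr K), (m.map (wt s)).prod

variable {K}

theorem wt_prod (s : ℝ) (m : Multiset (Pr K)) : (m.map (wt s)).prod =
    ENNReal.ofReal ((Ideal.absNorm (m.map (fun v : Pr K => v.asIdeal)).prod : ℝ) ^ (-s)) := by
  induction m using Multiset.induction_on with
  | empty => simp
  | cons v m ih =>
    rw [Multiset.map_cons, Multiset.prod_cons, Multiset.map_cons, Multiset.prod_cons, ih, map_mul,
      Nat.cast_mul, Real.mul_rpow (by positivity) (by positivity), ENNReal.ofReal_mul (by positivity), wt]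

theorem ideal_inj : Function.Injective
    (fun m : Multiset (Pr K) => (m.map (fun v : Pr K => v.asIdeal)).prod) := by
  classical
  intro m n h
  have key : ∀ m : Multiset (Pr K), UniqueFactorizationMonoid.normalizedFactors
      ((m.map (fun v : Pr K => v.asIdeal)).prod) = m.map (fun v : Pr K => v.asIdeal) := by
    intro m
    apply UniqueFactorizationMonoid.normalizedFactors_prod_of_prime
    intro p hp
    obtain ⟨v, -, rfl⟩ := Multiset.mem_map.mp hp
    exact v.prime
  have h2 := congrArg UniqueFactorizationMonoid.normalizedFactors h
  simp only [key] at h2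
  exact Multiset.map_injective (fun v w h => HeightOneSpectrum.ext h) h2

theorem ideal_ne (m : Multiset (Pr K)) : (m.map (fun v : Pr K => v.asIdeal)).prod ≠ ⊥ := by
  rw [← Ideal.zero_eq_bot]
  apply Multiset.prod_ne_zero
  intro h
  obtain ⟨v, -, h⟩ := Multiset.mem_map.mp h
  exact v.ne_bot h

theorem ideal_surj (I : Ideal (𝓞 K)) (hI : I ≠ ⊥) :
    ∃ m : Multiset (Pr K), (m.map (fun v : Pr K => v.asIdeal)).prod = I := by
  classical
  have h1 := Ideal.prod_normalizedFactors_eq_self hI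
  have h2 : ∀ J ∈ UniqueFactorizationMonoid.normalizedFactors I, ∃ v : Pr K, v.asIdeal = J := by
    intro J hJ
    have hp := UniqueFactorizationMonoid.prime_of_normalized_factor J hJ
    exact ⟨⟨J, Ideal.isPrime_of_prime hp, hp.ne_zero⟩, rfl⟩
  choose g hg using h2
  refine ⟨(UniqueFactorizationMonoid.normalizedFactors I).attach.map (fun J => g J.1 J.2), ?_⟩
  have e : ((fun v : Pr K => v.asIdeal) ∘ fun J : {x // x ∈ UniqueFactorizationMonoid.normalizedFactors I} =>
      g J.1 J.2) = Subtype.val := by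
    ext1 J; exact hg J.1 J.2
  rw [Multiset.map_map, e, Multiset.attach_map_val, h1]

/-- coefficients -/
noncomputable def tc (K : Type*) [Field K] [NumberField K] (s : ℝ) (n : ℕ) : ℝ :=
  if n = 0 then 0 else (Nat.card {I : Ideal (𝓞 K) // Ideal.absNorm I = n} : ℝ) * (n : ℝ) ^ (-s)

theorem tc_nonneg (s : ℝ) (n : ℕ) : 0 ≤ tc K s n := by
  unfold tc; split_ifs <;> positivity

theorem ZZ_eq (s : ℝ) : ZZ K s = ∑' n, ENNReal.ofReal (tc K s n) := by
  classical
  let h : ℕ → ℝ≥0∞ := fun n => if n = 0 then 0 else ENNReal.ofReal ((n : ℝ) ^ (-s))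
  have e1 : ZZ K s = ∑' I : Ideal (𝓞 K), h (Ideal.absNorm I) := by
    let φ := fun m : Multiset (Pr K) => (m.map (fun v : Pr K => v.asIdeal)).prod
    have hsup : Function.support (fun I : Ideal (𝓞 K) => h (Ideal.absNorm I)) ⊆ Set.range φ := by
      intro I hI
      apply ideal_surj
      rintro rfl
      apply hI
      simp [h]
    rw [ZZ, ← (ideal_inj (K := K)).tsum_eq hsup]
    congr 1
    ext m
    rw [wt_prod]
    have : Ideal.absNorm (φ m) ≠ 0 := by
      rw [Ne, Ideal.absNorm_eq_zero_iff]; exact ideal_ne m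
    simp only [h]
    rw [if_neg this]
  rw [e1, ← ENNReal.tsum_fiberwise _ (fun I : Ideal (𝓞 K) => Ideal.absNorm I)]
  congr 1
  ext n
  have e2 : ∀ I : ((fun I : Ideal (𝓞 K) => Ideal.absNorm I) ⁻¹' {n}), h (Ideal.absNorm I.1) = h n := by
    rintro ⟨I, hI⟩
    rw [show Ideal.absNorm I = n from hI]
  rw [tsum_congr e2, ENNReal.tsum_const]
  unfold tc
  by_cases hn : n = 0
  · simp [h, hn]
  · haveI : Finite ((fun I : Ideal (𝓞 K) => Ideal.absNorm I) ⁻¹' {n}) :=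
      Ideal.finite_setOfPred_absNorm_eq n
    simp only [h]
    rw [if_neg hn, if_neg hn, ENNReal.ofReal_mul (by positivity), ENat.card_eq_coe_natCard,
      ENNReal.ofReal_natCast]
    rfl

theorem zeta_real (s : ℝ) : dedekindZeta K s = ((∑' n, tc K s n : ℝ) : ℂ) := by
  rw [dedekindZeta, LSeries, Complex.ofReal_tsum]
  congr 1
  ext n
  rw [LSeries.term, tc]
  by_cases hn : n = 0
  · simp [hn]
  · rw [if_neg hn, if_neg hn, Complex.ofReal_mul, Complex.ofReal_cpow (by positivity)]
    push_cast
    rw [Complex.cpow_neg, div_eq_mul_inv]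

open Filter Topology in
theorem zeta_lim (K : Type*) [Field K] [NumberField K] : ∃ (z : ℝ → ℝ) (ρ : ℝ), 0 < ρ ∧
    Tendsto (fun s => (s - 1) * z s) (𝓝[>] 1) (𝓝 ρ) ∧
    ∀ᶠ s in 𝓝[>] (1 : ℝ), 0 ≤ z s ∧ ZZ K s = ENNReal.ofReal (z s) := by
  have h1 : Tendsto (fun s => (s - 1) * ∑' n, tc K s n) (𝓝[>] 1) (𝓝 (dedekindZeta_residue K)) := by
    have := tendsto_sub_one_mul_dedekindZeta_nhdsGT K
    have h2 := (Complex.continuous_re.tendsto _).comp this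
    refine h2.congr fun s => ?_
    simp only [Function.comp_apply]
    rw [zeta_real, ← Complex.ofReal_one, ← Complex.ofReal_sub, ← Complex.ofReal_mul, Complex.ofReal_re]
  refine ⟨fun s => ∑' n, tc K s n, dedekindZeta_residue K, dedekindZeta_residue_pos K, h1, ?_⟩
  have h2 := h1.eventually (lt_mem_nhds (dedekindZeta_residue_pos K))
  filter_upwards [h2] with s hs
  have hsum : Summable (tc K s) := by
    by_contra hcon
    rw [tsum_eq_zero_of_not_summable hcon, mul_zero] at hs
    exact lt_irrefl _ hs
  refine ⟨tsum_nonneg (tc_nonneg s), ?_⟩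
  rw [ZZ_eq, ENNReal.ofReal_tsum_of_nonneg (tc_nonneg s) hsum]

/-- partial zeta -/
noncomputable def ZF (s : ℝ) (F : Finset (Pr K)) : ℝ≥0∞ :=
  ∑' m : {m : Multiset (Pr K) // ∀ v ∈ m, v ∉ F}, (m.1.map (wt s)).prod

theorem ZF_empty (s : ℝ) : ZF s (∅ : Finset (Pr K)) = ZZ K s := by
  rw [ZF, ZZ]
  let e : {m : Multiset (Pr K) // ∀ v ∈ m, v ∉ (∅ : Finset (Pr K))} ≃ Multiset (Pr K) :=
    Equiv.subtypeUnivEquiv (fun m v _ => by simp)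
  exact e.tsum_eq (fun m => (m.map (wt s)).prod)

theorem ZF_le (s : ℝ) (F : Finset (Pr K)) : ZF s F ≤ ZZ K s := by
  exact ENNReal.tsum_comp_le_tsum_of_injective Subtype.val_injective
    (fun m : Multiset (Pr K) => (m.map (wt s)).prod)

theorem wt_le (s : ℝ) (hs : 1 < s) (v : Pr K) : wt s v ≤ 1 / 2 := by
  have h2 : 2 ≤ Ideal.absNorm v.asIdeal := by
    have h0 : Ideal.absNorm v.asIdeal ≠ 0 := by
      rw [Ne, Ideal.absNorm_eq_zero_iff]; exact v.ne_bot
    have h1 : Ideal.absNorm v.asIdeal ≠ 1 := by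
      rw [Ne, Ideal.absNorm_eq_one_iff]; exact v.isPrime.ne_top
    omega
  have h3 : ((Ideal.absNorm v.asIdeal : ℝ)) ^ (-s) ≤ 1 / 2 := by
    have h4 : (2 : ℝ) ≤ Ideal.absNorm v.asIdeal := by exact_mod_cast h2
    calc ((Ideal.absNorm v.asIdeal : ℝ)) ^ (-s) ≤ (Ideal.absNorm v.asIdeal : ℝ) ^ (-1 : ℝ) :=
          Real.rpow_le_rpow_of_exponent_le (by linarith) (by linarith)
      _ = (Ideal.absNorm v.asIdeal : ℝ)⁻¹ := Real.rpow_neg_one _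
      _ ≤ 1 / 2 := by rw [one_div]; exact inv_anti₀ (by norm_num) h4
  calc wt s v ≤ ENNReal.ofReal (1 / 2) := ENNReal.ofReal_le_ofReal h3
    _ = 1 / 2 := by rw [ENNReal.ofReal_div_of_pos two_pos]; simp

theorem ZF_insert (s : ℝ) (hs : 1 < s) (hfin : ZZ K s ≠ ∞) (F : Finset (Pr K)) [DecidableEq (Pr K)] (v : Pr K) :
    ZF s F ≤ 2 * ZF s (insert v F) := by
  classical
  have h1 : ZF s F ≤ ZF s (insert v F) + (1 / 2) * ZF s F := by
    conv_rhs => rw [ZF, ZF, ← ENNReal.tsum_mul_left]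
    rw [ZF]
    let A := {m : Multiset (Pr K) // ∀ v ∈ m, v ∉ F}
    let B := {m : Multiset (Pr K) // ∀ w ∈ m, w ∉ insert v F}
    let g : B ⊕ A → ℝ≥0∞ := Sum.elim (fun m => (m.1.map (wt s)).prod) (fun m => (1/2) * (m.1.map (wt s)).prod)
    have e : ∑' x, g x = (∑' m : B, (m.1.map (wt s)).prod) + ∑' m : A, (1/2) * (m.1.map (wt s)).prod :=
      Summable.tsum_sum (f := g) ENNReal.summable ENNReal.summable
    refine le_of_le_of_eq ?_ e
    let φ : A → B ⊕ A := fun m => if h : v ∈ m.1 then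
      Sum.inr ⟨m.1.erase v, fun w hw => m.2 w (Multiset.mem_of_mem_erase hw)⟩ else
      Sum.inl ⟨m.1, fun w hw => by
        rw [Finset.mem_insert, not_or]; exact ⟨fun h' => h (h' ▸ hw), m.2 w hw⟩⟩
    have hφ : Function.Injective φ := by
      intro m n hmn
      simp only [φ] at hmn
      split_ifs at hmn with h1 h2 h2
      · have h3 : m.1.erase v = n.1.erase v := congrArg Subtype.val (Sum.inr_injective hmn)
        apply Subtype.ext
        rw [← Multiset.cons_erase h1, ← Multiset.cons_erase h2, h3]
      · have h3 := congrArg (fun b : B => b.1) (Sum.inl.inj hmn)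
        exact Subtype.ext h3
    refine le_trans (ENNReal.tsum_le_tsum fun m => ?_) (ENNReal.tsum_comp_le_tsum_of_injective hφ g)
    simp only [φ]
    split_ifs with h
    · simp only [g, Sum.elim_inr]
      conv_lhs => rw [← Multiset.cons_erase h, Multiset.map_cons, Multiset.prod_cons]
      gcongr
      exact wt_le s hs v
    · exact le_rfl
  have hf2 : ZF s F ≠ ∞ := ne_top_of_le_ne_top hfin (ZF_le s F)
  have h2 : ZF s F = 1 / 2 * ZF s F + 1 / 2 * ZF s F := by
    rw [← add_mul, ENNReal.add_halves, one_mul]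
  rw [h2] at h1
  conv at h1 => rhs; rw [← h2]
  have hf3 : 1 / 2 * ZF s F ≠ ∞ := ENNReal.mul_ne_top (by simp) hf2
  have h3 : 1 / 2 * ZF s F ≤ ZF s (insert v F) := (ENNReal.add_le_add_iff_right hf3).mp h1
  calc ZF s F = 2 * (1 / 2 * ZF s F) := by
        rw [← mul_assoc, one_div, ENNReal.mul_inv_cancel (by simp) (by simp), one_mul]
    _ ≤ _ := by gcongr

theorem ZZ_le_ZF (s : ℝ) (hs : 1 < s) (hfin : ZZ K s ≠ ∞) (F : Finset (Pr K)) :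
    ZZ K s ≤ 2 ^ F.card * ZF s F := by
  classical
  induction F using Finset.induction_on with
  | empty => rw [ZF_empty]; simp
  | insert v F hv ih =>
    rw [Finset.card_insert_of_notMem hv, pow_succ, mul_assoc]
    refine ih.trans ?_
    gcongr
    exact ZF_insert s hs hfin F v

end Zeta
end Pourchet


set_option linter.unusedSectionVars false
set_option linter.unusedVariables false
set_option linter.style.haveILetI false

namespace Pourchet
open Module NumberField IsDedekindDomain nonZeroDivisors
open scoped ENNReal

section PropZ
variable {K L : Type*} [Field K] [NumberField K] [Field L] [NumberField L] [Algebra K L]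

namespace Quad
variable (q : Quad K L)
include q

theorem norm_le_of_split {w : Pr L} (h : q.cj w ≠ w) :
    Ideal.absNorm w.asIdeal ≤ Ideal.absNorm (dn w : Pr K).asIdeal := by
  classical
  let φ : 𝓞 K ⧸ (dn w : Pr K).asIdeal →+* 𝓞 L ⧸ w.asIdeal :=
    Ideal.quotientMap w.asIdeal (algebraMap (𝓞 K) (𝓞 L)) (fun r hr => hr)
  have hsurj : Function.Surjective φ := by
    intro y
    obtain ⟨α, rfl⟩ := Ideal.Quotient.mk_surjective y
    obtain ⟨β, hβ⟩ := crt {w, q.cj w} (fun u => if u = w then α else 0) (fun _ => 1)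
    have h1 := hβ w (by simp)
    have h2 := hβ (q.cj w) (by simp)
    rw [if_pos rfl, pow_one] at h1
    rw [if_neg h, pow_one, sub_zero] at h2
    let γ : 𝓞 L := ⟨q.σ (β : L), (RingOfIntegers.isIntegral_coe β).map q.σ⟩
    have hγ : γ ∈ w.asIdeal := by
      by_cases h0 : (γ : L) = 0
      · rw [show γ = 0 from RingOfIntegers.ext h0]; exact Ideal.zero_mem _
      · have hb0 : (β : L) ≠ 0 := by
          intro hb; apply h0; change q.σ (β : L) = 0; rw [hb, map_zero]
        rw [← ord_pos_iff _ _ h0]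
        change 0 < ord w (q.σ (β : L))
        rw [← q.ord_cj, ord_pos_iff _ _ hb0]
        exact h2
    obtain ⟨c, hc⟩ := q.fixed (y := (β : L) + q.σ (β : L)) (by rw [map_add, q.σσ, add_comm])
    have hci : IsIntegral ℤ c := by
      rw [← isIntegral_algebraMap_iff (algebraMap K L).injective, hc]
      exact (RingOfIntegers.isIntegral_coe β).add ((RingOfIntegers.isIntegral_coe β).map q.σ)
    refine ⟨Ideal.Quotient.mk _ (⟨c, hci⟩ : 𝓞 K), ?_⟩
    change Ideal.Quotient.mk _ (algebraMap (𝓞 K) (𝓞 L) ⟨c, hci⟩) = _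
    have e : algebraMap (𝓞 K) (𝓞 L) ⟨c, hci⟩ = β + γ := by
      apply RingOfIntegers.ext
      exact hc
    rw [e, Ideal.Quotient.eq]
    have : β + γ - α = (β - α) + γ := by ring
    rw [this]
    exact Ideal.add_mem _ h1 hγ
  have hfin : Finite (𝓞 K ⧸ (dn w : Pr K).asIdeal) := by
    have := finite_quot_pow (dn w : Pr K) 1; rwa [pow_one] at this
  have := Nat.card_le_card_of_surjective φ hsurj
  rw [Ideal.absNorm_apply, Ideal.absNorm_apply, Submodule.cardQuot_apply, Submodule.cardQuot_apply]
  exact this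

theorem ZF_sq_le (s : ℝ) (hs : 1 < s) (F : Finset (Pr K)) (hF : ∀ v ∉ F, q.Split v) :
    ZF s F * ZF s F ≤ ZZ L s := by
  classical
  choose up hup using dn_surj (K := K) (L := L)
  let A := {m : Multiset (Pr K) // ∀ v ∈ m, v ∉ F}
  let φ : A × A → Multiset (Pr L) := fun x => x.1.1.map up + x.2.1.map (fun v => q.cj (up v))
  have hinj : Function.Injective φ := by
    rintro ⟨⟨m, hm⟩, ⟨n, hn⟩⟩ ⟨⟨m', hm'⟩, ⟨n', hn'⟩⟩ h
    have key : ∀ (m n : Multiset (Pr K)) (hn : ∀ v ∈ n, v ∉ F),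
        (((m.map up + n.map (fun v => q.cj (up v))).filter (fun w => up (dn w) = w)).map dn) = m ∧
        ((m.map up + n.map (fun v => q.cj (up v))).filter (fun w => ¬ up (dn w) = w)).map dn = n := by
      intro m n hn
      have h1 : ∀ w ∈ m.map up, up (dn w : Pr K) = w := by
        intro w hw
        obtain ⟨v, _, rfl⟩ := Multiset.mem_map.mp hw
        rw [hup]
      have h2 : ∀ w ∈ n.map (fun v => q.cj (up v)), ¬ up (dn w : Pr K) = w := by
        intro w hw
        obtain ⟨v, hv, rfl⟩ := Multiset.mem_map.mp hw
        rw [q.dn_cj, hup]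
        exact (hF v (hn v hv) (up v) (hup v)).symm
      constructor
      · rw [Multiset.filter_add, Multiset.filter_eq_self.mpr h1, Multiset.filter_eq_nil.mpr h2,
          add_zero, Multiset.map_map]
        conv_rhs => rw [← Multiset.map_id m]
        exact Multiset.map_congr rfl (fun v _ => hup v)
      · rw [Multiset.filter_add, Multiset.filter_eq_self.mpr h2,
          Multiset.filter_eq_nil.mpr (fun w hw => not_not.mpr (h1 w hw)), zero_add, Multiset.map_map]
        conv_rhs => rw [← Multiset.map_id n]
        refine Multiset.map_congr rfl (fun v _ => ?_)
        simp only [Function.comp_apply, id]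
        rw [q.dn_cj, hup]
    have h' : m.map up + n.map (fun v => q.cj (up v)) = m'.map up + n'.map (fun v => q.cj (up v)) := h
    have k1 := key m n hn
    have k2 := key m' n' hn'
    rw [h'] at k1
    have e1 : m = m' := k1.1.symm.trans k2.1
    have e2 : n = n' := k1.2.symm.trans k2.2
    subst e1; subst e2; rfl
  have hw : ∀ v ∉ F, ∀ w : Pr L, dn w = v → wt s v ≤ wt s w := by
    intro v hv w hwv
    have h1 := q.norm_le_of_split (hF v hv w hwv)
    rw [hwv] at h1
    apply ENNReal.ofReal_le_ofReal
    have h0 : Ideal.absNorm w.asIdeal ≠ 0 := by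
      rw [Ne, Ideal.absNorm_eq_zero_iff]; exact w.ne_bot
    apply Real.rpow_le_rpow_of_nonpos (by positivity) (by exact_mod_cast h1) (by linarith)
  have hmap : ∀ (m : Multiset (Pr K)) (hm : ∀ v ∈ m, v ∉ F) (g : Pr K → Pr L) (hg : ∀ v, dn (g v) = v),
      (m.map (wt s)).prod ≤ ((m.map g).map (wt s)).prod := by
    intro m hm g hg
    rw [Multiset.map_map]
    exact Multiset.prod_map_le_prod_map _ _ (fun v hv => hw v (hm v hv) _ (hg v))
  calc ZF s F * ZF s F = ∑' x : A × A, (x.1.1.map (wt s)).prod * (x.2.1.map (wt s)).prod := by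
        rw [ENNReal.tsum_prod']
        simp_rw [ENNReal.tsum_mul_left]
        rw [ENNReal.tsum_mul_right]
        rfl
    _ ≤ ∑' x : A × A, ((φ x).map (wt s)).prod := by
        refine ENNReal.tsum_le_tsum fun x => ?_
        simp only [φ]
        rw [Multiset.map_add, Multiset.prod_add]
        exact mul_le_mul' (hmap _ x.1.2 _ hup) (hmap _ x.2.2 _ (fun v => by rw [q.dn_cj, hup]))
    _ ≤ ZZ L s := ENNReal.tsum_comp_le_tsum_of_injective hinj (fun m => (m.map (wt s)).prod)

open Filter Topology in
theorem exists_not_split (F : Finset (Pr K)) : ∃ v ∉ F, ¬ q.Split v := by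
  by_contra hcon
  push Not at hcon
  obtain ⟨z, ρ, hρ, hz, hz2⟩ := zeta_lim K
  obtain ⟨y, ρ', hρ', hy, hy2⟩ := zeta_lim L
  have hs1 : ∀ᶠ s in 𝓝[>] (1 : ℝ), 1 < s := self_mem_nhdsWithin
  have hlim1 : Tendsto (fun s => ((s - 1) * z s) ^ 2) (𝓝[>] 1) (𝓝 (ρ ^ 2)) := hz.pow 2
  have hs0 : Tendsto (fun s : ℝ => s - 1) (𝓝[>] 1) (𝓝 0) := by
    have : Tendsto (fun s : ℝ => s - 1) (𝓝 1) (𝓝 (1 - 1)) := (continuous_id.sub continuous_const).tendsto 1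
    rw [sub_self] at this
    exact this.mono_left nhdsWithin_le_nhds
  have hlim2 : Tendsto (fun s => 4 ^ F.card * ((s - 1) * ((s - 1) * y s))) (𝓝[>] 1)
      (𝓝 (4 ^ F.card * (0 * ρ'))) := (hs0.mul hy).const_mul _
  have hle : ∀ᶠ s in 𝓝[>] (1 : ℝ), ((s - 1) * z s) ^ 2 ≤ 4 ^ F.card * ((s - 1) * ((s - 1) * y s)) := by
    filter_upwards [hz2, hy2, hs1] with s h1 h2 h3
    have h4 := ZZ_le_ZF s h3 (by rw [h1.2]; exact ENNReal.ofReal_ne_top) F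
    have h5 := q.ZF_sq_le s h3 F hcon
    have h6 : ZZ K s * ZZ K s ≤ 4 ^ F.card * ZZ L s := by
      calc ZZ K s * ZZ K s ≤ (2 ^ F.card * ZF s F) * (2 ^ F.card * ZF s F) := mul_le_mul' h4 h4
        _ = (2 ^ F.card * 2 ^ F.card) * (ZF s F * ZF s F) := by ring
        _ = 4 ^ F.card * (ZF s F * ZF s F) := by rw [← mul_pow]; norm_num
        _ ≤ _ := by gcongr
    rw [h1.2, h2.2, ← ENNReal.ofReal_mul h1.1, show (4 : ℝ≥0∞) ^ F.card = ENNReal.ofReal (4 ^ F.card) by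
      rw [ENNReal.ofReal_pow (by norm_num)]; norm_num, ← ENNReal.ofReal_mul (by positivity),
      ENNReal.ofReal_le_ofReal_iff (mul_nonneg (by positivity) h2.1)] at h6
    calc ((s - 1) * z s) ^ 2 = (s - 1) ^ 2 * (z s * z s) := by ring
      _ ≤ (s - 1) ^ 2 * (4 ^ F.card * y s) := by gcongr
      _ = _ := by ring
  have h7 := le_of_tendsto_of_tendsto hlim1 hlim2 hle
  rw [zero_mul, mul_zero] at h7
  have : 0 < ρ ^ 2 := by positivity
  linarith

end Quad

open Quad

theorem ord_finset (x : K) (hx : x ≠ 0) : ∃ F : Finset (Pr K), ∀ v ∉ F, ord v x = 0 := by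
  classical
  have h := ord_finite x hx
  refine ⟨h.toFinset, fun v hv => ?_⟩
  by_contra h2
  exact hv (h.mem_toFinset.mpr h2)

theorem LS_up {w : Pr L} {b : Kˣ} (h : b ∈ LS (dn w : Pr K)) : io K L b ∈ LS w := by
  obtain ⟨z, hz⟩ := h
  refine ⟨io K L z, ?_⟩
  rw [io_val, io_val, ← map_pow, ← map_mul, ← map_one (algebraMap K L), ← map_sub,
    ← map_ofNat (algebraMap K L) 4]
  by_cases h0 : (b : K) * (z : K) ^ 2 - 1 = 0
  · rw [h0, map_zero, map_zero]
    exact (Valuation.pos_iff _).mpr ((_root_.map_ne_zero _).mpr (by norm_num))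
  · rw [val_lt_iff _ h0 (by norm_num)] at hz
    rw [val_lt_iff _ ((_root_.map_ne_zero _).mpr h0) ((_root_.map_ne_zero _).mpr (by norm_num)), ord_alg, ord_alg]
    have := ee_pos (K := K) w
    exact Int.mul_lt_mul_of_pos_left hz (by exact_mod_cast this)

/-- at an odd place, a product of two unit non-squares is a square -/
theorem LS_mul_of_not {v : Pr K} (h2 : ord v (2 : K) = 0) {a c : Kˣ} (ha : ord v (a : K) = 0)
    (hc : ord v (c : K) = 0) (ha' : a ∉ LS v) (hc' : c ∉ LS v) : a * c ∈ LS v := by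
  have h1 := LS_units v
  have he : e2 v = 0 := by rw [e2, h2]; rfl
  rw [he, pow_zero, mul_one] at h1
  have h3 : ((LS v).subgroupOf (Uv v)).index = 2 := by
    change (LS v).relIndex (Uv v) = 2
    have h4 : (LS v).relIndex (Uv v) ≠ 1 := by
      intro h
      rw [Subgroup.relIndex_eq_one] at h
      exact ha' (h ha)
    omega
  have h5 := Subgroup.mul_mem_iff_of_index_two h3 (a := ⟨a, ha⟩) (b := ⟨c, hc⟩)
  simp only [Subgroup.mem_subgroupOf] at h5
  exact h5.mpr (by tauto)

end PropZ

section PropC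
open Quad
universe u
variable {K L : Type u} [Field K] [NumberField K] [Field L] [NumberField L] [Algebra K L]

theorem Quad.not_sq_up (q : Quad K L) (c : Kˣ) (hc1 : ¬ IsSquare (c : K)) (hc2 : ¬ IsSquare (q.a * c)) :
    ¬ IsSquare (algebraMap K L c) := by
  rintro ⟨y, hy⟩
  obtain ⟨s, t, rfl⟩ := q.span y
  have h1 : algebraMap K L (s ^ 2 + q.a * t ^ 2 - c) + algebraMap K L (2 * s * t) * q.δ = 0 := by
    simp only [map_sub, map_add, map_mul, map_pow, map_ofNat]
    rw [← q.hδ]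
    linear_combination -hy
  obtain ⟨h2, h3⟩ := q.indep h1
  rcases mul_eq_zero.mp h3 with h4 | h4
  · have hs : s = 0 := by simpa using h4
    refine hc2 ⟨q.a * t, ?_⟩
    rw [hs] at h2
    linear_combination -q.a * h2
  · refine hc1 ⟨s, ?_⟩
    rw [h4] at h2
    linear_combination -h2

theorem Quad.propC_aux {M : Type*} [Field M] [NumberField M] [Algebra L M] (q : Quad K L) (c : Kˣ)
    (r : Quad L M) (hr : r.a = algebraMap K L c)
    (F : Finset (Pr K)) (hcon : ∀ v ∉ F, q.Split v → c ∈ LS v) : False := by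
  letI : DecidableEq (Pr K) := Classical.decEq _
  let a : Kˣ := Units.mk0 q.a q.ha
  obtain ⟨F', hF'⟩ : ∃ F' : Finset (Pr K), ∀ v, v ∉ F' → v ∉ F ∧ ord v (2 : K) = 0 ∧ ord v q.a = 0 ∧
      ord v (c : K) = 0 := by
    obtain ⟨F2, h2⟩ := ord_finset (2 : K) two_ne_zero
    obtain ⟨F3, h3⟩ := ord_finset q.a q.ha
    obtain ⟨F4, h4⟩ := ord_finset (c : K) c.ne_zero
    refine ⟨F ∪ (F2 ∪ (F3 ∪ F4)), fun v hw => ?_⟩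
    simp only [Finset.mem_union, not_or] at hw
    exact ⟨hw.1, h2 v hw.2.1, h3 v hw.2.2.1, h4 v hw.2.2.2⟩
  obtain ⟨w, hw, hns⟩ := r.exists_not_split (q.up F')
  rw [q.mem_up] at hw
  obtain ⟨hwF, hw2, hwa, hwc⟩ := hF' _ hw
  apply hns
  have main : io K L c ∈ LS w → r.Split w := fun h => r.split_of_LS h (by rw [hr, io_val])
  by_cases hcv : c ∈ LS (dn w : Pr K)
  · exact main (LS_up hcv)
  have hsp : ¬ q.Split (dn w) := fun h => hcv (hcon _ hwF h)
  have hav : a ∉ LS (dn w : Pr K) := fun h => hsp (q.split_of_LS h rfl)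
  have hac0 : a * c ∈ LS (dn w : Pr K) := LS_mul_of_not hw2 hwa hwc hav hcv
  have hac : io K L (a * c) ∈ LS w := LS_up hac0
  apply main
  have e : io K L (a * c) = (Units.mk0 q.δ q.δ_ne) ^ 2 * io K L c := by
    apply Units.ext
    rw [Units.val_mul, Units.val_pow_eq_pow_val, io_val, io_val, Units.val_mul, map_mul]
    change algebraMap K L q.a * _ = q.δ ^ 2 * _
    rw [q.hδ]
  rw [e] at hac
  exact (Subgroup.mul_mem_cancel_left _ (sq_mem_LS w _)).mp hac

theorem Quad.propC (q : Quad K L) (c : Kˣ) (hc1 : ¬ IsSquare (c : K)) (hc2 : ¬ IsSquare (q.a * c))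
    (F : Finset (Pr K)) : ∃ v ∉ F, q.Split v ∧ c ∉ LS v := by
  by_contra hcon
  push Not at hcon
  obtain ⟨M, _, _, _, r, hr⟩ := exists_quad (algebraMap K L c) (q.not_sq_up c hc1 hc2)
  exact q.propC_aux c r hr F hcon

end PropC
end Pourchet


set_option linter.unusedSectionVars false
set_option linter.unusedVariables false
set_option linter.style.haveILetI false

namespace Pourchet
open Module NumberField IsDedekindDomain nonZeroDivisors
open Quad

section Grp
variable {G : Type*} [CommGroup G]

theorem relIndex_biInf {ι : Type*} (V : Subgroup G) (H : ι → Subgroup G) (T : Finset ι) (n : ι → ℕ)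
    (h : ∀ t ∈ T, (H t).relIndex V ≤ n t ∧ (H t).relIndex V ≠ 0) :
    (⨅ t ∈ T, H t).relIndex V ≤ ∏ t ∈ T, n t ∧ (⨅ t ∈ T, H t).relIndex V ≠ 0 := by
  classical
  induction T using Finset.induction_on with
  | empty => simp
  | insert a T ha ih =>
    have h1 := h a (Finset.mem_insert_self _ _)
    have h2 := ih (fun t ht => h t (Finset.mem_insert_of_mem ht))
    rw [Finset.iInf_insert, Finset.prod_insert ha]
    exact ⟨Subgroup.relIndex_inf_le.trans (Nat.mul_le_mul h1.1 h2.1),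
      Subgroup.relIndex_inf_ne_zero h1.2 h2.2⟩

theorem mem_biInf {ι : Type*} (H : ι → Subgroup G) (T : Finset ι) (x : G) :
    x ∈ (⨅ t ∈ T, H t) ↔ ∀ t ∈ T, x ∈ H t := by
  simp only [Subgroup.mem_iInf]

theorem relIndex_le_two (H V : Subgroup G)
    (h : ∀ x ∈ V, ∀ y ∈ V, x ∉ H → y ∉ H → x * y⁻¹ ∈ H) : H.relIndex V ≤ 2 := by
  by_cases hV : V ≤ H
  · rw [Subgroup.relIndex_eq_one.mpr hV]; norm_num
  · obtain ⟨y, hy, hyH⟩ := SetLike.not_le_iff_exists.mp hV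
    apply le_of_eq
    rw [Subgroup.relIndex, Subgroup.index_eq_two_iff]
    refine ⟨⟨y, hy⟩⁻¹, fun b => ?_⟩
    simp only [Subgroup.mem_subgroupOf, Subgroup.coe_mul, Subgroup.coe_inv]
    by_cases hb : (b : G) ∈ H
    · right
      refine ⟨hb, fun h' => hyH ?_⟩
      have := H.mul_mem (H.inv_mem h') hb
      simpa using this
    · left
      exact ⟨h b b.2 y hy hb hyH, hb⟩

/-- lower bound for an index from separating elements -/
theorem le_relIndex {ι : Type*} (V : Subgroup G) (H : ι → Subgroup G) (T : Finset ι)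
    (hfin : (⨅ t ∈ T, H t).relIndex V ≠ 0)
    (h : ∀ A ⊆ T, ∃ x ∈ V, ∀ t ∈ T, x ∈ H t ↔ t ∉ A) : 2 ^ T.card ≤ (⨅ t ∈ T, H t).relIndex V := by
  classical
  choose! x hxV hx using h
  let I := ⨅ t ∈ T, H t
  let φ : T.powerset → V ⧸ (I.subgroupOf V) := fun A =>
    QuotientGroup.mk ⟨x A.1, hxV A.1 (Finset.mem_powerset.mp A.2)⟩
  have hinj : Function.Injective φ := by
    rintro ⟨A, hA⟩ ⟨B, hB⟩ hAB
    have h1 := QuotientGroup.eq.mp hAB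
    rw [Subgroup.mem_subgroupOf] at h1
    have h2 : (x A)⁻¹ * x B ∈ I := h1
    rw [mem_biInf] at h2
    apply Subtype.ext
    change A = B
    rw [Finset.mem_powerset] at hA hB
    ext t
    constructor
    · intro htA
      by_contra htB
      have h3 := (hx B hB t (hA htA)).mpr htB
      have h4 := (H t).mul_mem h3 ((H t).inv_mem (h2 t (hA htA)))
      have h5 : x A ∈ H t := by simpa using h4
      exact (hx A hA t (hA htA)).mp h5 htA
    · intro htB
      by_contra htA
      have h3 := (hx A hA t (hB htB)).mpr htA
      have h4 := (H t).mul_mem h3 ((h2 t (hB htB)))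
      have h5 : x B ∈ H t := by simpa using h4
      exact (hx B hB t (hB htB)).mp h5 htB
  have hf : Finite (V ⧸ (I.subgroupOf V)) := Nat.finite_of_card_ne_zero hfin
  have := Nat.card_le_card_of_injective φ hinj
  rw [Nat.card_eq_fintype_card, Fintype.card_coe, Finset.card_powerset] at this
  exact this
end Grp

section TP
universe u
variable {K L : Type u} [Field K] [NumberField K] [Field L] [NumberField L] [Algebra K L]

theorem SU_le_Uv {S : Finset (Pr K)} {v : Pr K} (hv : v ∉ S) : SU S ≤ Uv v := fun x hx => hx v hv

theorem LS_relIndex_two {S : Finset (Pr K)} {v : Pr K} (hv : v ∉ S) (h2 : ord v (2 : K) = 0) :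
    (LS v).relIndex (SU S) ≤ 2 ∧ (LS v).relIndex (SU S) ≠ 0 := by
  have h1 := LS_units v
  have he : e2 v = 0 := by rw [e2, h2]; rfl
  rw [he, pow_zero, mul_one] at h1
  have h3 : (LS v).relIndex (SU S) ∣ (LS v).relIndex (Uv v) ∨ True := Or.inr trivial
  have h4 := Subgroup.relIndex_le_of_le_right (SU_le_Uv hv) h1.2
  refine ⟨h4.trans h1.1, fun h0 => h1.2 (Subgroup.relIndex_eq_zero_of_le_right (SU_le_Uv hv) h0)⟩

theorem SU_sqrt {S : Finset (Pr K)} {x y : Kˣ} (hx : x ∈ SU S) (h : y ^ 2 = x) : y ∈ SU S := by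
  intro v hv
  have h1 := hx v hv
  rw [← h, Units.val_pow_eq_pow_val, ord_pow] at h1
  simpa using h1

theorem isSq_mem {S : Finset (Pr K)} {x : Kˣ} (hx : x ∈ SU S) (h : IsSquare (x : K)) :
    x ∈ (SU S).map (powMonoidHom 2) := by
  obtain ⟨y, hy⟩ := h
  have hy0 : y ≠ 0 := by rintro rfl; exact x.ne_zero (by simpa using hy)
  have h1 : (Units.mk0 y hy0) ^ 2 = x := by
    apply Units.ext; rw [Units.val_pow_eq_pow_val, hy, sq]; rfl
  exact ⟨Units.mk0 y hy0, SU_sqrt hx h1, h1⟩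

theorem sq_le_biInf (S T : Finset (Pr K)) : (SU S).map (powMonoidHom 2) ≤ SU S ⊓ ⨅ t ∈ T, LS t := by
  rintro x ⟨y, hy, rfl⟩
  refine ⟨(SU S).pow_mem hy 2, ?_⟩
  exact (mem_biInf _ _ _).mpr (fun t _ => sq_mem_LS t y)

theorem sq_index_split (S T : Finset (Pr K)) :
    ((SU S).map (powMonoidHom 2)).relIndex (SU S ⊓ ⨅ t ∈ T, LS t) * (⨅ t ∈ T, LS t).relIndex (SU S)
      = 2 ^ (S.card + Units.rank K + 1) := by
  have h1 := Subgroup.relIndex_mul_relIndex _ _ _ (sq_le_biInf S T) (inf_le_left : SU S ⊓ ⨅ t ∈ T, LS t ≤ SU S)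
  rw [Subgroup.inf_relIndex_left, sq_relIndex _ (neg_one_mem_SU S), SU_rk] at h1
  exact h1

theorem Quad.exists_T' (q : Quad K L) (S : Finset (Pr K)) (h2 : ∀ v ∉ S, ord v (2 : K) = 0)
    (ha : ∀ v ∉ S, ord v q.a = 0) (k : ℕ) (hk : k ≤ S.card + Units.rank K) :
    ∃ T : Finset (Pr K), T.card = k ∧ (∀ t ∈ T, t ∉ S ∧ q.Split t) ∧
      ∀ A ⊆ T, ∃ x ∈ SU S, ∀ t ∈ T, x ∈ LS t ↔ t ∉ A := by
  classical
  induction k with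
  | zero => exact ⟨∅, rfl, by simp, fun A hA => ⟨1, Subgroup.one_mem _, by simp⟩⟩
  | succ k ih =>
    obtain ⟨T, hTc, hT, hTx⟩ := ih (by omega)
    let V := SU S
    let V2 := V.map (powMonoidHom 2)
    let a : Kˣ := Units.mk0 q.a q.ha
    have haV : a ∈ V := ha
    -- the key element
    obtain ⟨c, hcV, hcT, hc1, hc2⟩ : ∃ c ∈ V, (∀ t ∈ T, c ∈ LS t) ∧ ¬ IsSquare (c : K) ∧
        ¬ IsSquare (q.a * c) := by
      by_contra hcon
      push Not at hcon
      have h3 := sq_index_split S T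
      have h4 : ((SU S).map (powMonoidHom 2)).relIndex (SU S ⊓ ⨅ t ∈ T, LS t) ≤ 2 := by
        apply relIndex_le_two
        have key : ∀ x ∈ SU S ⊓ ⨅ t ∈ T, LS t, x ∉ (SU S).map (powMonoidHom 2) →
            a * x ∈ (SU S).map (powMonoidHom 2) := by
          intro x hx hx2
          have h5 := hcon x hx.1 ((mem_biInf _ _ _).mp hx.2) (fun h => hx2 (isSq_mem hx.1 h))
          exact isSq_mem ((SU S).mul_mem haV hx.1) h5
        intro x hx y hy hx2 hy2
        have h5 := Subgroup.mul_mem _ (key x hx hx2) (Subgroup.inv_mem _ (key y hy hy2))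
        have e : a * x * (a * y)⁻¹ = x * y⁻¹ := by
          rw [mul_inv, mul_mul_mul_comm, mul_inv_cancel, one_mul]
        rwa [e] at h5
      have h5 := relIndex_biInf (SU S) LS T (fun _ => 2)
        (fun t ht => LS_relIndex_two (hT t ht).1 (h2 t (hT t ht).1))
      rw [Finset.prod_const, hTc] at h5
      have h6 : 2 ^ (S.card + Units.rank K + 1) ≤ 2 ^ (k + 1) := by
        rw [← h3, pow_succ, mul_comm]
        exact Nat.mul_le_mul h5.1 h4
      have h7 := (Nat.pow_le_pow_iff_right (by norm_num : 1 < 2)).mp h6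
      omega
    obtain ⟨t, htF, hts, htc⟩ := q.propC c hc1 hc2 (S ∪ T)
    rw [Finset.mem_union, not_or] at htF
    refine ⟨insert t T, by rw [Finset.card_insert_of_notMem htF.2, hTc], ?_, ?_⟩
    · intro s hs
      rcases Finset.mem_insert.mp hs with rfl | hs
      · exact ⟨htF.1, hts⟩
      · exact hT s hs
    · intro A hA
      obtain ⟨x, hxV, hx⟩ := hTx (A ∩ T) Finset.inter_subset_right
      have hx' : ∀ s ∈ T, x ∈ LS s ↔ s ∉ A := by
        intro s hs; rw [hx s hs, Finset.mem_inter]; tauto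
      by_cases hgood : x ∈ LS t ↔ t ∉ A
      · refine ⟨x, hxV, fun s hs => ?_⟩
        rcases Finset.mem_insert.mp hs with rfl | hs
        · exact hgood
        · exact hx' s hs
      · refine ⟨x * c, (SU S).mul_mem hxV hcV, fun s hs => ?_⟩
        rcases Finset.mem_insert.mp hs with rfl | hs
        · by_cases hxs : x ∈ LS s
          · rw [Subgroup.mul_mem_cancel_left _ hxs]
            tauto
          · have := LS_mul_of_not (h2 s htF.1) (hxV s htF.1) (hcV s htF.1) hxs htc
            tauto
        · rw [Subgroup.mul_mem_cancel_right _ (hcT s hs)]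
          exact hx' s hs

theorem Quad.propD_aux [IsTotallyComplex K] {M : Type*} [Field M] [NumberField M] [Algebra K M]
    (r : Quad K M) (b : Kˣ) (hb : r.a = b) (S T' : Finset (Pr K)) (hS : Cl S)
    (h2 : ∀ v ∉ S, ord v (2 : K) = 0) (hbS : ∀ v ∈ S, b ∈ LS v)
    (hbT : ∀ v, Odd (ord v (b : K)) → v ∈ T') (hT' : ∀ t ∈ T', t ∉ S)
    (hT'x : ∀ A ⊆ T', ∃ x ∈ SU S, ∀ t ∈ T', x ∈ LS t ↔ t ∉ A) : False := by
  classical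
  let T := T'.filter (fun v => Odd (ord v (b : K)))
  have hTmem : ∀ v, v ∈ T ↔ Odd (ord v (b : K)) := fun v => by
    simp only [T, Finset.mem_filter]; exact ⟨fun h => h.2, fun h => ⟨hbT v h, h⟩⟩
  have hTT : T ⊆ T' := Finset.filter_subset _ _
  have hdis : Disjoint S T := by
    rw [Finset.disjoint_right]
    exact fun v hv => hT' v (hTT hv)
  have hA := r.lemmaA hS hdis (fun w hw1 hw2 => by
      apply r.ee_one_of_even
      · have h3 : (2 : M) = algebraMap K M 2 := (map_ofNat (algebraMap K M) 2).symm
        rw [h3, ord_alg, h2 _ hw1, mul_zero]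
      · rw [hb, ← Int.not_odd_iff_even, ← hTmem]; exact hw2)
    (fun w hw => r.ee_two_of_odd (by rw [hb, ← hTmem]; exact hw))
  have hns : S.filter (fun v => ¬ r.Split v) = ∅ := by
    rw [Finset.filter_eq_empty_iff]
    intro v hv h
    exact h (r.split_of_LS (hbS v hv) hb)
  rw [hns, Finset.card_empty, zero_add] at hA
  have hle : (SU (r.up S)).map r.nmU ≤ ⨅ t ∈ T, LS t := by
    rintro x ⟨y, hy, rfl⟩
    rw [mem_biInf]
    intro t ht
    obtain ⟨w, rfl⟩ := dn_surj (L := M) t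
    have htS : dn w ∉ S := hT' _ (hTT ht)
    have h3 := r.nm_LS (w := w) (h2 _ htS) (by rw [hb, ← hTmem]; exact ht) y.ne_zero
      (hy w (by rw [r.mem_up]; exact htS))
    have e : Units.mk0 _ (r.nm_ne y.ne_zero) = r.nmU y := Units.ext rfl
    rwa [e] at h3
  have h5 := relIndex_biInf (SU S) LS T (fun _ => 2)
        (fun t ht => LS_relIndex_two (hT' t (hTT ht)) (h2 t (hT' t (hTT ht))))
  have h6 := le_relIndex (SU S) LS T h5.2 (fun A hA => by
    obtain ⟨x, hx, hx'⟩ := hT'x A (hA.trans hTT)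
    exact ⟨x, hx, fun t ht => hx' t (hTT ht)⟩)
  have h7 := Subgroup.relIndex_le_of_le_left hle hA.1
  have h8 : 0 < 2 ^ T.card := by positivity
  omega

theorem propD [IsTotallyComplex K] [DecidableEq (Pr K)] (S0 T T' : Finset (Pr K)) (hd : Disjoint S0 T) (hS : Cl S0)
    (h2 : ∀ v ∉ S0, ord v (2 : K) = 0)
    (hT'c : T'.card = (S0 ∪ T).card + Units.rank K) (hT' : ∀ t ∈ T', t ∉ S0 ∪ T)
    (hT'x : ∀ A ⊆ T', ∃ x ∈ SU (S0 ∪ T), ∀ t ∈ T', x ∈ LS t ↔ t ∉ A)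
    (r1 r2 : Pr K) (hr : r1 ≠ r2) (h1S : r1 ∉ S0 ∪ T) (h2S : r2 ∉ S0 ∪ T)
    (h1T : r1 ∉ T') (h2T : r2 ∉ T') :
    ∃ b ∈ SU (S0 ∪ T' ∪ {r1, r2}), (∀ v ∈ S0 ∪ T, b ∈ LS v) ∧
      (Odd (ord r1 (b : K)) ∨ Odd (ord r2 (b : K))) := by
  classical
  set S1 := S0 ∪ T with hS1
  set S := S0 ∪ T' ∪ {r1, r2} with hSdef
  have hS1c : S1.card = S0.card + T.card := Finset.card_union_of_disjoint hd
  have hScard : S.card = S0.card + T'.card + 2 := by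
    rw [hSdef, Finset.card_union_of_disjoint, Finset.card_union_of_disjoint, Finset.card_pair hr]
    · rw [Finset.disjoint_right]
      exact fun v hv h => hT' v hv (Finset.mem_union_left _ h)
    · rw [Finset.disjoint_right]
      intro v hv h
      rcases Finset.mem_union.mp h with h | h <;>
      rcases Finset.mem_insert.mp hv with rfl | hv
      · exact h1S (Finset.mem_union_left _ h)
      · rw [Finset.mem_singleton] at hv; subst hv; exact h2S (Finset.mem_union_left _ h)
      · exact h1T h
      · rw [Finset.mem_singleton] at hv; subst hv; exact h2T h
  have hTS : ∀ v ∈ T, v ∉ S := by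
    intro v hv h
    simp only [hSdef, Finset.mem_union, Finset.mem_insert, Finset.mem_singleton] at h
    rcases h with (h | h) | h | h
    · exact Finset.disjoint_left.mp hd h hv
    · exact hT' v h (Finset.mem_union_right _ hv)
    · subst h; exact h1S (Finset.mem_union_right _ hv)
    · subst h; exact h2S (Finset.mem_union_right _ hv)
  have hTS0 : ∀ v ∈ T, v ∉ S0 := fun v hv h => Finset.disjoint_left.mp hd h hv
  -- index bound
  have hI := relIndex_biInf (SU S) LS S1
    (fun v => if v ∈ S0 then 4 * Ideal.absNorm v.asIdeal ^ e2 v else 2) (fun v hv => by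
      by_cases hv0 : v ∈ S0
      · simp only [if_pos hv0]
        have h3 := LS_index v
        have h4 := Subgroup.relIndex_le_of_le_right (H := LS v) (K := SU S) (L := ⊤) le_top
          (by rw [Subgroup.relIndex_top_right]; exact h3.2)
        rw [Subgroup.relIndex_top_right] at h4
        refine ⟨h4.trans h3.1, fun h0 => h3.2 ?_⟩
        rw [← Subgroup.relIndex_top_right]
        exact Subgroup.relIndex_eq_zero_of_le_right le_top h0
      · simp only [if_neg hv0]
        have hvT : v ∈ T := (Finset.mem_union.mp hv).resolve_left hv0
        exact LS_relIndex_two (hTS v hvT) (h2 v hv0))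
  have hprod : ∏ v ∈ S1, (if v ∈ S0 then 4 * Ideal.absNorm v.asIdeal ^ e2 v else 2) ≤
      2 ^ (2 * S0.card + T.card + 2 * (Units.rank K + 1)) := by
    rw [hS1, Finset.prod_union hd, Finset.prod_congr rfl (fun v hv => if_pos hv),
      Finset.prod_congr (s₁ := T) rfl (fun v hv => if_neg (hTS0 v hv)), Finset.prod_const,
      Finset.prod_mul_distrib, Finset.prod_const]
    have h3 := prod_e2_le S0
    rw [finrank_c, ← rank_succ] at h3
    calc 4 ^ S0.card * (∏ v ∈ S0, Ideal.absNorm v.asIdeal ^ e2 v) * 2 ^ T.card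
        ≤ 4 ^ S0.card * 2 ^ (2 * (Units.rank K + 1)) * 2 ^ T.card := by gcongr
      _ = _ := by rw [show (4 : ℕ) = 2 ^ 2 by norm_num, ← pow_mul]; ring
  have hsp := sq_index_split S S1
  -- the element b
  obtain ⟨b, hbS, hbLS, hbsq⟩ : ∃ b ∈ SU S, (∀ v ∈ S1, b ∈ LS v) ∧ ¬ IsSquare (b : K) := by
    by_contra hcon
    push Not at hcon
    have h3 : ((SU S).map (powMonoidHom 2)).relIndex (SU S ⊓ ⨅ t ∈ S1, LS t) = 1 := by
      rw [Subgroup.relIndex_eq_one]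
      intro x hx
      exact isSq_mem hx.1 (hcon x hx.1 ((mem_biInf _ _ _).mp hx.2))
    rw [h3, one_mul] at hsp
    have h4 := hI.1.trans hprod
    rw [hsp] at h4
    have h7 := (Nat.pow_le_pow_iff_right (by norm_num : 1 < 2)).mp h4
    omega
  refine ⟨b, hbS, hbLS, ?_⟩
  by_contra hcon
  rw [not_or] at hcon
  obtain ⟨M, _, _, _, r, hr'⟩ := exists_quad (b : K) hbsq
  refine r.propD_aux b hr' S1 T' (hS.mono Finset.subset_union_left)
    (fun v hv => h2 v (fun h => hv (Finset.mem_union_left _ h))) hbLS ?_ hT' hT'x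
  intro v hv
  by_contra hvT'
  have hvS : v ∈ S := by
    by_contra hvS
    rw [hbS v hvS] at hv
    simp at hv
  simp only [hSdef, Finset.mem_union, Finset.mem_insert, Finset.mem_singleton] at hvS
  rcases hvS with (h | h) | h | h
  · have := ord_even_of_LS (hbLS v (Finset.mem_union_left _ h))
    rw [← Int.not_odd_iff_even] at this; exact this hv
  · exact hvT' h
  · subst h; exact hcon.1 hv
  · subst h; exact hcon.2 hv

end TP
end Pourchet


set_option linter.unusedSectionVars false
set_option linter.unusedVariables false
set_option linter.style.haveILetI false

namespace Pourchet
open Module NumberField IsDedekindDomain nonZeroDivisors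
open Quad

section Grp2
variable {G : Type*} [CommGroup G] {ι : Type*}

/-- all sign patterns on `U` are realized by elements of `V` -/
def Pat (V : Subgroup G) (D : ι → Subgroup G) (U : Finset ι) : Prop :=
  ∀ A ⊆ U, ∃ x ∈ V, ∀ t ∈ U, x ∈ D t ↔ t ∉ A

theorem pat_insert [DecidableEq ι] {V : Subgroup G} {D : ι → Subgroup G} {U : Finset ι} {j : ι}
    (hm : ∀ x ∈ V, ∀ y ∈ V, x ∉ D j → y ∉ D j → x * y ∈ D j)
    (hU : Pat V D U) (hx : ∃ x ∈ V, x ∉ D j ∧ ∀ t ∈ U, t ≠ j → x ∈ D t) :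
    Pat V D (insert j U) := by
  by_cases hj : j ∈ U
  · rwa [Finset.insert_eq_of_mem hj]
  intro A hA
  obtain ⟨x, hxV, hxj, hxU⟩ := hx
  obtain ⟨y, hyV, hy⟩ := hU (A ∩ U) Finset.inter_subset_right
  have hy' : ∀ t ∈ U, y ∈ D t ↔ t ∉ A := fun t ht => by
    rw [hy t ht]; simp [ht]
  by_cases hc : y ∈ D j ↔ j ∉ A
  · refine ⟨y, hyV, fun t ht => ?_⟩
    rcases Finset.mem_insert.mp ht with rfl | ht
    · exact hc
    · exact hy' t ht
  · refine ⟨y * x, V.mul_mem hyV hxV, fun t ht => ?_⟩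
    rcases Finset.mem_insert.mp ht with rfl | ht'
    · by_cases hyj : y ∈ D t
      · rw [Subgroup.mul_mem_cancel_left _ hyj]
        tauto
      · have := hm y hyV x hxV hyj hxj
        tauto
    · rw [Subgroup.mul_mem_cancel_right _ (hxU t ht' (by rintro rfl; exact hj ht'))]
      exact hy' t ht'

theorem pat_union [DecidableEq ι] {V : Subgroup G} {D : ι → Subgroup G} {U : Finset ι}
    (hU : Pat V D U) (R : Finset ι)
    (hm : ∀ j ∈ R, ∀ x ∈ V, ∀ y ∈ V, x ∉ D j → y ∉ D j → x * y ∈ D j)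
    (hx : ∀ j ∈ R, ∃ x ∈ V, x ∉ D j ∧ ∀ t ∈ U ∪ R, t ≠ j → x ∈ D t) :
    Pat V D (U ∪ R) := by
  induction R using Finset.induction_on with
  | empty => simpa using hU
  | insert r R hr ih =>
    rw [Finset.union_insert]
    apply pat_insert (hm r (Finset.mem_insert_self _ _))
    · apply ih (fun j hj => hm j (Finset.mem_insert_of_mem hj))
      intro j hj
      obtain ⟨x, h1, h2, h3⟩ := hx j (Finset.mem_insert_of_mem hj)
      exact ⟨x, h1, h2, fun t ht => h3 t (by
        rw [Finset.union_insert]; exact Finset.mem_insert_of_mem ht)⟩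
    · obtain ⟨x, h1, h2, h3⟩ := hx r (Finset.mem_insert_self _ _)
      exact ⟨x, h1, h2, fun t ht => h3 t (by
        rw [Finset.union_insert]; exact Finset.mem_insert_of_mem ht)⟩

theorem pat_empty (V : Subgroup G) (D : ι → Subgroup G) : Pat V D ∅ := fun A _ =>
  ⟨1, V.one_mem, by simp⟩

/-- the counting argument -/
theorem count_arg {V N : Subgroup G} {D : ι → Subgroup G} {J : Finset ι} (hp : Pat V D J)
    (hN0 : N.relIndex V ≠ 0) (hN : N.relIndex V ≤ 2 ^ J.card) (hNV : N ≤ V)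
    (hND : ∀ j ∈ J, N ≤ D j) {x : G} (hx : x ∈ V) (hxD : ∀ j ∈ J, x ∈ D j) : x ∈ N := by
  set E := ⨅ t ∈ J, D t with hE
  have hNE : N ≤ E := le_iInf₂ hND
  have hE0 : E.relIndex V ≠ 0 := by
    intro h0
    have := Subgroup.relIndex_dvd_of_le_left V hNE
    rw [h0] at this
    exact hN0 (Nat.eq_zero_of_zero_dvd this)
  have h1 := le_relIndex V D J hE0 hp
  have h2 : N.relIndex (E ⊓ V) * (E ⊓ V).relIndex V = N.relIndex V :=
    Subgroup.relIndex_mul_relIndex _ _ _ (le_inf hNE hNV) inf_le_right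
  rw [Subgroup.inf_relIndex_right] at h2
  have h3 : N.relIndex (E ⊓ V) = 1 := by
    have ha : N.relIndex (E ⊓ V) ≠ 0 := by
      intro h; rw [h, zero_mul] at h2; exact hN0 h2.symm
    by_contra hb
    have hc : 2 ≤ N.relIndex (E ⊓ V) := by omega
    have hd : 0 < 2 ^ J.card := by positivity
    rw [← hE] at h1
    nlinarith
  rw [Subgroup.relIndex_eq_one] at h3
  exact h3 ⟨by rw [hE]; exact (mem_biInf D J x).mpr hxD, hx⟩

end Grp2

section Loc
variable {K : Type*} [Field K] [NumberField K]

theorem res_two_ne {t : Pr K} (h2 : ord t (2 : K) = 0) : (2 : 𝓞 K) ∉ t.asIdeal := by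
  intro h
  have := (ord_pos_iff t (2 : 𝓞 K) (coe_ne_zero' two_ne_zero)).mpr h
  rw [show ((2 : 𝓞 K) : K) = 2 from map_ofNat (algebraMap (𝓞 K) K) 2] at this
  omega

theorem ord_of_not_mem {t : Pr K} {x : 𝓞 K} (h : x ∉ t.asIdeal) : ord t (x : K) = 0 := by
  have hx : x ≠ 0 := by rintro rfl; exact h (zero_mem _)
  have h1 := ord_nonneg t x
  have h2 := mt (ord_pos_iff t x (coe_ne_zero' hx)).mp h
  omega

theorem val_lt_one_mem {t : Pr K} (x : 𝓞 K) : t.valuation K (x : K) < 1 ↔ x ∈ t.asIdeal := by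
  rw [← HeightOneSpectrum.valuation_lt_one_iff_mem (K := K)]

theorem exists_nonres {t : Pr K} (h2 : ord t (2 : K) = 0) :
    ∃ u : 𝓞 K, ∀ x : 𝓞 K, x - u ∈ t.asIdeal → x ∉ t.asIdeal ∧
      ∀ y : Kˣ, (y : K) = x → y ∉ LS t := by
  have hmax : t.asIdeal.IsMaximal := t.isMaximal
  letI : Field (𝓞 K ⧸ t.asIdeal) := Ideal.Quotient.field _
  haveI : Finite (𝓞 K ⧸ t.asIdeal) := by
    have := finite_quot_pow t 1
    rwa [pow_one] at this
  have hch : ringChar (𝓞 K ⧸ t.asIdeal) ≠ 2 := by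
    intro h
    have h' : ((2 : ℕ) : 𝓞 K ⧸ t.asIdeal) = 0 := by
      rw [← h]; exact ringChar.Nat.cast_ringChar
    apply res_two_ne h2
    rw [← Ideal.Quotient.eq_zero_iff_mem]
    rw [map_ofNat]
    exact_mod_cast h'
  obtain ⟨a, ha⟩ := FiniteField.exists_nonsquare hch
  obtain ⟨u, rfl⟩ := Ideal.Quotient.mk_surjective a
  refine ⟨u, fun x hx => ?_⟩
  have hxu : Ideal.Quotient.mk t.asIdeal x = Ideal.Quotient.mk t.asIdeal u :=
    Ideal.Quotient.eq.mpr hx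
  have hx0 : x ∉ t.asIdeal := by
    intro h
    rw [← Ideal.Quotient.eq_zero_iff_mem, hxu] at h
    exact ha (h ▸ IsSquare.zero)
  refine ⟨hx0, fun y hy hyL => ha ?_⟩
  obtain ⟨z, hz⟩ := mem_LS.mp hyL
  have h4 : t.valuation K 4 ≤ 1 := by
    have := HeightOneSpectrum.valuation_le_one (K := K) t (4 : 𝓞 K)
    exact (congrArg (t.valuation K) (map_ofNat (algebraMap (𝓞 K) K) 4)).symm.le.trans this
  have hvx : t.valuation K (x : K) = 1 := by
    rw [val_eq_one_iff t (by rw [← hy]; exact y.ne_zero)]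
    exact ord_of_not_mem hx0
  have hvz : t.valuation K (z : K) = 1 := by
    have h1 : t.valuation K ((y : K) * z ^ 2) = t.valuation K 1 := by
      apply Valuation.map_eq_of_sub_lt
      rw [map_one]
      exact lt_of_lt_of_le hz h4
    rw [map_one, map_mul, hy, hvx, one_mul, map_pow] at h1
    exact (pow_eq_one_iff.mp h1).resolve_right two_ne_zero
  obtain ⟨r, hr⟩ := approx t hvz.le
  have hr1 : t.valuation K ((r : K) - z) < 1 := lt_of_lt_of_le hr h4
  have key : x * r ^ 2 - 1 ∈ t.asIdeal := by
    rw [← val_lt_one_mem]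
    have e : ((x * r ^ 2 - 1 : 𝓞 K) : K) = ((y : K) * z ^ 2 - 1) + (x : K) * ((r - z) * (r + z)) := by
      rw [hy]; push_cast; ring
    rw [e]
    apply Valuation.map_add_lt
    · exact lt_of_lt_of_le hz h4
    · rw [map_mul, hvx, one_mul, map_mul]
      have h5 : t.valuation K ((r : K) + z) ≤ 1 :=
        (Valuation.map_add _ _ _).trans (max_le (HeightOneSpectrum.valuation_le_one t r) hvz.le)
      calc _ ≤ t.valuation K ((r : K) - z) * 1 := by gcongr
        _ < 1 := by rwa [mul_one]
  have key2 : Ideal.Quotient.mk t.asIdeal u * (Ideal.Quotient.mk t.asIdeal r) ^ 2 = 1 := by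
    rw [← hxu, ← map_pow, ← map_mul, ← map_one (Ideal.Quotient.mk t.asIdeal)]
    exact Ideal.Quotient.eq.mpr key
  have hr0 : Ideal.Quotient.mk t.asIdeal r ≠ 0 := by
    intro h; rw [h] at key2; simp at key2
  refine ⟨(Ideal.Quotient.mk t.asIdeal r)⁻¹, ?_⟩
  field_simp
  exact key2

theorem exists_xbeta [DecidableEq (Pr K)] (S0 T : Finset (Pr K)) (hd : Disjoint S0 T)
    (h2 : ∀ v ∈ T, ord v (2 : K) = 0) (β : Pr K) (hβ : β ∈ S0 ∪ T) :
    ∃ x : Kˣ, (∀ t ∈ T, ord t (x : K) = 0) ∧ (β ∈ T → x ∉ LS β) ∧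
      (β ∉ T → Odd (ord β (x : K))) ∧ ∀ v ∈ S0 ∪ T, v ≠ β → x ∈ LS v := by
  have hclose : ∀ (v : Pr K) (x : 𝓞 K) (y : Kˣ), (y : K) = x →
      x - 1 ∈ v.asIdeal ^ (2 * e2 v + 1) → y ∈ LS v := by
    intro v x y hy hx
    apply close_mem_LS
    rw [hy]
    exact (val_lt_four_iff v (x - 1)).mpr hx
  have hone : ∀ (v : Pr K) (x : 𝓞 K), x - 1 ∈ v.asIdeal ^ (2 * e2 v + 1) → x ∉ v.asIdeal := by
    intro v x hx hxv
    have h1 : x - 1 ∈ v.asIdeal := Ideal.pow_le_self (by omega) hx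
    have : (1 : 𝓞 K) ∈ v.asIdeal := by
      have := v.asIdeal.sub_mem hxv h1
      simpa using this
    exact v.isPrime.ne_top ((Ideal.eq_top_iff_one _).mpr this)
  by_cases hT : β ∈ T
  · obtain ⟨u, hu⟩ := exists_nonres (h2 β hT)
    obtain ⟨x, hx⟩ := crt (S0 ∪ T) (fun v => if v = β then u else 1)
      (fun v => if v = β then 1 else 2 * e2 v + 1)
    have hxβ : x - u ∈ β.asIdeal := by simpa using hx β hβ
    have hxv : ∀ v ∈ S0 ∪ T, v ≠ β → x - 1 ∈ v.asIdeal ^ (2 * e2 v + 1) := fun v hv hne => by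
      simpa [hne] using hx v hv
    have hx0 : x ≠ 0 := by
      rintro rfl; exact (hu 0 hxβ).1 (zero_mem _)
    refine ⟨Units.mk0 (x : K) (coe_ne_zero' hx0), fun t ht => ?_, fun _ => ?_,
      fun h => absurd hT h, fun v hv hne => ?_⟩
    · by_cases htb : t = β
      · subst htb; exact ord_of_not_mem (hu x hxβ).1
      · exact ord_of_not_mem (hone t x (hxv t (Finset.mem_union_right _ ht) htb))
    · exact (hu x hxβ).2 _ rfl
    · exact hclose v x _ rfl (hxv v hv hne)
  · obtain ⟨π, hπ0, hπ⟩ := exists_uniformizer β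
    obtain ⟨x, hx⟩ := crt (S0 ∪ T) (fun v => if v = β then π else 1)
      (fun v => if v = β then 2 else 2 * e2 v + 1)
    have hxβ : x - π ∈ β.asIdeal ^ 2 := by simpa using hx β hβ
    have hxv : ∀ v ∈ S0 ∪ T, v ≠ β → x - 1 ∈ v.asIdeal ^ (2 * e2 v + 1) := fun v hv hne => by
      simpa [hne] using hx v hv
    have hπ2 : π ∉ β.asIdeal ^ 2 := by
      rw [← ord_ge_iff β π hπ0 2, hπ]; norm_num
    have hπ1 : π ∈ β.asIdeal := by
      rw [← ord_pos_iff β π hπ0, hπ]; norm_num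
    have hx2 : x ∉ β.asIdeal ^ 2 := by
      intro h
      apply hπ2
      have := Ideal.sub_mem _ h hxβ
      simpa using this
    have hx1 : x ∈ β.asIdeal := by
      have := β.asIdeal.add_mem (Ideal.pow_le_self two_ne_zero hxβ) hπ1
      simpa using this
    have hx0 : x ≠ 0 := by
      rintro rfl; exact hx2 (zero_mem _)
    have ho : ord β (x : K) = 1 := by
      have a1 := (ord_pos_iff β x (coe_ne_zero' hx0)).mpr hx1
      have a2 := mt (ord_ge_iff β x (coe_ne_zero' hx0) 2).mp hx2
      push_cast at a2
      omega
    refine ⟨Units.mk0 (x : K) (coe_ne_zero' hx0), fun t ht => ?_, fun h => absurd h hT,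
      fun _ => ?_, fun v hv hne => ?_⟩
    · exact ord_of_not_mem (hone t x (hxv t (Finset.mem_union_right _ ht)
        (by rintro rfl; exact hT ht)))
    · rw [Units.val_mk0, ho]; exact odd_one
    · exact hclose v x _ rfl (hxv v hv hne)

end Loc
end Pourchet


set_option linter.unusedSectionVars false
set_option linter.unusedVariables false
set_option linter.style.haveILetI false

namespace Pourchet
open Module NumberField IsDedekindDomain nonZeroDivisors
open Quad

section Hasse
universe u
variable {K L : Type u} [Field K] [NumberField K] [Field L] [NumberField L] [Algebra K L]
  (q : Quad K L)

theorem coprime23 (v : Pr K) (h : ord v (3 : K) ≠ 0) : ord v (2 : K) = 0 := by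
  by_contra h2
  have e3 : ((3 : 𝓞 K) : K) = 3 := map_ofNat (algebraMap (𝓞 K) K) 3
  have e2 : ((2 : 𝓞 K) : K) = 2 := map_ofNat (algebraMap (𝓞 K) K) 2
  have m3 : (3 : 𝓞 K) ∈ v.asIdeal := by
    by_contra hc
    exact h (e3 ▸ ord_of_not_mem hc)
  have m2 : (2 : 𝓞 K) ∈ v.asIdeal := by
    by_contra hc
    exact h2 (e2 ▸ ord_of_not_mem hc)
  have : (1 : 𝓞 K) ∈ v.asIdeal := by
    have := v.asIdeal.sub_mem m3 m2
    norm_num at this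
    exact this
  exact v.isPrime.ne_top ((Ideal.eq_top_iff_one _).mpr this)

theorem Quad.ee_one_three (ha : q.a = -3) (w : Pr L) (h : Even (ord (dn w : Pr K) (3 : K))) :
    ee K w = 1 := by
  have e2 : ord w (2 : L) = ee K w * ord (dn w : Pr K) (2 : K) := by
    rw [← ord_alg, map_ofNat]
  by_cases h2 : ord (dn w : Pr K) (2 : K) = 0
  · apply q.ee_one_of_even
    · rw [e2, h2, mul_zero]
    · rw [ha, ord_neg]; exact h
  · have h3 : ord (dn w : Pr K) (3 : K) = 0 := by
      by_contra hc; exact h2 (coprime23 _ hc)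
    have hδ : q.δ ^ 2 = -3 := by rw [q.hδ, ha, map_neg, map_ofNat]
    have hδv : w.valuation L q.δ = 1 := by
      have h4 : w.valuation L (q.δ ^ 2) = 1 := by
        rw [q.hδ, val_eq_one_iff w (by simpa using q.ha), ord_alg, ha, ord_neg, h3, mul_zero]
      rw [map_pow] at h4
      exact (pow_eq_one_iff.mp h4).resolve_right two_ne_zero
    set α : L := (-1 + q.δ) / 2 with hα
    have hα2 : α ^ 2 = -(α + 1) := by
      rw [hα]; field_simp; linear_combination hδ
    apply q.ee_one_of α
    · by_contra hc
      push Not at hc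
      have h5 : w.valuation L α ^ 2 ≤ w.valuation L α := by
        rw [← map_pow, hα2, Valuation.map_neg]
        exact (Valuation.map_add _ _ _).trans (max_le le_rfl (by rw [map_one]; exact hc.le))
      have h6 : w.valuation L α ^ 2 > w.valuation L α := by
        rw [pow_two]
        exact lt_mul_of_one_lt_left (zero_lt_one.trans hc) hc
      exact absurd h5 (not_le.mpr h6)
    · have : α - q.σ α = q.δ := by
        have e : q.σ α = (-1 - q.δ) / 2 := by
          rw [hα, map_div₀, map_add, map_neg, map_one, q.hσ, map_ofNat]; ring
        rw [e, hα]; ring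
      rw [this, hδv]

theorem ord_prod_finset (B : Finset (Pr K)) (x : Pr K → Kˣ) :
    ∃ F : Finset (Pr K), (∀ β ∈ B, ∀ v, ord v (x β : K) ≠ 0 → v ∈ F) ∧
      ∀ v ∈ F, ∃ β ∈ B, ord v (x β : K) ≠ 0 := by
  classical
  choose F hF using fun β => ord_finset (x β : K) (x β).ne_zero
  refine ⟨B.biUnion fun β => (F β).filter fun v => ord v (x β : K) ≠ 0, ?_, ?_⟩
  · intro β hβ v hv
    refine Finset.mem_biUnion.mpr ⟨β, hβ, Finset.mem_filter.mpr ⟨?_, hv⟩⟩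
    by_contra hc
    exact hv (hF β v hc)
  · intro v hv
    obtain ⟨β, hβ, h⟩ := Finset.mem_biUnion.mp hv
    exact ⟨β, hβ, (Finset.mem_filter.mp h).2⟩

/-- Setup of all the places. -/
theorem Quad.setup [IsTotallyComplex K] [DecidableEq (Pr K)] (ha : q.a = -3) :
    ∃ (T S0 S : Finset (Pr K)) (r0 : Pr K),
      (∀ v, v ∈ T ↔ Odd (ord v (3 : K))) ∧ Disjoint S T ∧ S0 ⊆ S ∧ Cl S ∧
      (∀ v, ord v (2 : K) ≠ 0 → v ∈ S0) ∧ r0 ∈ S ∧ r0 ∉ S0 ∧ ¬ q.Split r0 ∧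
      (∀ β ∈ S0 ∪ T, ∃ x ∈ SU S, (β ∈ T → x ∉ LS β) ∧
        (β ∉ T → Odd (ord β (x : K))) ∧ ∀ v ∈ S0 ∪ T, v ≠ β → x ∈ LS v) ∧
      (∀ r ∈ S, ∀ s ∈ S, r ∉ S0 → s ∉ S0 → ¬ q.Split r → ¬ q.Split s → r ≠ s →
        ∃ b ∈ SU S, (∀ v ∈ S0 ∪ T, b ∈ LS v) ∧ (Odd (ord r (b : K)) ∨ Odd (ord s (b : K))) ∧
          ∀ v, v ∉ S0 → ¬ q.Split v → v ≠ r → v ≠ s → ord v (b : K) = 0) := by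
  obtain ⟨F2, hF2⟩ := ord_finset (2 : K) two_ne_zero
  obtain ⟨F3, hF3⟩ := ord_finset (3 : K) three_ne_zero
  set T := F3.filter (fun v => Odd (ord v (3 : K))) with hTdef
  have hT : ∀ v, v ∈ T ↔ Odd (ord v (3 : K)) := by
    intro v
    rw [hTdef, Finset.mem_filter]
    refine ⟨fun h => h.2, fun h => ⟨?_, h⟩⟩
    by_contra hc
    rw [hF3 v hc] at h
    exact absurd h (by decide)
  have hT2 : ∀ v ∈ T, ord v (2 : K) = 0 := by
    intro v hv
    apply coprime23
    intro h0
    have := (hT v).mp hv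
    rw [h0] at this
    exact absurd this (by decide)
  obtain ⟨S0, hS0A, hS0T, hCl⟩ := exists_Cl ((F2.filter fun v => ord v (2 : K) ≠ 0) ∪ (F3 \ T)) T
    (by
      rw [Finset.disjoint_union_left]
      refine ⟨?_, Finset.sdiff_disjoint⟩
      rw [Finset.disjoint_left]
      intro v hv hvT
      exact (Finset.mem_filter.mp hv).2 (hT2 v hvT))
  have h2S0 : ∀ v, ord v (2 : K) ≠ 0 → v ∈ S0 := by
    intro v hv
    apply hS0A
    apply Finset.mem_union_left
    refine Finset.mem_filter.mpr ⟨?_, hv⟩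
    by_contra hc; exact hv (hF2 v hc)
  have h3S1 : ∀ v ∉ S0 ∪ T, ord v q.a = 0 := by
    intro v hv
    rw [ha, ord_neg]
    by_contra hc
    apply hv
    by_cases hvT : v ∈ T
    · exact Finset.mem_union_right _ hvT
    · apply Finset.mem_union_left
      apply hS0A
      apply Finset.mem_union_right
      refine Finset.mem_sdiff.mpr ⟨?_, hvT⟩
      by_contra h; exact hc (hF3 v h)
  obtain ⟨T', hT'c, hT'S, hT'x⟩ := q.exists_T' (S0 ∪ T)
    (fun v hv => by by_contra hc; exact hv (Finset.mem_union_left _ (h2S0 v hc))) h3S1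
    ((S0 ∪ T).card + Units.rank K) le_rfl
  obtain ⟨r0, hr0, hr0s⟩ := q.exists_not_split (S0 ∪ T)
  have hx := exists_xbeta S0 T hS0T hT2
  choose! x hx1 hx2 hx3 hx4 using hx
  obtain ⟨F, hF, hF'⟩ := ord_prod_finset (S0 ∪ T) x
  have hsub : S0 ⊆ S0 ∪ T' ∪ {r0} ∪ F := fun v hv => by simp [hv]
  have hTns : ∀ v ∈ T, ¬ q.Split v := by
    intro v hv hs
    obtain ⟨w, hw⟩ := dn_surj (L := L) v
    refine hs w hw (q.cj_of_ee_two (q.ee_two_of_odd ?_))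
    rw [hw, ha, ord_neg]; exact (hT v).mp hv
  refine ⟨T, S0, S0 ∪ T' ∪ {r0} ∪ F, r0, hT, ?_, hsub, hCl.mono hsub, h2S0, by simp,
    fun h => hr0 (Finset.mem_union_left _ h), hr0s, ?_, ?_⟩
  · rw [Finset.disjoint_left]
    intro v hv hvT
    simp only [Finset.mem_union, Finset.mem_singleton] at hv
    rcases hv with ((hv | hv) | hv) | hv
    · exact Finset.disjoint_left.mp hS0T hv hvT
    · exact (hT'S v hv).1 (Finset.mem_union_right _ hvT)
    · exact hr0 (hv ▸ Finset.mem_union_right _ hvT)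
    · obtain ⟨β, hβ, hne⟩ := hF' v hv
      exact hne (hx1 β hβ v hvT)
  · intro β hβ
    refine ⟨x β, ?_, hx2 β hβ, hx3 β hβ, hx4 β hβ⟩
    rw [mem_SU]
    intro v hv
    by_contra hc
    exact hv (Finset.mem_union_right _ (hF β hβ v hc))
  · intro r hr s hs hr0' hs0' hrs hss hne
    have hd : ∀ v ∈ S0 ∪ T' ∪ {r0} ∪ F, v ∉ T := by
      intro v hv hvT
      simp only [Finset.mem_union, Finset.mem_singleton] at hv
      rcases hv with ((hv | hv) | hv) | hv
      · exact Finset.disjoint_left.mp hS0T hv hvT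
      · exact (hT'S v hv).1 (Finset.mem_union_right _ hvT)
      · exact hr0 (hv ▸ Finset.mem_union_right _ hvT)
      · obtain ⟨β, hβ, hne⟩ := hF' v hv
        exact hne (hx1 β hβ v hvT)
    obtain ⟨b, hb, hbL, hbo⟩ := propD S0 T T' hS0T hCl
      (fun v hv => by by_contra hc; exact hv (h2S0 v hc)) hT'c (fun t ht => (hT'S t ht).1) hT'x
      r s hne (by simp [hr0', hd r hr]) (by simp [hs0', hd s hs])
      (fun h => hrs (hT'S r h).2) (fun h => hss (hT'S s h).2)
    rw [mem_SU] at hb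
    refine ⟨b, ?_, hbL, hbo, ?_⟩
    · rw [mem_SU]
      intro v hv
      apply hb
      intro hc
      apply hv
      simp only [Finset.mem_union, Finset.mem_insert, Finset.mem_singleton] at hc
      rcases hc with (hc | hc) | hc | hc
      · simp [hc]
      · simp [hc]
      · exact hc ▸ hr
      · exact hc ▸ hs
    · intro v hv hvs h1 h2
      apply hb
      simp only [Finset.mem_union, Finset.mem_insert, Finset.mem_singleton]
      rintro ((hc | hc) | hc | hc)
      · exact hv hc
      · exact hvs (hT'S v hc).2
      · exact h1 hc
      · exact h2 hc

open Classical in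
/-- The Hasse norm principle argument for `-2` and `K(√-3)/K`. -/
theorem Quad.neg_two_norm [IsTotallyComplex K] (ha : q.a = -3)
    (h2e : ∀ v : Pr K, ord v (2 : K) ≠ 0 → ¬ q.Split v → Even (ord v (2 : K))) :
    ∃ c d : K, c ^ 2 + 3 * d ^ 2 = -2 := by
  obtain ⟨T, S0, S, r0, hT, hST, hS0S, hCl, h2S0, hr0S, hr0S0, hr0s, hxβ, hpD⟩ := q.setup ha
  have hT0 : ∀ v ∈ S, v ∉ T := fun v hv => Finset.disjoint_left.mp hST hv
  have hT2 : ∀ v ∈ T, ord v (2 : K) = 0 := by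
    intro v hv
    by_contra hc
    exact hT0 v (hS0S (h2S0 v hc)) hv
  have ha' : ∀ v : Pr K, ord v q.a = ord v (3 : K) := fun v => by rw [ha, ord_neg]
  have hur : ∀ w : Pr L, (dn w : Pr K) ∉ T → ee K w = 1 := by
    intro w hw
    apply q.ee_one_three ha
    rw [hT, Int.not_odd_iff_even] at hw
    exact hw
  have hram : ∀ w : Pr L, (dn w : Pr K) ∈ T → ee K w = 2 := by
    intro w hw
    apply q.ee_two_of_odd
    rw [ha', ← hT]; exact hw
  obtain ⟨hA0, hA⟩ := q.lemmaA hCl hST (fun w _ hw => hur w hw) hram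
  set N := Subgroup.map q.nmU (SU (q.up S)) with hN
  let D : Pr K → Subgroup Kˣ := fun v => if v ∈ T then LS v else Ev v
  have hDT : ∀ v ∈ T, D v = LS v := fun v hv => if_pos hv
  have hDS : ∀ v, v ∉ T → D v = Ev v := fun v hv => if_neg hv
  have hLSD : ∀ v, LS v ≤ D v := by
    intro v
    by_cases hv : v ∈ T
    · rw [hDT v hv]
    · rw [hDS v hv]; exact LS_le_Ev v
  have hmul : ∀ j, ∀ x ∈ SU S, ∀ y ∈ SU S, x ∉ D j → y ∉ D j → x * y ∈ D j := by
    intro j x hx y hy hxj hyj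
    by_cases hj : j ∈ T
    · rw [hDT j hj] at *
      have hjS : j ∉ S := fun h => hT0 j h hj
      exact LS_mul_of_not (hT2 j hj) (mem_SU.mp hx j hjS) (mem_SU.mp hy j hjS) hxj hyj
    · rw [hDS j hj, mem_Ev] at *
      rw [Int.not_even_iff_odd] at hxj hyj
      rw [Units.val_mul, ord_mul j x.ne_zero y.ne_zero]
      exact hxj.add_odd hyj
  set B := T ∪ S0.filter (fun v => ¬ q.Split v) with hB
  set R := (S \ S0).filter (fun v => ¬ q.Split v) with hR
  have hRm : ∀ r, r ∈ R ↔ (r ∈ S ∧ r ∉ S0) ∧ ¬ q.Split r := by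
    intro r; simp [hR]
  have hBm : ∀ r, r ∈ B → r ∈ S0 ∪ T := by
    intro r hr; simp only [hB, Finset.mem_union, Finset.mem_filter] at hr ⊢; tauto
  have hr0R : r0 ∈ R := (hRm r0).mpr ⟨⟨hr0S, hr0S0⟩, hr0s⟩
  have hRT : ∀ r ∈ R, r ∉ T := fun r hr => hT0 r ((hRm r).mp hr).1.1
  have hBR : Disjoint B R := by
    rw [Finset.disjoint_left]
    intro v hv hvR
    rcases Finset.mem_union.mp (hBm v hv) with h | h
    · exact ((hRm v).mp hvR).1.2 h
    · exact hRT v hvR h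
  let er : Pr K → Prop := fun r => ∃ x ∈ SU S, x ∉ D r ∧ ∀ j ∈ B ∪ R, j ≠ r → x ∈ D j
  have hpd : ∀ r ∈ R, ∀ s ∈ R, r ≠ s → er s ∨
      ∃ x ∈ SU S, x ∉ D r ∧ ∀ j ∈ B ∪ R, j ≠ r → j ≠ s → x ∈ D j := by
    intro r hr s hs hne
    have hr' := (hRm r).mp hr
    have hs' := (hRm s).mp hs
    obtain ⟨b, hbS, hbL, hbo, hb0⟩ := hpD r hr'.1.1 s hs'.1.1 hr'.1.2 hs'.1.2 hr'.2 hs'.2 hne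
    have hD : ∀ j ∈ B ∪ R, j ≠ r → j ≠ s → b ∈ D j := by
      intro j hj h1 h2
      rcases Finset.mem_union.mp hj with hj | hj
      · exact hLSD j (hbL j (hBm j hj))
      · rw [hDS j (hRT j hj), mem_Ev,
          hb0 j ((hRm j).mp hj).1.2 ((hRm j).mp hj).2 h1 h2]
        exact Even.zero
    by_cases hbr : b ∈ D r
    · left
      have hbs : b ∉ D s := by
        rw [hDS s (hRT s hs), mem_Ev, Int.not_even_iff_odd]
        rw [hDS r (hRT r hr), mem_Ev, ← Int.not_odd_iff_even] at hbr
        tauto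
      refine ⟨b, hbS, hbs, fun j hj hjs => ?_⟩
      by_cases hjr : j = r
      · exact hjr ▸ hbr
      · exact hD j hj hjr hjs
    · exact Or.inr ⟨b, hbS, hbr, hD⟩
  obtain ⟨r1, hr1R, hr1⟩ : ∃ r1 ∈ R, ∀ r ∈ R, r ≠ r1 →
      ∃ x ∈ SU S, x ∉ D r ∧ ∀ j ∈ B ∪ R, j ≠ r → j ≠ r1 → x ∈ D j := by
    by_cases h : ∃ r1 ∈ R, ¬ er r1
    · obtain ⟨r1, h1, h2⟩ := h
      exact ⟨r1, h1, fun r hr hne => (hpd r hr r1 h1 hne).resolve_left h2⟩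
    · push Not at h
      refine ⟨r0, hr0R, fun r hr hne => ?_⟩
      obtain ⟨x, hx, hxr, hxj⟩ := h r hr
      exact ⟨x, hx, hxr, fun j hj h1 _ => hxj j hj h1⟩
  have hpB : Pat (SU S) D B := by
    have := pat_union (pat_empty (SU S) D) B (fun j _ => hmul j) ?_
    · rwa [Finset.empty_union] at this
    intro β hβ
    obtain ⟨x, hxS, h1, h2, h3⟩ := hxβ β (hBm β hβ)
    refine ⟨x, hxS, ?_, fun t ht hne => hLSD t (h3 t (hBm t (by simpa using ht)) hne)⟩
    by_cases hβT : β ∈ T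
    · rw [hDT β hβT]; exact h1 hβT
    · rw [hDS β hβT, mem_Ev, Int.not_even_iff_odd]; exact h2 hβT
  have hpJ : Pat (SU S) D (B ∪ R.erase r1) := by
    apply pat_union hpB _ (fun j _ => hmul j)
    intro j hj
    obtain ⟨x, hxS, hxj, hx⟩ := hr1 j (Finset.mem_of_mem_erase hj) (Finset.ne_of_mem_erase hj)
    refine ⟨x, hxS, hxj, fun t ht hne => hx t ?_ hne ?_⟩
    · exact Finset.union_subset_union_right (Finset.erase_subset _ _) ht
    · rintro rfl
      rcases Finset.mem_union.mp ht with h | h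
      · exact Finset.disjoint_left.mp hBR h hr1R
      · exact Finset.ne_of_mem_erase h rfl
  have hcard : ((S.filter fun v => ¬ q.Split v).card + T.card) = (B ∪ R.erase r1).card + 1 := by
    have c1 : (B ∪ R.erase r1).card = B.card + (R.erase r1).card :=
      Finset.card_union_of_disjoint (hBR.mono_right (Finset.erase_subset _ _))
    have c2 : (R.erase r1).card + 1 = R.card := Finset.card_erase_add_one hr1R
    have c3 : B.card = T.card + (S0.filter fun v => ¬ q.Split v).card := by
      apply Finset.card_union_of_disjoint
      rw [Finset.disjoint_left]
      intro v hv hv'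
      exact hT0 v (hS0S (Finset.mem_filter.mp hv').1) hv
    have c4 : (S.filter fun v => ¬ q.Split v).card =
        (S0.filter fun v => ¬ q.Split v).card + R.card := by
      rw [← Finset.card_union_of_disjoint]
      · congr 1
        rw [hR, ← Finset.filter_union, Finset.union_sdiff_of_subset hS0S]
      · rw [Finset.disjoint_left]
        intro v hv hv'
        exact ((hRm v).mp hv').1.2 (Finset.mem_filter.mp hv).1
    omega
  have hNle : N.relIndex (SU S) ≤ 2 ^ (B ∪ R.erase r1).card := by
    rw [hcard, pow_succ] at hA
    omega
  have hNV : N ≤ SU S := by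
    rintro _ ⟨y, hy, rfl⟩
    exact q.nmU_mem hy
  have hnsJ : ∀ j ∈ B ∪ R.erase r1, j ∉ T → ¬ q.Split j := by
    intro j hj hjT
    simp only [hB, hR, Finset.mem_union, Finset.mem_filter, Finset.mem_erase] at hj
    tauto
  have hND : ∀ j ∈ B ∪ R.erase r1, N ≤ D j := by
    rintro j hj _ ⟨y, hy, rfl⟩
    by_cases hjT : j ∈ T
    · rw [hDT j hjT]
      obtain ⟨w, rfl⟩ := dn_surj (L := L) j
      have hw : ord w (y : L) = 0 := by
        apply mem_SU.mp hy
        rw [q.mem_up]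
        exact fun h => hT0 _ h hjT
      have h1 : Units.mk0 _ (q.nm_ne y.ne_zero) ∈ LS (dn w : Pr K) :=
        q.nm_LS (hT2 _ hjT) (by rw [ha', ← hT]; exact hjT) y.ne_zero hw
      have h2 : q.nmU y = Units.mk0 _ (q.nm_ne y.ne_zero) := by
        ext; rw [q.nmU_val]; rfl
      rw [h2]; exact h1
    · rw [hDS j hjT, mem_Ev, q.nmU_val]
      apply q.even_ord_nm (hnsJ j hj hjT) _ y.ne_zero
      intro w hw
      apply hur; rw [hw]; exact hjT
  have hm2 : (-2 : K) ≠ 0 := by norm_num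
  have hmem : Units.mk0 (-2 : K) hm2 ∈ N := by
    apply count_arg hpJ hA0 hNle hNV hND
    · rw [mem_SU]
      intro v hv
      rw [Units.val_mk0, ord_neg]
      by_contra hc
      exact hv (hS0S (h2S0 v hc))
    · intro j hj
      by_cases hjT : j ∈ T
      · rw [hDT j hjT]
        apply close_mem_LS
        rw [Units.val_mk0, show (-2 - 1 : K) = -3 by norm_num, Valuation.map_neg]
        have h4 : j.valuation K (4 : K) = 1 := by
          rw [val_four]
          have := e2_cast j
          rw [hT2 j hjT] at this
          rw [show e2 j = 0 by omega]; simp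
        rw [h4, val_lt_one_iff j (by norm_num : (3 : K) ≠ 0)]
        have e3 : ((3 : 𝓞 K) : K) = 3 := map_ofNat (algebraMap (𝓞 K) K) 3
        have h5 := ord_nonneg j (3 : 𝓞 K)
        rw [e3] at h5
        have h6 := (hT j).mp hjT
        rcases h5.lt_or_eq with h | h
        · exact h
        · rw [← h] at h6; exact absurd h6 (by decide)
      · rw [hDS j hjT, mem_Ev, Units.val_mk0, ord_neg]
        by_cases h0 : ord j (2 : K) = 0
        · rw [h0]; exact Even.zero
        · exact h2e j h0 (hnsJ j hj hjT)
  obtain ⟨y, -, hy⟩ := hmem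
  obtain ⟨c, d, hcd⟩ := q.span (y : L)
  refine ⟨c, d, ?_⟩
  have h7 : q.nm (y : L) = -2 := by
    rw [← q.nmU_val, hy, Units.val_mk0]
  rw [hcd, q.nm_eq, ha] at h7
  linear_combination h7

end Hasse
end Pourchet


set_option linter.unusedSectionVars false
set_option linter.unusedVariables false
set_option linter.style.haveILetI false

namespace Pourchet
open Module NumberField IsDedekindDomain nonZeroDivisors
open Quad

section Emb
variable {K : Type*} [Field K] [NumberField K]
  {Ω : Type*} [NormedField Ω] [IsUltrametricDist Ω] [Algebra ℚ Ω]

theorem norm_int_le (φ : K →ₐ[ℚ] Ω) (r : 𝓞 K) : ‖φ (r : K)‖ ≤ 1 := by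
  have h1 : IsIntegral ℤ (φ (r : K)) :=
    (RingOfIntegers.isIntegral_coe r).map (φ.toRingHom.toIntAlgHom)
  have h2 : IsIntegral (NormedField.valuation (K := Ω)).integer (φ (r : K)) := h1.tower_top
  have h3 := (Valuation.integer.integers (NormedField.valuation (K := Ω))).mem_of_integral h2
  exact h3

/-- the prime of `K` induced by an embedding -/
def Vp (h2 : ‖(2 : Ω)‖ < 1) (φ : K →ₐ[ℚ] Ω) : Pr K where
  asIdeal :=
    { carrier := {r | ‖φ (r : K)‖ < 1}
      add_mem' := by
        intro a b ha hb
        change ‖φ ((a + b : 𝓞 K) : K)‖ < 1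
        rw [show ((a + b : 𝓞 K) : K) = a + b from map_add _ _ _, map_add]
        exact (IsUltrametricDist.norm_add_le_max _ _).trans_lt (max_lt ha hb)
      zero_mem' := by
        change ‖φ ((0 : 𝓞 K) : K)‖ < 1
        rw [show ((0 : 𝓞 K) : K) = 0 from map_zero _, map_zero, norm_zero]
        exact zero_lt_one
      smul_mem' := by
        intro c a ha
        change ‖φ ((c * a : 𝓞 K) : K)‖ < 1
        rw [show ((c * a : 𝓞 K) : K) = c * a from map_mul _ _ _, map_mul, norm_mul]
        calc _ ≤ 1 * ‖φ (a : K)‖ := by gcongr; exact norm_int_le φ c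
          _ < 1 := by rw [one_mul]; exact ha }
  isPrime := by
    refine ⟨?_, ?_⟩
    · rw [Ne, Ideal.eq_top_iff_one]
      intro h
      have h' : ‖φ ((1 : 𝓞 K) : K)‖ < 1 := h
      rw [show ((1 : 𝓞 K) : K) = 1 from map_one _, map_one, norm_one] at h'
      exact lt_irrefl _ h'
    · intro a b hab
      by_contra! hc
      have ha : ‖φ (a : K)‖ = 1 := le_antisymm (norm_int_le φ a) (not_lt.mp hc.1)
      have hb : ‖φ (b : K)‖ = 1 := le_antisymm (norm_int_le φ b) (not_lt.mp hc.2)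
      have h' : ‖φ ((a * b : 𝓞 K) : K)‖ < 1 := hab
      rw [show ((a * b : 𝓞 K) : K) = a * b from map_mul _ _ _, map_mul, norm_mul, ha, hb,
        one_mul] at h'
      exact lt_irrefl _ h'
  ne_bot := by
    intro h
    have h3 : (2 : 𝓞 K) ∈ (⊥ : Ideal (𝓞 K)) := by
      rw [← h]
      change ‖φ ((2 : 𝓞 K) : K)‖ < 1
      rw [show ((2 : 𝓞 K) : K) = 2 from map_ofNat (algebraMap (𝓞 K) K) 2, map_ofNat]
      exact h2
    exact two_ne_zero ((Submodule.mem_bot _).mp h3)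

theorem mem_Vp (h2 : ‖(2 : Ω)‖ < 1) (φ : K →ₐ[ℚ] Ω) (r : 𝓞 K) :
    r ∈ (Vp h2 φ).asIdeal ↔ ‖φ (r : K)‖ < 1 := Iff.rfl

theorem two_mem_Vp (h2 : ‖(2 : Ω)‖ < 1) (φ : K →ₐ[ℚ] Ω) : (2 : 𝓞 K) ∈ (Vp h2 φ).asIdeal := by
  rw [mem_Vp, show ((2 : 𝓞 K) : K) = 2 from map_ofNat (algebraMap (𝓞 K) K) 2, map_ofNat]
  exact h2

theorem norm_eq_one_of (h2 : ‖(2 : Ω)‖ < 1) (φ : K →ₐ[ℚ] Ω) (r : 𝓞 K)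
    (h : r ∉ (Vp h2 φ).asIdeal) : ‖φ (r : K)‖ = 1 :=
  le_antisymm (norm_int_le φ r) (not_lt.mp h)

theorem norm_pow_e (h2 : ‖(2 : Ω)‖ < 1) (φ : K →ₐ[ℚ] Ω) (α : 𝓞 K)
    (hα : α ∈ (Vp h2 φ).asIdeal) (hα2 : α ∉ (Vp h2 φ).asIdeal ^ 2) :
    ‖φ (α : K)‖ ^ e2 (Vp h2 φ) = ‖(2 : Ω)‖ := by
  set v := Vp h2 φ with hv
  set e := e2 v with he
  have e2c : ((2 : 𝓞 K) : K) = 2 := map_ofNat (algebraMap (𝓞 K) K) 2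
  have h20 : ((2 : 𝓞 K) : K) ≠ 0 := by rw [e2c]; exact two_ne_zero
  have hα0 : (α : K) ≠ 0 := by
    apply coe_ne_zero'; rintro rfl; exact hα2 (zero_mem _)
  have hoα : ord v (α : K) = 1 := by
    have a1 := (ord_pos_iff v α hα0).mpr hα
    have a2 := mt (ord_ge_iff v α hα0 2).mp hα2
    push_cast at a2
    omega
  have ho2 : ord v ((2 : 𝓞 K) : K) = e := by rw [e2c, he, e2_cast]
  have hd : v.asIdeal ^ e ∣ Ideal.span {(2 : 𝓞 K)} := by
    rw [Ideal.dvd_span_singleton, ← ord_ge_iff v _ h20, ho2]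
  obtain ⟨J, hJ⟩ := hd
  have hJv : ¬ J ≤ v.asIdeal := by
    intro h
    have h1 : (2 : 𝓞 K) ∈ v.asIdeal ^ (e + 1) := by
      have : (2 : 𝓞 K) ∈ v.asIdeal ^ e * J := by
        rw [← hJ]; exact Ideal.mem_span_singleton_self _
      rw [pow_succ]
      exact Ideal.mul_mono_right h this
    rw [← ord_ge_iff v _ h20, ho2] at h1
    push_cast at h1
    omega
  obtain ⟨b, hbJ, hbv⟩ := Set.not_subset.mp hJv
  have hb : b * α ^ e ∈ Ideal.span {(2 : 𝓞 K)} := by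
    rw [hJ, mul_comm b]
    exact Ideal.mul_mem_mul (Ideal.pow_mem_pow hα e) hbJ
  obtain ⟨a, ha⟩ := Ideal.mem_span_singleton'.mp hb
  have hb0 : (b : K) ≠ 0 := by
    apply coe_ne_zero'; rintro rfl; exact hbv (zero_mem _)
  have haK : (a : K) * (2 : K) = b * (α : K) ^ e := by
    have := congrArg (algebraMap (𝓞 K) K) ha
    rw [map_mul, map_mul, map_pow, map_ofNat] at this
    exact this
  have ha0 : (a : K) ≠ 0 := by
    intro h
    rw [h, zero_mul] at haK
    exact mul_ne_zero hb0 (pow_ne_zero _ hα0) haK.symm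
  have hav : a ∉ v.asIdeal := by
    intro h
    have h1 := (ord_pos_iff v a ha0).mpr h
    have h3 := congrArg (ord v) haK
    rw [ord_mul v ha0 two_ne_zero, ord_mul v hb0 (pow_ne_zero _ hα0), ord_pow, hoα,
      ord_of_not_mem hbv, ← e2c, ho2] at h3
    simp at h3
    omega
  have h3 := congrArg (fun x => ‖φ x‖) haK
  simp only [map_mul, map_pow, norm_mul, norm_pow, map_ofNat] at h3
  rw [norm_eq_one_of h2 φ a hav, norm_eq_one_of h2 φ b hbv, one_mul, one_mul] at h3
  exact h3.symm

end Emb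

section AbsN
variable {K : Type*} [Field K] [NumberField K]

theorem odd_absNorm (I : Ideal (𝓞 K)) (hI : I ≠ ⊥)
    (h : ∀ P : Ideal (𝓞 K), P.IsMaximal → I ≤ P → (2 : 𝓞 K) ∉ P) : Odd (Ideal.absNorm I) := by
  rw [← Nat.not_even_iff_odd]
  intro he
  have hfin : Finite (𝓞 K ⧸ I) := Ideal.finiteQuotientOfFreeOfNeBot I hI
  have hc : Ideal.absNorm I = Nat.card (𝓞 K ⧸ I) := by
    rw [Ideal.absNorm_apply]; rfl
  rw [hc] at he
  obtain ⟨x, hx⟩ := exists_prime_addOrderOf_dvd_card' (G := 𝓞 K ⧸ I) 2 he.two_dvd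
  have hx0 : x ≠ 0 := by
    rintro rfl; simp at hx
  have hx2 : (2 : 𝓞 K ⧸ I) * x = 0 := by
    have := addOrderOf_nsmul_eq_zero x
    rw [hx] at this
    rw [two_mul, ← two_nsmul]; exact this
  obtain ⟨y, rfl⟩ := Ideal.Quotient.mk_surjective x
  have hne : Ideal.span {(2 : 𝓞 K)} ⊔ I ≠ ⊤ := by
    intro ht
    have h1 : (1 : 𝓞 K) ∈ Ideal.span {(2 : 𝓞 K)} ⊔ I := by rw [ht]; trivial
    obtain ⟨a, ha, b, hb, hab⟩ := Submodule.mem_sup.mp h1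
    obtain ⟨c, rfl⟩ := Ideal.mem_span_singleton'.mp ha
    apply hx0
    have h3 : Ideal.Quotient.mk I b = 0 := Ideal.Quotient.eq_zero_iff_mem.mpr hb
    have h4 := congrArg (Ideal.Quotient.mk I) hab
    rw [map_add, map_mul, h3, add_zero, map_one, map_ofNat] at h4
    calc Ideal.Quotient.mk I y = (Ideal.Quotient.mk I c * 2) * Ideal.Quotient.mk I y := by
          rw [h4, one_mul]
      _ = Ideal.Quotient.mk I c * (2 * Ideal.Quotient.mk I y) := by ring
      _ = 0 := by rw [hx2, mul_zero]
  obtain ⟨P, hP, hle⟩ := Ideal.exists_le_maximal _ hne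
  exact h P hP (le_sup_right.trans hle)
    (hle (Ideal.mem_sup_left (Ideal.mem_span_singleton_self _)))

theorem card_res (v : Pr K) (h2 : (2 : 𝓞 K) ∈ v.asIdeal) :
    ∃ k : ℕ, Ideal.absNorm v.asIdeal = 2 ^ k := by
  have hmax : v.asIdeal.IsMaximal := v.isMaximal
  letI : Field (𝓞 K ⧸ v.asIdeal) := Ideal.Quotient.field _
  haveI : Finite (𝓞 K ⧸ v.asIdeal) := Ideal.finiteQuotientOfFreeOfNeBot _ v.ne_bot
  letI := Fintype.ofFinite (𝓞 K ⧸ v.asIdeal)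
  haveI : CharP (𝓞 K ⧸ v.asIdeal) 2 := by
    apply CharTwo.of_one_ne_zero_of_two_eq_zero one_ne_zero
    rw [← map_ofNat (Ideal.Quotient.mk v.asIdeal) 2]
    exact Ideal.Quotient.eq_zero_iff_mem.mpr h2
  obtain ⟨n, -, hn⟩ := FiniteField.card (𝓞 K ⧸ v.asIdeal) 2
  refine ⟨n, ?_⟩
  rw [← hn, Ideal.absNorm_apply, ← Nat.card_eq_fintype_card]
  rfl

theorem exists_alpha (v : Pr K) (h2 : (2 : 𝓞 K) ∈ v.asIdeal) :
    ∃ (α : 𝓞 K) (m : ℕ), α ∈ v.asIdeal ∧ α ∉ v.asIdeal ^ 2 ∧ Odd m ∧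
      (∀ v' : Pr K, (2 : 𝓞 K) ∈ v'.asIdeal → v' ≠ v → α ∉ v'.asIdeal) ∧
      (Algebra.norm ℤ α).natAbs = Ideal.absNorm v.asIdeal * m := by
  classical
  have e2c : ((2 : 𝓞 K) : K) = 2 := map_ofNat (algebraMap (𝓞 K) K) 2
  have h20 : ((2 : 𝓞 K) : K) ≠ 0 := by rw [e2c]; exact two_ne_zero
  obtain ⟨F, hF⟩ := ord_finset (2 : K) two_ne_zero
  have hFm : ∀ w : Pr K, (2 : 𝓞 K) ∈ w.asIdeal → w ∈ F := by
    intro w hw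
    by_contra hc
    have h1 := (ord_pos_iff w _ h20).mpr hw
    rw [e2c, hF w hc] at h1
    exact lt_irrefl _ h1
  obtain ⟨π, hπ0, hπ⟩ := exists_uniformizer v
  have hπ2 : π ∉ v.asIdeal ^ 2 := by
    rw [← ord_ge_iff v π hπ0 2, hπ]; norm_num
  have hπ1 : π ∈ v.asIdeal := by
    rw [← ord_pos_iff v π hπ0, hπ]; norm_num
  obtain ⟨α, hα⟩ := crt F (fun w => if w = v then π else 1) (fun w => if w = v then 2 else 1)
  have hαv : α - π ∈ v.asIdeal ^ 2 := by simpa using hα v (hFm v h2)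
  have hα1 : α ∈ v.asIdeal := by
    have := v.asIdeal.add_mem (Ideal.pow_le_self two_ne_zero hαv) hπ1
    simpa using this
  have hα2 : α ∉ v.asIdeal ^ 2 := by
    intro h
    apply hπ2
    have := Ideal.sub_mem _ h hαv
    simpa using this
  have hαo : ∀ v' : Pr K, (2 : 𝓞 K) ∈ v'.asIdeal → v' ≠ v → α ∉ v'.asIdeal := by
    intro w hw hne h
    have h1 : α - 1 ∈ w.asIdeal := by simpa [hne] using hα w (hFm w hw)
    have : (1 : 𝓞 K) ∈ w.asIdeal := by
      have := w.asIdeal.sub_mem h h1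
      simpa using this
    exact w.isPrime.ne_top ((Ideal.eq_top_iff_one _).mpr this)
  obtain ⟨I, hI⟩ := Ideal.dvd_span_singleton.mpr hα1
  have hα0 : α ≠ 0 := by rintro rfl; exact hα2 (zero_mem _)
  have hαI : α ∈ v.asIdeal * I := by rw [← hI]; exact Ideal.mem_span_singleton_self _
  have hI0 : I ≠ ⊥ := by
    rintro rfl
    rw [Ideal.mul_bot, Ideal.span_singleton_eq_bot] at hI
    exact hα0 hI
  refine ⟨α, Ideal.absNorm I, hα1, hα2, ?_, hαo, ?_⟩
  · apply odd_absNorm I hI0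
    intro P hP hle h2P
    by_cases hPv : P = v.asIdeal
    · apply hα2
      rw [pow_two]
      exact Ideal.mul_mono_right (hle.trans hPv.le) hαI
    · have hPb : P ≠ ⊥ := by
        rintro rfl
        exact two_ne_zero ((Submodule.mem_bot _).mp h2P)
      let w : Pr K := ⟨P, hP.isPrime, hPb⟩
      have hαP : α ∈ P := by
        have hle' : v.asIdeal * I ≤ I := Ideal.mul_le_right
        exact hle (hle' hαI)
      have hne : w ≠ v := fun h => hPv (congrArg HeightOneSpectrum.asIdeal h)
      exact hαo w h2P hne hαP
  · rw [← Ideal.absNorm_span_singleton, hI, map_mul]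

end AbsN
end Pourchet


set_option linter.unusedSectionVars false
set_option linter.unusedVariables false
set_option linter.style.haveILetI false

namespace Pourchet
open Module NumberField IsDedekindDomain nonZeroDivisors
open Quad Polynomial

section Two
variable {K : Type*} [Field K] [NumberField K]

theorem normΩ_rat (x : ℚ) : ‖algebraMap ℚ (PadicAlgCl 2) x‖ = ‖(x : ℚ_[2])‖ := by
  rw [IsScalarTower.algebraMap_apply ℚ ℚ_[2] (PadicAlgCl 2), PadicAlgCl.norm_extends]
  rfl

theorem normΩ_two : ‖(2 : PadicAlgCl 2)‖ = 2⁻¹ := by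
  have := normΩ_rat 2
  rw [map_ofNat] at this
  rw [this]
  have h := Padic.norm_p (p := 2)
  exact_mod_cast h

theorem normΩ_two_lt : ‖(2 : PadicAlgCl 2)‖ < 1 := by rw [normΩ_two]; norm_num

theorem norm_odd (m : ℕ) (h : Odd m) : ‖(m : ℚ_[2])‖ = 1 := by
  rw [Padic.norm_natCast_eq_one_iff]
  exact (Nat.coprime_two_left).mpr h

theorem Vp_eq_of_minpoly (pb : PowerBasis ℚ K) (φ ψ : K →ₐ[ℚ] PadicAlgCl 2)
    (h : minpoly ℚ_[2] (φ pb.gen) = minpoly ℚ_[2] (ψ pb.gen)) :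
    Vp normΩ_two_lt φ = Vp normΩ_two_lt ψ := by
  obtain ⟨τ, hτ⟩ := (isConjRoot_iff_exists_algEquiv (K := ℚ_[2])).mp h
  have e : φ = (τ.toAlgHom.restrictScalars ℚ).comp ψ := by
    apply pb.algHom_ext
    exact hτ.symm
  apply HeightOneSpectrum.ext
  ext r
  rw [mem_Vp, mem_Vp, e]
  have : ‖ψ (r : K)‖ = ‖τ (ψ (r : K))‖ := spectralNorm_eq_of_equiv τ _
  rw [this]
  rfl

theorem fiber_card (pb : PowerBasis ℚ K) (φ : K →ₐ[ℚ] PadicAlgCl 2) :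
    Nat.card {ψ : K →ₐ[ℚ] PadicAlgCl 2 // minpoly ℚ_[2] (ψ pb.gen) = minpoly ℚ_[2] (φ pb.gen)} =
      (minpoly ℚ_[2] (φ pb.gen)).natDegree := by
  set g := minpoly ℚ_[2] (φ pb.gen) with hg
  have hinteg : IsIntegral ℚ_[2] (φ pb.gen) := Algebra.IsIntegral.isIntegral _
  have hirr : Irreducible g := minpoly.irreducible hinteg
  have hmon : g.Monic := minpoly.monic hinteg
  have hdvd : g ∣ (minpoly ℚ pb.gen).map (algebraMap ℚ ℚ_[2]) := by
    apply minpoly.dvd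
    rw [aeval_map_algebraMap, aeval_algHom_apply, minpoly.aeval, map_zero]
  rw [← card_rootSet_eq_natDegree (K := PadicAlgCl 2) hirr.separable (IsAlgClosed.splits _),
    ← Nat.card_eq_fintype_card]
  have hmem : ∀ y, y ∈ g.rootSet (PadicAlgCl 2) ↔ minpoly ℚ_[2] y = g := by
    intro y
    rw [mem_rootSet]
    constructor
    · rintro ⟨-, hy⟩
      exact (minpoly.eq_of_irreducible_of_monic hirr hy hmon).symm
    · intro h
      exact ⟨hirr.ne_zero, by rw [← h]; exact minpoly.aeval _ _⟩
  apply Nat.card_congr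
  refine Equiv.ofBijective (fun ψ => ⟨ψ.1 pb.gen, (hmem _).mpr ψ.2⟩) ⟨?_, ?_⟩
  · intro ψ ψ' h
    apply Subtype.ext
    apply pb.algHom_ext
    exact congrArg Subtype.val h
  · rintro ⟨y, hy⟩
    have hy0 : aeval y (minpoly ℚ pb.gen) = 0 := by
      obtain ⟨c, hc⟩ := hdvd
      have h1 : aeval y ((minpoly ℚ pb.gen).map (algebraMap ℚ ℚ_[2])) = 0 := by
        rw [hc, map_mul, (mem_rootSet.mp hy).2, zero_mul]
      rwa [aeval_map_algebraMap] at h1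
    refine ⟨⟨pb.lift y hy0, ?_⟩, ?_⟩
    · rw [pb.lift_gen]; exact (hmem y).mp hy
    · apply Subtype.ext
      exact pb.lift_gen y hy0

theorem even_count (pb : PowerBasis ℚ K)
    (hp : ∀ g : ℚ_[2][X], g.Monic → Irreducible g →
      g ∣ (minpoly ℚ pb.gen).map (algebraMap ℚ ℚ_[2]) → Even g.natDegree)
    (P : (K →ₐ[ℚ] PadicAlgCl 2) → Prop) [DecidablePred P]
    (hP : ∀ φ ψ : K →ₐ[ℚ] PadicAlgCl 2,
      minpoly ℚ_[2] (φ pb.gen) = minpoly ℚ_[2] (ψ pb.gen) → P φ → P ψ) :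
    Even (Finset.univ.filter P).card := by
  classical
  rw [Finset.card_eq_sum_card_image (fun φ => minpoly ℚ_[2] (φ pb.gen))]
  apply Finset.even_sum
  intro g hg
  obtain ⟨φ, hφ, rfl⟩ := Finset.mem_image.mp hg
  have hφP := (Finset.mem_filter.mp hφ).2
  have hinteg : IsIntegral ℚ_[2] (φ pb.gen) := Algebra.IsIntegral.isIntegral _
  have : ((Finset.univ.filter P).filter fun ψ =>
      minpoly ℚ_[2] (ψ pb.gen) = minpoly ℚ_[2] (φ pb.gen)).card =
      (minpoly ℚ_[2] (φ pb.gen)).natDegree := by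
    rw [← fiber_card pb φ, Nat.card_eq_fintype_card, Fintype.card_subtype]
    congr 1
    ext ψ
    simp only [Finset.mem_filter, Finset.mem_univ, true_and]
    exact ⟨fun h => h.2, fun h => ⟨hP φ ψ h.symm hφP, h⟩⟩
  rw [this]
  apply hp _ (minpoly.monic hinteg) (minpoly.irreducible hinteg)
  apply minpoly.dvd
  rw [aeval_map_algebraMap, aeval_algHom_apply, minpoly.aeval, map_zero]

theorem ef_even (pb : PowerBasis ℚ K)
    (hp : ∀ g : ℚ_[2][X], g.Monic → Irreducible g →
      g ∣ (minpoly ℚ pb.gen).map (algebraMap ℚ ℚ_[2]) → Even g.natDegree)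
    (v : Pr K) (h2 : (2 : 𝓞 K) ∈ v.asIdeal) :
    ∃ k : ℕ, Ideal.absNorm v.asIdeal = 2 ^ k ∧ Even (k * e2 v) := by
  classical
  obtain ⟨k, hk⟩ := card_res v h2
  refine ⟨k, hk, ?_⟩
  obtain ⟨α, m, hα1, hα2, hm, hαo, hN⟩ := exists_alpha v h2
  have hc := even_count pb hp (fun φ => Vp normΩ_two_lt φ = v) (fun φ ψ h h' => by
    rw [← Vp_eq_of_minpoly pb φ ψ h]; exact h')
  have h3 := congrArg norm (Algebra.norm_eq_prod_embeddings ℚ (PadicAlgCl 2) (α : K))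
  rw [normΩ_rat, norm_prod, ← Algebra.coe_norm_int] at h3
  have h4 : ‖(((Algebra.norm ℤ α : ℤ) : ℚ) : ℚ_[2])‖ = (2⁻¹ : ℝ) ^ k := by
    have h5 : ‖(((Algebra.norm ℤ α : ℤ) : ℚ) : ℚ_[2])‖ =
        ‖(((Algebra.norm ℤ α).natAbs : ℕ) : ℚ_[2])‖ := by
      rw [Rat.cast_intCast]
      rcases Int.natAbs_eq (Algebra.norm ℤ α) with h | h
      · conv_lhs => rw [h]
        rw [Int.cast_natCast]
      · conv_lhs => rw [h]
        rw [Int.cast_neg, norm_neg, Int.cast_natCast]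
    rw [h5, hN, hk]
    push_cast
    rw [norm_mul, norm_odd m hm, mul_one, norm_pow]
    congr 1
    have h := Padic.norm_p (p := 2)
    exact_mod_cast h
  rw [h4] at h3
  have h6 := congrArg (fun x => x ^ e2 v) h3
  rw [← Finset.prod_pow] at h6
  have h7 : ∀ φ : K →ₐ[ℚ] PadicAlgCl 2,
      ‖φ (α : K)‖ ^ e2 v = if Vp normΩ_two_lt φ = v then (2⁻¹ : ℝ) else 1 := by
    intro φ
    split_ifs with h
    · subst h
      rw [norm_pow_e normΩ_two_lt φ α hα1 hα2, normΩ_two]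
    · rw [norm_eq_one_of normΩ_two_lt φ α (hαo _ (two_mem_Vp _ φ) h), one_pow]
  rw [Finset.prod_congr rfl (fun φ _ => h7 φ), Finset.prod_ite, Finset.prod_const_one, mul_one,
    Finset.prod_const, ← pow_mul] at h6
  have h8 : k * e2 v = (Finset.univ.filter (fun φ => Vp normΩ_two_lt φ = v)).card :=
    pow_right_injective₀ (by norm_num) (by norm_num) h6
  rw [h8]; exact hc

end Two

section Spl
universe u
variable {K L : Type u} [Field K] [NumberField K] [Field L] [NumberField L] [Algebra K L]
  (q : Quad K L)

theorem exists_cube_root (v : Pr K) (k : ℕ) (hk : Ideal.absNorm v.asIdeal = 2 ^ k)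
    (he : Even k) : ∃ y : 𝓞 K, y ^ 2 + y + 1 ∈ v.asIdeal := by
  have hmax : v.asIdeal.IsMaximal := v.isMaximal
  letI : Field (𝓞 K ⧸ v.asIdeal) := Ideal.Quotient.field _
  haveI : Finite (𝓞 K ⧸ v.asIdeal) := Ideal.finiteQuotientOfFreeOfNeBot _ v.ne_bot
  letI := Fintype.ofFinite (𝓞 K ⧸ v.asIdeal)
  have hc : Nat.card (𝓞 K ⧸ v.asIdeal) = 2 ^ k := by
    rw [← hk, Ideal.absNorm_apply]; rfl
  have h3 : 3 ∣ Nat.card (𝓞 K ⧸ v.asIdeal)ˣ := by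
    rw [Nat.card_units, hc]
    obtain ⟨j, rfl⟩ := he
    rw [← two_mul, pow_mul]
    have := Nat.sub_dvd_pow_sub_pow 4 1 j
    simpa using this
  haveI : Fact (Nat.Prime 3) := ⟨Nat.prime_three⟩
  obtain ⟨ζ, hζ⟩ := exists_prime_orderOf_dvd_card' 3 h3
  have hζ1 : (ζ : 𝓞 K ⧸ v.asIdeal) ≠ 1 := by
    intro h
    have h1 : ζ = 1 := Units.ext h
    rw [h1, orderOf_one] at hζ
    norm_num at hζ
  have hζ3 : (ζ : 𝓞 K ⧸ v.asIdeal) ^ 3 = 1 := by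
    have := pow_orderOf_eq_one ζ
    rw [hζ] at this
    rw [← Units.val_pow_eq_pow_val, this, Units.val_one]
  obtain ⟨y, hy⟩ := Ideal.Quotient.mk_surjective (ζ : 𝓞 K ⧸ v.asIdeal)
  refine ⟨y, ?_⟩
  rw [← Ideal.Quotient.eq_zero_iff_mem, map_add, map_add, map_pow, hy, map_one]
  have h5 : ((ζ : 𝓞 K ⧸ v.asIdeal) - 1) * ((ζ : 𝓞 K ⧸ v.asIdeal) ^ 2 + ζ + 1) = 0 := by
    linear_combination hζ3
  exact (mul_eq_zero.mp h5).resolve_left (sub_ne_zero.mpr hζ1)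

theorem Quad.split_of_res (ha : q.a = -3) (v : Pr K) (h2 : (2 : 𝓞 K) ∈ v.asIdeal) (y : 𝓞 K)
    (hy : y ^ 2 + y + 1 ∈ v.asIdeal) : q.Split v := by
  rintro w rfl hcj
  have hδ : q.δ ^ 2 = -3 := by rw [q.hδ, ha, map_neg, map_ofNat]
  set yL : L := algebraMap K L (y : K) with hyL
  set x1 : L := yL - (-1 + q.δ) / 2 with hx1
  set x2 : L := yL - (-1 - q.δ) / 2 with hx2
  have hσ : q.σ x1 = x2 := by
    rw [hx1, hx2, map_sub, hyL, AlgEquiv.commutes, map_div₀, map_add, map_neg, map_one, q.hσ,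
      map_ofNat]
    ring
  have hdif : x2 + -x1 = q.δ := by rw [hx1, hx2]; ring
  have h10 : x1 ≠ 0 := by
    intro h
    rw [h, map_zero] at hσ
    rw [← hσ, h] at hdif
    exact q.δ_ne (by rw [← hdif]; ring)
  have h20 : x2 ≠ 0 := by
    rw [← hσ]; exact (_root_.map_ne_zero _).mpr h10
  have ho : ord w x1 = ord w x2 := by
    rw [← hσ, ← q.ord_cj, hcj]
  have hprod : x1 * x2 = ((algebraMap (𝓞 K) (𝓞 L) (y ^ 2 + y + 1) : 𝓞 L) : L) := by
    have : ((algebraMap (𝓞 K) (𝓞 L) (y ^ 2 + y + 1) : 𝓞 L) : L) = yL ^ 2 + yL + 1 := by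
      rw [coe_alg, hyL]
      simp only [map_add, map_pow, map_one]
    rw [this, hx1, hx2]
    linear_combination (-1 / 4 : L) * hδ
  have hpos : 0 < ord w (x1 * x2) := by
    rw [hprod, ord_pos_iff w _ (by rw [← hprod]; exact mul_ne_zero h10 h20)]
    exact (mem_dn w _).mp hy
  rw [ord_mul w h10 h20] at hpos
  have hδo : 1 ≤ ord w (x2 + -x1) :=
    ord_add_ge w h20 (neg_ne_zero.mpr h10) (by rw [hdif]; exact q.δ_ne) (by omega)
      (by rw [ord_neg]; omega)
  rw [hdif] at hδo
  have h3 : ord w (3 : L) ≠ 0 := by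
    have := congrArg (ord w) hδ
    rw [ord_neg, ord_pow] at this
    push_cast at this
    omega
  have h4 := coprime23 w h3
  have h5 : (2 : 𝓞 L) ∈ w.asIdeal := by
    have := (mem_dn w _).mp h2
    rwa [map_ofNat] at this
  exact res_two_ne h4 h5

theorem Quad.neg_two (ha : q.a = -3) [IsTotallyComplex K] (pb : PowerBasis ℚ K)
    (hp : ∀ g : ℚ_[2][X], g.Monic → Irreducible g →
      g ∣ (minpoly ℚ pb.gen).map (algebraMap ℚ ℚ_[2]) → Even g.natDegree) :
    ∃ c d : K, c ^ 2 + 3 * d ^ 2 = -2 := by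
  apply q.neg_two_norm ha
  intro v hv hns
  have h2 : (2 : 𝓞 K) ∈ v.asIdeal := by
    by_contra hc
    apply hv
    have := ord_of_not_mem hc
    rwa [show ((2 : 𝓞 K) : K) = 2 from map_ofNat (algebraMap (𝓞 K) K) 2] at this
  obtain ⟨k, hk, he⟩ := ef_even pb hp v h2
  rcases Nat.even_mul.mp he with h | h
  · obtain ⟨y, hy⟩ := exists_cube_root v k hk h
    exact absurd (q.split_of_res ha v h2 y hy) hns
  · rw [← e2_cast]
    exact_mod_cast h

end Spl

section Fin
variable {K : Type*} [Field K] [NumberField K]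

theorem neg_one_of_neg_two {c d : K} (h : c ^ 2 + 3 * d ^ 2 = -2) : ∃ u v : K, u ^ 2 + v ^ 2 = -1 := by
  by_cases h0 : (1 - d) ^ 2 + d ^ 2 = 0
  · have hd : d ≠ 0 := by
      rintro rfl
      norm_num at h0
    refine ⟨(1 - d) / d, 0, ?_⟩
    field_simp
    linear_combination h0
  · refine ⟨(c * (1 - d) + (d + 1) * d) / ((1 - d) ^ 2 + d ^ 2),
      (c * d - (d + 1) * (1 - d)) / ((1 - d) ^ 2 + d ^ 2), ?_⟩
    field_simp
    linear_combination ((1 - d) ^ 2 + d ^ 2) * h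

theorem exists_neg_one [IsTotallyComplex K] (pb : PowerBasis ℚ K)
    (hp : ∀ g : ℚ_[2][X], g.Monic → Irreducible g →
      g ∣ (minpoly ℚ pb.gen).map (algebraMap ℚ ℚ_[2]) → Even g.natDegree) :
    ∃ u v : K, u ^ 2 + v ^ 2 = -1 := by
  by_cases hs : IsSquare (-3 : K)
  · obtain ⟨s, hs⟩ := hs
    refine ⟨(-1 + s) / 2, ((-1 + s) / 2) ^ 2, ?_⟩
    have h0 : ((-1 + s) / 2) ^ 2 + (-1 + s) / 2 + 1 = 0 := by
      field_simp
      linear_combination -hs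
    set a := (-1 + s) / 2
    have h3 : a ^ 3 = 1 := by linear_combination (a - 1) * h0
    linear_combination h0 + a * h3
  · obtain ⟨L, _, _, _, q, hq⟩ := exists_quad (-3 : K) hs
    obtain ⟨c, d, h⟩ := q.neg_two hq pb hp
    exact neg_one_of_neg_two h

end Fin
end Pourchet


set_option linter.unusedSectionVars false
set_option linter.unusedVariables false
set_option linter.style.haveILetI false

namespace Pourchet
open Module NumberField IsDedekindDomain nonZeroDivisors
open Polynomial

theorem adjoin_neg_one (p : ℚ[X]) (hm : p.Monic) (hirr : Irreducible p)
    (hreal : ∀ t : ℝ, aeval t p ≠ 0)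
    (hp : ∀ g : ℚ_[2][X], g.Monic → Irreducible g →
      g ∣ p.map (algebraMap ℚ ℚ_[2]) → Even g.natDegree) :
    ∃ u v : ℚ[X] ⧸ Ideal.span {p}, u ^ 2 + v ^ 2 = -1 := by
  haveI : Fact (Irreducible p) := ⟨hirr⟩
  haveI : CharZero (AdjoinRoot p) := algebraRat.charZero _
  haveI : FiniteDimensional ℚ (AdjoinRoot p) := hm.finite_adjoinRoot
  haveI : NumberField (AdjoinRoot p) := { }
  haveI : IsTotallyComplex (AdjoinRoot p) := by
    refine ⟨fun w => ?_⟩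
    rw [← InfinitePlace.not_isReal_iff_isComplex]
    intro hw
    let φ : AdjoinRoot p →+* ℝ := InfinitePlace.embedding_of_isReal hw
    apply hreal (φ (AdjoinRoot.root p))
    have h1 : eval₂ (algebraMap ℚ (AdjoinRoot p)) (AdjoinRoot.root p) p = 0 :=
      AdjoinRoot.eval₂_root p
    have h2 := congrArg φ h1
    rw [hom_eval₂, map_zero] at h2
    rw [aeval_def, Subsingleton.elim (algebraMap ℚ ℝ) (φ.comp (algebraMap ℚ (AdjoinRoot p)))]
    exact h2
  have hmp : minpoly ℚ (AdjoinRoot.powerBasis hirr.ne_zero).gen = p :=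
    AdjoinRoot.minpoly_powerBasis_gen_of_monic hm
  exact exists_neg_one (K := AdjoinRoot p) (AdjoinRoot.powerBasis hirr.ne_zero) (by
    rw [hmp]; exact hp)

theorem no_real_root (f p h : ℚ[X]) (m : ℕ) (hmo : Odd m) (hirr : Irreducible p)
    (hfac : f = p ^ m * h) (hph : ¬ p ∣ h) (hpos : ∀ t : ℝ, 0 ≤ aeval t f) (t : ℝ) :
    aeval t p ≠ 0 := by
  intro ht
  have hcop : IsCoprime p h := (hirr.coprime_iff_not_dvd).mpr hph
  have hht : aeval t h ≠ 0 := by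
    intro h0
    obtain ⟨a, b, hab⟩ := hcop
    have := congrArg (aeval t) hab
    rw [map_add, map_mul, map_mul, ht, h0, mul_zero, mul_zero, add_zero, map_one] at this
    exact zero_ne_one this
  have hpr : eval t (p.map (algebraMap ℚ ℝ)) = 0 := by rw [eval_map_algebraMap]; exact ht
  obtain ⟨r, hr⟩ := dvd_iff_isRoot.mpr hpr
  have hsep : (p.map (algebraMap ℚ ℝ)).Separable := hirr.separable.map
  have hrt : eval t r ≠ 0 := by
    intro h0
    obtain ⟨s, hs⟩ := dvd_iff_isRoot.mpr (show IsRoot r t from h0)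
    have hd : (X - C t) * (X - C t) ∣ p.map (algebraMap ℚ ℝ) := ⟨s, by rw [hr, hs]; ring⟩
    exact not_isUnit_X_sub_C t (hsep.squarefree _ hd)
  set g : ℝ[X] := r ^ m * h.map (algebraMap ℚ ℝ) with hg
  have hgt : eval t g ≠ 0 := by
    rw [hg, eval_mul, eval_pow, eval_map_algebraMap]
    exact mul_ne_zero (pow_ne_zero _ hrt) hht
  have hfe : ∀ s : ℝ, 0 ≤ (s - t) ^ m * eval s g := by
    intro s
    have h1 := hpos s
    rw [← eval_map_algebraMap, hfac, Polynomial.map_mul, Polynomial.map_pow, hr] at h1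
    have e : ((X - C t) * r) ^ m * h.map (algebraMap ℚ ℝ) = (X - C t) ^ m * g := by
      rw [hg, mul_pow]; ring
    rw [e] at h1
    simpa using h1
  have hcont : ContinuousAt (fun s => eval s g) t := g.continuous.continuousAt
  rcases lt_or_gt_of_ne hgt with hlt | hgt
  · obtain ⟨ε, hε, hball⟩ := Metric.eventually_nhds_iff.mp (hcont.eventually_lt_const hlt)
    have h1 : eval (t + ε / 2) g < 0 := hball (by
      rw [Real.dist_eq, add_sub_cancel_left, abs_of_pos (by linarith)]; linarith)
    have h2 := hfe (t + ε / 2)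
    rw [add_sub_cancel_left] at h2
    have h3 : 0 < (ε / 2) ^ m := by positivity
    nlinarith
  · obtain ⟨ε, hε, hball⟩ := Metric.eventually_nhds_iff.mp (hcont.eventually_const_lt hgt)
    have h1 : 0 < eval (t - ε / 2) g := hball (by
      rw [Real.dist_eq, sub_sub_cancel_left, abs_neg, abs_of_pos (by linarith)]; linarith)
    have h2 := hfe (t - ε / 2)
    rw [sub_sub_cancel_left, hmo.neg_pow] at h2
    have h3 : 0 < (ε / 2) ^ m := by positivity
    nlinarith

theorem three_imp_two (f : ℚ[X]) (hf : f ≠ 0) (hpos : ∀ t : ℝ, 0 ≤ aeval t f)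
    (h2 : ∀ p : ℚ_[2][X], p.Monic → Irreducible p →
            (∃ m : ℕ, Odd m ∧ p ^ m ∣ f.map (Rat.castHom ℚ_[2]) ∧
              ¬ p ^ (m + 1) ∣ f.map (Rat.castHom ℚ_[2])) →
            Even p.natDegree) (p : ℚ[X]) (hm : p.Monic) (hirr : Irreducible p)
    (hmult : ∃ m : ℕ, Odd m ∧ p ^ m ∣ f ∧ ¬ p ^ (m + 1) ∣ f) :
    ∃ u v : ℚ[X] ⧸ Ideal.span {p}, u ^ 2 + v ^ 2 = -1 := by
  obtain ⟨m, hmo, ⟨h, hfac⟩, hnd⟩ := hmult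
  have hph : ¬ p ∣ h := by
    rintro ⟨c, rfl⟩
    exact hnd ⟨c, by rw [hfac]; ring⟩
  apply adjoin_neg_one p hm hirr (no_real_root f p h m hmo hirr hfac hph hpos)
  intro g hgm hgi hgd
  have hcast : algebraMap ℚ ℚ_[2] = Rat.castHom ℚ_[2] := Subsingleton.elim _ _
  rw [hcast] at hgd
  apply h2 g hgm hgi
  obtain ⟨r, hr⟩ := hgd
  have hsep : (p.map (Rat.castHom ℚ_[2])).Separable := hirr.separable.map
  have hgr : ¬ g ∣ r := by
    rintro ⟨s, rfl⟩
    exact hgi.not_isUnit (hsep.squarefree g ⟨s, by rw [hr]; ring⟩)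
  have hgh : ¬ g ∣ h.map (Rat.castHom ℚ_[2]) := by
    intro hd
    have hcop : IsCoprime (p.map (Rat.castHom ℚ_[2])) (h.map (Rat.castHom ℚ_[2])) :=
      ((hirr.coprime_iff_not_dvd).mpr hph).map (mapRingHom (Rat.castHom ℚ_[2]))
    exact hgi.not_isUnit (hcop.isUnit_of_dvd' ⟨r, hr⟩ hd)
  have hfm : f.map (Rat.castHom ℚ_[2]) = g ^ m * (r ^ m * h.map (Rat.castHom ℚ_[2])) := by
    rw [hfac, Polynomial.map_mul, Polynomial.map_pow, hr]; ring
  refine ⟨m, hmo, ⟨_, hfm⟩, ?_⟩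
  rw [hfm, pow_succ, mul_dvd_mul_iff_left (pow_ne_zero _ hgi.ne_zero)]
  intro hd
  rcases hgi.prime.dvd_or_dvd hd with h' | h'
  · exact hgr (hgi.prime.dvd_of_dvd_pow h')
  · exact hgh h'

end Pourchet

theorem pourchet_four_squares_criterion (f : Polynomial ℚ) (hf : f ≠ 0) :
    List.TFAE
      [ (∃ p₁ p₂ p₃ p₄ : Polynomial ℚ, f = p₁ ^ 2 + p₂ ^ 2 + p₃ ^ 2 + p₄ ^ 2),
        (0 < f.leadingCoeff ∧
          ∀ p : Polynomial ℚ, p.Monic → Irreducible p →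
            (∃ m : ℕ, Odd m ∧ p ^ m ∣ f ∧ ¬ p ^ (m + 1) ∣ f) →
            ∃ u v : Polynomial ℚ ⧸ Ideal.span {p}, u ^ 2 + v ^ 2 = -1),
        ((∀ t : ℝ, 0 ≤ Polynomial.aeval t f) ∧
          ∀ p : Polynomial ℚ_[2], p.Monic → Irreducible p →
            (∃ m : ℕ, Odd m ∧ p ^ m ∣ f.map (Rat.castHom ℚ_[2]) ∧
              ¬ p ^ (m + 1) ∣ f.map (Rat.castHom ℚ_[2])) →
            Even p.natDegree) ] := by
  tfae_have 2 → 1 := fun h => Pourchet.two_imp_one f hf h.1 h.2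
  tfae_have 1 → 3 := fun h => Pourchet.one_imp_three f h
  tfae_have 3 → 2 := fun h =>
    ⟨Pourchet.leadingCoeff_pos_rat f hf h.1, Pourchet.three_imp_two f hf h.1 h.2⟩
  tfae_finish
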